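/- (Theorem 5.2(i), scalar two-obstacle problem) Assume (H0), (A1) and (A2). Then there exists a unique continuous viscosity solution u of polynomial growth of the PDE with two obstacles of min-max type: min{ u(t,x)-L(t,x) ; max[ u(t,x)-H(t,x) ; -\partial_t u(t,x)-\mathcal{L}^X u(t,x)-f(t,x,u(t,x),\sigma(t,x)^\top D_x u(t,x)) ] } = 0 on (0,T)\times\mathbb{R}^k, with u(T,x)=g(x). -/

import Mathlib

/- Scalar PDE with two obstacles of min-max type (Theorem 5.2(i) / Theorem `existence` (A2)).

Setting: `T > 0`, `k, d ≥ 1`.  `b, σ` satisfy (H0); data `g, f, H, L` are continuous and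
satisfy (A1), (A2).  Conclusion: there exists a unique continuous viscosity solution of
polynomial growth of
  min{ u - L ; max[ u - H ; -∂_t u - 𝓛^X u - f(t,x,u,σᵀ D_x u) ] } = 0 on (0,T)×ℝ^k,
  u(T,·) = g. -/

open Set Matrix

noncomputable section

abbrev Euc (k : ℕ) : Type := EuclideanSpace ℝ (Fin k)

/-- Partial derivative in the `i`-th coordinate direction. -/
noncomputable def pd {k : ℕ} (i : Fin k) (ψ : Euc k → ℝ) (x : Euc k) : ℝ :=
  fderiv ℝ ψ x (EuclideanSpace.single i 1)

/-- Time derivative of `φ(t,x)` in `t`. -/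
noncomputable def timeDeriv {k : ℕ} (φ : ℝ → Euc k → ℝ) (t : ℝ) (x : Euc k) : ℝ :=
  deriv (fun s => φ s x) t

/-- The second order generator
`𝓛^X φ(t,x) = ½ Tr[σσᵀ(t,x) D²_{xx} φ(t,x)] + b(t,x)ᵀ D_x φ(t,x)`. -/
noncomputable def genL {k d : ℕ} (b : ℝ → Euc k → Fin k → ℝ)
    (σm : ℝ → Euc k → Matrix (Fin k) (Fin d) ℝ) (φ : ℝ → Euc k → ℝ)
    (t : ℝ) (x : Euc k) : ℝ :=
  (1 / 2) * ∑ i, ∑ j, (σm t x * (σm t x)ᵀ) i j * pd i (fun y => pd j (φ t) y) x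
    + ∑ i, b t x i * pd i (φ t) x

/-- `σ(t,x)ᵀ D_x φ(t,x)` as a vector of `ℝ^d`. -/
noncomputable def sigGrad {k d : ℕ} (σm : ℝ → Euc k → Matrix (Fin k) (Fin d) ℝ)
    (φ : ℝ → Euc k → ℝ) (t : ℝ) (x : Euc k) : Fin d → ℝ :=
  fun l => ∑ i, σm t x i l * pd i (φ t) x

/-- `φ` is of class `C^{1,2}`: once differentiable in `t`, twice in `x`,
with (jointly) continuous derivatives. -/
def IsC12 {k : ℕ} (φ : ℝ → Euc k → ℝ) : Prop :=
  (∀ x, Differentiable ℝ fun s => φ s x) ∧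
  Continuous (fun p : ℝ × Euc k => deriv (fun s => φ s p.2) p.1) ∧
  (∀ t, ContDiff ℝ 2 (φ t)) ∧
  Continuous (fun p : ℝ × Euc k => fderiv ℝ (φ p.1) p.2) ∧
  Continuous (fun p : ℝ × Euc k => fderiv ℝ (fderiv ℝ (φ p.1)) p.2)

/-- Polynomial growth on `[0,T] × ℝ^k`. -/
def PolyGrowth {k : ℕ} (T : ℝ) (Φ : ℝ → Euc k → ℝ) : Prop :=
  ∃ C γ : ℝ, 0 ≤ C ∧ 0 ≤ γ ∧ ∀ t ∈ Icc (0 : ℝ) T, ∀ x : Euc k, |Φ t x| ≤ C * (1 + ‖x‖ ^ γ)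

/-- (H0): `b` and `σ` are jointly continuous and Lipschitz in `x` uniformly in `t`. -/
def H0 {k d : ℕ} (T : ℝ) (b : ℝ → Euc k → Fin k → ℝ)
    (σm : ℝ → Euc k → Matrix (Fin k) (Fin d) ℝ) : Prop :=
  Continuous (fun p : ℝ × Euc k => b p.1 p.2) ∧
  Continuous (fun p : ℝ × Euc k => σm p.1 p.2) ∧
  ∃ C : ℝ, ∀ t ∈ Icc (0 : ℝ) T, ∀ x x' : Euc k,
    (∀ i, |b t x i - b t x' i| ≤ C * ‖x - x'‖) ∧
    (∀ i l, |σm t x i l - σm t x' i l| ≤ C * ‖x - x'‖)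

/-- Viscosity subsolution of the terminal value problem
`F(t, x, u, ∂_t u, 𝓛^X u, σᵀ D_x u) = 0` on `(0,T) × ℝ^k`, `u(T,·) = gT`. -/
def IsViscSubsol {k d : ℕ} (T : ℝ) (b : ℝ → Euc k → Fin k → ℝ)
    (σm : ℝ → Euc k → Matrix (Fin k) (Fin d) ℝ) (gT : Euc k → ℝ)
    (F : ℝ → Euc k → ℝ → ℝ → ℝ → (Fin d → ℝ) → ℝ) (u : ℝ → Euc k → ℝ) : Prop :=
  (∀ x, u T x ≤ gT x) ∧
  ∀ t x, t ∈ Ioo (0 : ℝ) T → ∀ φ : ℝ → Euc k → ℝ, IsC12 φ →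
    IsLocalMax (fun p : ℝ × Euc k => u p.1 p.2 - φ p.1 p.2) (t, x) →
    u t x = φ t x →
    F t x (u t x) (timeDeriv φ t x) (genL b σm φ t x) (sigGrad σm φ t x) ≤ 0

/-- Viscosity supersolution. -/
def IsViscSupersol {k d : ℕ} (T : ℝ) (b : ℝ → Euc k → Fin k → ℝ)
    (σm : ℝ → Euc k → Matrix (Fin k) (Fin d) ℝ) (gT : Euc k → ℝ)
    (F : ℝ → Euc k → ℝ → ℝ → ℝ → (Fin d → ℝ) → ℝ) (u : ℝ → Euc k → ℝ) : Prop :=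
  (∀ x, gT x ≤ u T x) ∧
  ∀ t x, t ∈ Ioo (0 : ℝ) T → ∀ φ : ℝ → Euc k → ℝ, IsC12 φ →
    IsLocalMin (fun p : ℝ × Euc k => u p.1 p.2 - φ p.1 p.2) (t, x) →
    u t x = φ t x →
    0 ≤ F t x (u t x) (timeDeriv φ t x) (genL b σm φ t x) (sigGrad σm φ t x)

/-- Viscosity solution: both a subsolution and a supersolution. -/
def IsViscSol {k d : ℕ} (T : ℝ) (b : ℝ → Euc k → Fin k → ℝ)
    (σm : ℝ → Euc k → Matrix (Fin k) (Fin d) ℝ) (gT : Euc k → ℝ)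
    (F : ℝ → Euc k → ℝ → ℝ → ℝ → (Fin d → ℝ) → ℝ) (u : ℝ → Euc k → ℝ) : Prop :=
  IsViscSubsol T b σm gT F u ∧ IsViscSupersol T b σm gT F u

/-- The min-max two obstacles expression
`min{ u - L ; max[ u - H ; -∂_t u - 𝓛^X u - f(t,x,u,σᵀD_x u) ] }`. -/
noncomputable def Fmm {k d : ℕ} (f : ℝ → Euc k → ℝ → (Fin d → ℝ) → ℝ)
    (Lf Hf : ℝ → Euc k → ℝ) : ℝ → Euc k → ℝ → ℝ → ℝ → (Fin d → ℝ) → ℝ :=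
  fun t x uv dtφ Lφ zφ =>
    min (uv - Lf t x) (max (uv - Hf t x) (-dtφ - Lφ - f t x uv zφ))

section

open Filter Topology MeasureTheory
open scoped RealInnerProductSpace NNReal

theorem abs_sub_le_of_forall_abs_sub_le_add_sq {φ : ℝ → ℝ} {m K : ℝ}
    (h : ∀ s ∈ Icc (0 : ℝ) 1, ∀ t ∈ Icc (0 : ℝ) 1,
      φ t - φ s ≤ m * |t - s| + K * (t - s) ^ 2) : |φ 1 - φ 0| ≤ m := by
  have key : ∀ n : ℕ, |φ 1 - φ 0| ≤ m + K * (1 / ((n : ℝ) + 1)) := by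
    intro n
    have hn : (0 : ℝ) < (n : ℝ) + 1 := by positivity
    have step : ∀ j : ℕ, j ≤ n + 1 →
        |φ ((j : ℝ) / (n + 1)) - φ 0| ≤ j * (m / (n + 1) + K / ((n : ℝ) + 1) ^ 2) := by
      intro j
      induction j with
      | zero => intro _; simp
      | succ j ih =>
        intro hj
        have ih' := ih (by omega)
        have hj' : (j : ℝ) + 1 ≤ n + 1 := by exact_mod_cast hj
        have m1 : (j : ℝ) / (n + 1) ∈ Icc (0 : ℝ) 1 :=
          ⟨by positivity, by rw [div_le_one hn]; linarith⟩
        have m2 : ((j : ℝ) + 1) / (n + 1) ∈ Icc (0 : ℝ) 1 :=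
          ⟨by positivity, by rw [div_le_one hn]; linarith⟩
        have e : ((j : ℝ) + 1) / (n + 1) - (j : ℝ) / (n + 1) = 1 / (n + 1) := by
          field_simp; ring
        have h1 := h _ m1 _ m2
        have h2 := h _ m2 _ m1
        rw [abs_sub_comm, show ((j : ℝ) / (n + 1) - ((j : ℝ) + 1) / (n + 1)) ^ 2 =
          (((j : ℝ) + 1) / (n + 1) - (j : ℝ) / (n + 1)) ^ 2 by ring] at h2
        rw [e, abs_of_pos (by positivity)] at h1 h2
        have e2 : m * (1 / ((n : ℝ) + 1)) + K * (1 / ((n : ℝ) + 1)) ^ 2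
            = m / (n + 1) + K / ((n : ℝ) + 1) ^ 2 := by field_simp
        rw [e2] at h1 h2
        push_cast
        rw [abs_le] at ih' ⊢
        constructor <;> linarith [ih'.1, ih'.2]
    have := step (n + 1) le_rfl
    push_cast at this
    rw [div_self hn.ne'] at this
    refine this.trans (le_of_eq ?_)
    field_simp
  have hlim : Tendsto (fun n : ℕ => m + K * (1 / ((n : ℝ) + 1))) atTop (𝓝 (m + K * 0)) :=
    (tendsto_one_div_add_atTop_nhds_zero_nat.const_mul K).const_add m
  simpa using ge_of_tendsto' hlim key

section SemiconvexMax

variable {X : Type*} [NormedAddCommGroup X] [InnerProductSpace ℝ X]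

theorem norm_le_of_forall_inner_le {v h : X} {c : ℝ} (hc : 0 ≤ c)
    (H : ∀ e, ⟪v, e⟫ ≤ c * ‖h + e‖ ^ 2) : ‖v‖ ≤ 4 * c * ‖h‖ := by
  by_contra hlt
  push Not at hlt
  have hv : 0 < ‖v‖ := lt_of_le_of_lt (by positivity) hlt
  have main : ∀ τ : ℝ, 0 < τ → τ * ‖v‖ ^ 2 ≤ c * (‖h‖ + τ * ‖v‖) ^ 2 := by
    intro τ hτ
    have h1 := H (τ • v)
    rw [inner_smul_right, real_inner_self_eq_norm_sq] at h1
    have h2 : ‖h + τ • v‖ ≤ ‖h‖ + τ * ‖v‖ := by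
      refine (norm_add_le _ _).trans ?_
      rw [norm_smul, Real.norm_of_nonneg hτ.le]
    refine h1.trans ?_
    gcongr
  rcases eq_or_ne h 0 with rfl | hh
  · have := main (1 / (c + 1)) (by positivity)
    simp only [norm_zero, zero_add] at this
    have h3 : (1 / (c + 1)) * ‖v‖ ^ 2 * 1 ≤ (1 / (c + 1)) * ‖v‖ ^ 2 * (c / (c + 1)) := by
      calc _ = (1 / (c + 1)) * ‖v‖ ^ 2 := by ring
        _ ≤ _ := this
        _ = _ := by field_simp
    have h4 := le_of_mul_le_mul_left h3 (by positivity)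
    rw [le_div_iff₀ (by positivity)] at h4
    linarith
  · have hh' : 0 < ‖h‖ := norm_pos_iff.mpr hh
    have := main (‖h‖ / ‖v‖) (by positivity)
    rw [div_mul_cancel₀ _ hv.ne'] at this
    have e : ‖h‖ / ‖v‖ * ‖v‖ ^ 2 = ‖h‖ * ‖v‖ := by field_simp
    rw [e] at this
    nlinarith

/-- If a selection `s` of subgradients of `f` is differentiable at `x`, with derivative `A`, then
`f` has a second order Taylor expansion at `x`. -/
theorem taylor_of_subgradient {f : X → ℝ} {s : X → X} (hs : ∀ y h, f y + ⟪s y, h⟫ ≤ f (y + h))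
    {x : X} {A : X →L[ℝ] X}
    (hA : ∀ ε > 0, ∀ᶠ h in 𝓝 (0 : X), ‖s (x + h) - s x - A h‖ ≤ ε * ‖h‖) :
    ∀ ε > 0, ∀ᶠ h in 𝓝 (0 : X),
      |f (x + h) - f x - ⟪s x, h⟫ - (1 / 2) * ⟪A h, h⟫| ≤ ε * ‖h‖ ^ 2 := by
  intro ε hε
  obtain ⟨ρ, hρ, hball⟩ := Metric.eventually_nhds_iff_ball.1 (hA ε hε)
  filter_upwards [Metric.ball_mem_nhds (0 : X) hρ] with h hh
  have key := abs_sub_le_of_forall_abs_sub_le_add_sq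
    (φ := fun τ => f (x + τ • h) - f x - τ * ⟪s x, h⟫ - τ ^ 2 / 2 * ⟪A h, h⟫)
    (m := ε * ‖h‖ ^ 2) (K := |⟪A h, h⟫| / 2) ?_
  · simpa using key
  intro a ha b hb
  have h1 := hs (x + b • h) ((a - b) • h)
  have e1 : x + b • h + (a - b) • h = x + a • h := by module
  rw [e1, inner_smul_right] at h1
  have hbh : b • h ∈ Metric.ball (0 : X) ρ := by
    rw [mem_ball_zero_iff] at hh ⊢
    rw [norm_smul, Real.norm_of_nonneg hb.1]
    nlinarith [hb.2, norm_nonneg h]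
  have h2 := hball _ hbh
  set R := s (x + b • h) - s x - A (b • h) with hR
  have h3 : ⟪s (x + b • h), h⟫ = ⟪R, h⟫ + ⟪s x, h⟫ + b * ⟪A h, h⟫ := by
    rw [hR, map_smul, inner_sub_left, inner_sub_left, inner_smul_left, conj_trivial]; ring
  have h4 : |⟪R, h⟫| ≤ ε * ‖h‖ ^ 2 := by
    refine (abs_real_inner_le_norm _ _).trans ?_
    have : ‖b • h‖ ≤ ‖h‖ := by
      rw [norm_smul, Real.norm_of_nonneg hb.1]
      nlinarith [hb.2, norm_nonneg h]
    calc ‖R‖ * ‖h‖ ≤ (ε * ‖h‖) * ‖h‖ := by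
          gcongr; exact h2.trans (by gcongr)
      _ = _ := by ring
  rw [h3] at h1
  have h5 : (b - a) * ⟪R, h⟫ ≤ ε * ‖h‖ ^ 2 * |b - a| := by
    calc (b - a) * ⟪R, h⟫ ≤ |(b - a) * ⟪R, h⟫| := le_abs_self _
      _ = |b - a| * |⟪R, h⟫| := abs_mul _ _
      _ ≤ |b - a| * (ε * ‖h‖ ^ 2) := by gcongr
      _ = _ := by ring
  have h6 : (b - a) ^ 2 / 2 * ⟪A h, h⟫ ≤ |⟪A h, h⟫| / 2 * (b - a) ^ 2 := by
    have := le_abs_self ⟪A h, h⟫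
    nlinarith [sq_nonneg (b - a)]
  linarith [h1, h5, h6]

variable [FiniteDimensional ℝ X]

theorem exists_contact_taylor_aux {m : X → ℝ} {C κ : ℝ} (hC : 0 ≤ C) (hκ : 0 < κ)
    (hm : Continuous m)
    (hsc : ∀ x, ∃ q : X, ∀ h, m x + ⟪q, h⟫ - C / 2 * ‖h‖ ^ 2 ≤ m (x + h)) {x₀ : X}
    (hmax : ∀ x, m x ≤ m x₀ - κ / 2 * ‖x - x₀‖ ^ 2) {r : ℝ} (hr : 0 < r) :
    ∃ (x p : X) (A : X →L[ℝ] X), ‖x - x₀‖ ≤ r ∧ ‖p‖ ≤ r ∧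
      (∀ h, m (x + h) ≤ m x + ⟪p, h⟫) ∧
      ∀ ε > 0, ∀ᶠ h in 𝓝 (0 : X),
        |m (x + h) - m x - ⟪p, h⟫ - (1 / 2) * ⟪A h, h⟫| ≤ ε * ‖h‖ ^ 2 := by
  let _ : MeasurableSpace X := borel X
  have _ : BorelSpace X := ⟨rfl⟩
  set f : X → ℝ := fun x => m x + C / 2 * ‖x‖ ^ 2 with hf
  choose q hq using hsc
  set s : X → X := fun x => q x + C • x with hs_def
  have hs : ∀ y h, f y + ⟪s y, h⟫ ≤ f (y + h) := by
    intro y h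
    have := hq y h
    simp only [hf, hs_def, inner_add_left, inner_smul_left, norm_add_sq_real]
    simp only [conj_trivial]
    nlinarith
  set Z : X → X := fun x => x + s x with hZ
  have hanti : ∀ y z, ‖y - z‖ ≤ ‖Z y - Z z‖ := by
    intro y z
    have h1 := hs y (z - y)
    have h2 := hs z (y - z)
    rw [add_sub_cancel] at h1 h2
    have h3 : 0 ≤ ⟪s y - s z, y - z⟫ := by
      have : ⟪s y, z - y⟫ = - ⟪s y, y - z⟫ := by rw [← inner_neg_right, neg_sub]
      rw [inner_sub_left]; linarith
    have h4 : ‖y - z‖ ^ 2 ≤ ⟪Z y - Z z, y - z⟫ := by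
      have : Z y - Z z = (y - z) + (s y - s z) := by simp only [hZ]; abel
      rw [this, inner_add_left, real_inner_self_eq_norm_sq]; linarith
    have h5 := h4.trans (real_inner_le_norm _ _)
    rcases (norm_nonneg (y - z)).eq_or_lt with h0 | h0
    · rw [← h0]; positivity
    · nlinarith
  have hinj : Function.Injective Z := by
    intro y z hyz
    have := hanti y z
    rw [hyz, sub_self, norm_zero] at this
    exact sub_eq_zero.1 (norm_le_zero_iff.1 this)
  obtain ⟨P, K, hPL, hPZ⟩ : ∃ (P : X → X) (K : ℝ≥0), LipschitzWith K P ∧ ∀ y, P (Z y) = y := by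
    have hlip : LipschitzOnWith 1 (Function.invFun Z) (range Z) := by
      apply LipschitzOnWith.of_dist_le_mul
      rintro _ ⟨y, rfl⟩ _ ⟨z, rfl⟩
      rw [Function.leftInverse_invFun hinj, Function.leftInverse_invFun hinj, dist_eq_norm,
        dist_eq_norm, NNReal.coe_one, one_mul]
      exact hanti y z
    obtain ⟨P, hP, hPe⟩ := hlip.extend_finite_dimension
    exact ⟨P, _, hP, fun y => by
      rw [← hPe (mem_range_self y), Function.leftInverse_invFun hinj]⟩
  -- maximizers of linearly tilted functions
  have hmaxp : ∀ p : X, ‖p‖ ≤ min r (κ * r / 4) →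
      ∃ x, ‖x - x₀‖ ≤ r ∧ ∀ h, m (x + h) ≤ m x + ⟪p, h⟫ := by
    intro p hp
    obtain ⟨x, hx, hxm⟩ := (isCompact_closedBall x₀ r).exists_isMaxOn
      (f := fun y => m y - ⟪p, y⟫) ⟨x₀, Metric.mem_closedBall_self hr.le⟩ (by fun_prop)
    refine ⟨x, by simpa [dist_eq_norm] using hx, fun h => ?_⟩
    have hall : ∀ y, m y - ⟪p, y⟫ ≤ m x - ⟪p, x⟫ := by
      intro y
      by_cases hy : y ∈ Metric.closedBall x₀ r
      · exact hxm hy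
      · have hy' : r < ‖y - x₀‖ := by simpa [dist_eq_norm] using hy
        have h1 : m x₀ - ⟪p, x₀⟫ ≤ m x - ⟪p, x⟫ := hxm (Metric.mem_closedBall_self hr.le)
        have h2 := hmax y
        have h3 : -⟪p, y - x₀⟫ ≤ ‖p‖ * ‖y - x₀‖ :=
          (neg_le_abs _).trans (abs_real_inner_le_norm _ _)
        rw [inner_sub_right] at h3
        have h4 : ‖p‖ ≤ κ * r / 4 := hp.trans (min_le_right _ _)
        have h5 : ‖p‖ * ‖y - x₀‖ ≤ κ / 2 * ‖y - x₀‖ ^ 2 := by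
          calc ‖p‖ * ‖y - x₀‖ ≤ (κ * r / 4) * ‖y - x₀‖ := by gcongr
            _ ≤ (κ / 2 * ‖y - x₀‖) * ‖y - x₀‖ := by gcongr; nlinarith
            _ = _ := by ring
        linarith
    have := hall (x + h)
    rw [inner_add_right] at this
    linarith
  have hcontact : ∀ p x, (∀ h, m (x + h) ≤ m x + ⟪p, h⟫) →
      s x = p + C • x ∧ ∀ h, ‖s (x + h) - s x‖ ≤ 2 * C * ‖h‖ := by
    intro p x hx
    have hfu : ∀ h, f (x + h) ≤ f x + ⟪p + C • x, h⟫ + C / 2 * ‖h‖ ^ 2 := by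
      intro h
      have := hx h
      simp only [hf, inner_add_left, inner_smul_left, norm_add_sq_real, conj_trivial]
      nlinarith
    have hb : ∀ h, ‖s (x + h) - (p + C • x)‖ ≤ 4 * (C / 2) * ‖h‖ := by
      intro h
      apply norm_le_of_forall_inner_le (by positivity)
      intro e
      have h1 := hs x h
      have h2 := hs (x + h) e
      have h3 := hfu (h + e)
      have h4 := hfu h
      have h5 := hs (x + h) (-h)
      rw [← add_assoc] at h3
      rw [inner_sub_left]
      rw [inner_add_right] at h3
      have h6 : s x = p + C • x := by
        have : ‖s x - (p + C • x)‖ ≤ 4 * (C / 2) * ‖(0 : X)‖ := by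
          apply norm_le_of_forall_inner_le (by positivity)
          intro e
          rw [zero_add, inner_sub_left]
          linarith [hs x e, hfu e]
        rw [norm_zero, mul_zero] at this
        exact sub_eq_zero.1 (norm_le_zero_iff.1 this)
      rw [h6] at h1
      linarith
    have h0 : s x = p + C • x := by
      have := hb 0
      rw [norm_zero, mul_zero, add_zero] at this
      exact sub_eq_zero.1 (norm_le_zero_iff.1 this)
    refine ⟨h0, fun h => ?_⟩
    rw [h0]
    exact (hb h).trans (le_of_eq (by ring))
  obtain ⟨p, x, hp, hx, hxm, hdiff⟩ : ∃ p x, ‖p‖ ≤ r ∧ ‖x - x₀‖ ≤ r ∧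
      (∀ h, m (x + h) ≤ m x + ⟪p, h⟫) ∧ DifferentiableAt ℝ P (Z x) := by
    by_contra hcon
    push Not at hcon
    let μ : Measure X := Measure.hausdorffMeasure (Module.finrank ℝ X)
    have hN : μ {z | ¬ DifferentiableAt ℝ P z} = 0 := hPL.ae_differentiableAt
    have hT : LipschitzWith (1 + (‖(1 + C : ℝ)‖₊) * K) (fun z => z - (1 + C) • P z) :=
      LipschitzWith.id.sub ((lipschitzWith_smul (1 + C : ℝ)).comp hPL)
    have h0 : μ ((fun z => z - (1 + C) • P z) '' {z | ¬ DifferentiableAt ℝ P z}) = 0 := by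
      have := hT.hausdorffMeasure_image_le (d := Module.finrank ℝ X) (by positivity)
        {z | ¬ DifferentiableAt ℝ P z}
      refine le_antisymm (this.trans ?_) (by positivity)
      change _ * μ _ ≤ 0
      rw [hN, mul_zero]
    have hr' : 0 < min r (κ * r / 4) := by positivity
    have hsub : Metric.ball (0 : X) (min r (κ * r / 4)) ⊆
        (fun z => z - (1 + C) • P z) '' {z | ¬ DifferentiableAt ℝ P z} := by
      intro p hp
      rw [mem_ball_zero_iff] at hp
      obtain ⟨x, hx, hxm⟩ := hmaxp p hp.le
      refine ⟨Z x, hcon p x (hp.le.trans (min_le_left _ _)) hx hxm, ?_⟩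
      simp only [hPZ]
      simp only [hZ, (hcontact p x hxm).1]
      module
    have := measure_mono_null hsub h0
    exact (Metric.measure_ball_pos μ (0 : X) hr').ne' this
  obtain ⟨hsx, hsL⟩ := hcontact p x hxm
  set D := fderiv ℝ P (Z x) with hD
  have hkb : ∀ h, ‖Z (x + h) - Z x‖ ≤ (1 + 2 * C) * ‖h‖ := by
    intro h
    have : Z (x + h) - Z x = h + (s (x + h) - s x) := by simp only [hZ]; abel
    rw [this]
    linarith [norm_add_le h (s (x + h) - s x), hsL h]
  have hlin : ∀ ε > 0, ∀ᶠ h in 𝓝 (0 : X), ‖h - D (Z (x + h) - Z x)‖ ≤ ε * ‖h‖ := by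
    intro ε hε
    have h1 := hdiff.hasFDerivAt.isLittleO
    have h2 := h1.def (c := ε / (1 + 2 * C)) (by positivity)
    have ht : Tendsto (fun h => Z (x + h)) (𝓝 0) (𝓝 (Z x)) := by
      rw [tendsto_iff_norm_sub_tendsto_zero]
      refine squeeze_zero (fun _ => norm_nonneg _) hkb ?_
      have : Continuous fun h : X => (1 + 2 * C) * ‖h‖ := by fun_prop
      simpa using this.tendsto 0
    filter_upwards [ht.eventually h2] with h hh
    rw [hPZ, hPZ, add_sub_cancel_left] at hh
    refine hh.trans ?_
    calc ε / (1 + 2 * C) * ‖Z (x + h) - Z x‖ ≤ ε / (1 + 2 * C) * ((1 + 2 * C) * ‖h‖) := by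
          gcongr; exact hkb h
      _ = ε * ‖h‖ := by field_simp
  have hsurj : Function.Surjective D := by
    intro h
    have hcl : h ∈ closure (LinearMap.range D.toLinearMap : Set X) := by
      rw [Metric.mem_closure_iff]
      intro ε hε
      rcases eq_or_ne h 0 with rfl | hh
      · exact ⟨0, zero_mem _, by simpa using hε⟩
      have hh' := norm_pos_iff.2 hh
      have hev := hlin (ε / (2 * ‖h‖)) (by positivity)
      have htt : Tendsto (fun t : ℝ => t • h) (𝓝[>] 0) (𝓝 0) := by
        have : Continuous fun t : ℝ => t • h := by fun_prop
        simpa using (this.tendsto 0).mono_left nhdsWithin_le_nhds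
      obtain ⟨t, ht1, ht0⟩ := ((htt.eventually hev).and self_mem_nhdsWithin).exists
      have ht0 : 0 < t := ht0
      refine ⟨D (t⁻¹ • (Z (x + t • h) - Z x)), ⟨_, rfl⟩, ?_⟩
      rw [dist_eq_norm, map_smul]
      have : h - t⁻¹ • D (Z (x + t • h) - Z x) = t⁻¹ • (t • h - D (Z (x + t • h) - Z x)) := by
        rw [smul_sub, smul_smul, inv_mul_cancel₀ ht0.ne', one_smul]
      rw [this, norm_smul, norm_inv, Real.norm_of_nonneg ht0.le]
      rw [norm_smul, Real.norm_of_nonneg ht0.le] at ht1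
      calc t⁻¹ * ‖t • h - D (Z (x + t • h) - Z x)‖
          ≤ t⁻¹ * (ε / (2 * ‖h‖) * (t * ‖h‖)) := by gcongr
        _ = ε / 2 := by field_simp
        _ < ε := by linarith
    rwa [IsClosed.closure_eq (Submodule.closed_of_finiteDimensional _)] at hcl
  have hDinj : Function.Injective D :=
    (LinearMap.injective_iff_surjective (f := D.toLinearMap)).2 hsurj
  let e : X ≃L[ℝ] X :=
    (LinearEquiv.ofBijective D.toLinearMap ⟨hDinj, hsurj⟩).toContinuousLinearEquiv
  have he : ∀ v, e v = D v := fun v => rfl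
  let B : X →L[ℝ] X := (e.symm : X →L[ℝ] X) - ContinuousLinearMap.id ℝ X
  have hB : ∀ ε > 0, ∀ᶠ h in 𝓝 (0 : X), ‖s (x + h) - s x - B h‖ ≤ ε * ‖h‖ := by
    intro ε hε
    have hM : 0 ≤ ‖(e.symm : X →L[ℝ] X)‖ := norm_nonneg _
    filter_upwards [hlin (ε / (‖(e.symm : X →L[ℝ] X)‖ + 1)) (by positivity)] with h hh
    have : s (x + h) - s x - B h = -(e.symm : X →L[ℝ] X) (h - D (Z (x + h) - Z x)) := by
      have h1 : (e.symm : X →L[ℝ] X) (D (Z (x + h) - Z x)) = Z (x + h) - Z x := by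
        rw [← he]; simp
      rw [map_sub, h1]
      simp only [B, hZ, _root_.sub_apply, ContinuousLinearMap.id_apply]
      abel
    rw [this, norm_neg]
    refine (ContinuousLinearMap.le_opNorm _ _).trans ?_
    calc _ ≤ ‖(e.symm : X →L[ℝ] X)‖ * (ε / (‖(e.symm : X →L[ℝ] X)‖ + 1) * ‖h‖) := by gcongr
      _ = (‖(e.symm : X →L[ℝ] X)‖ / (‖(e.symm : X →L[ℝ] X)‖ + 1)) * (ε * ‖h‖) := by ring
      _ ≤ 1 * (ε * ‖h‖) := by
          gcongr
          rw [div_le_one (by positivity)]; linarith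
      _ = _ := one_mul _
  refine ⟨x, p, B - C • ContinuousLinearMap.id ℝ X, hx, hp, hxm, fun ε hε => ?_⟩
  filter_upwards [taylor_of_subgradient hs hB ε hε] with h hh
  convert hh using 2
  simp only [hf, hsx, inner_add_left, inner_smul_left, norm_add_sq_real, conj_trivial,
    _root_.sub_apply, _root_.smul_apply, ContinuousLinearMap.id_apply,
    inner_sub_left, real_inner_self_eq_norm_sq]
  ring

/-- **Jensen–Alexandrov lemma.** Near a global maximum point of a semiconvex function there are
points having a second order Taylor expansion whose first order part is almost zero and whose
second order part is almost nonpositive. -/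
theorem exists_taylor_near_max {w : X → ℝ} {C : ℝ} (hC : 0 ≤ C) (hw : Continuous w)
    (hsc : ∀ x, ∃ q : X, ∀ h, w x + ⟪q, h⟫ - C / 2 * ‖h‖ ^ 2 ≤ w (x + h)) {x₀ : X}
    (hmax : ∀ x, w x ≤ w x₀) {κ : ℝ} (hκ : 0 < κ) :
    ∃ (x p : X) (A : X →L[ℝ] X), ‖x - x₀‖ ≤ κ ∧ ‖p‖ ≤ κ ∧
      (∀ h, w (x + h) ≤ w x + ⟪p, h⟫ + κ / 2 * ‖h‖ ^ 2) ∧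
      ∀ ε > 0, ∀ᶠ h in 𝓝 (0 : X),
        |w (x + h) - w x - ⟪p, h⟫ - (1 / 2) * ⟪A h, h⟫| ≤ ε * ‖h‖ ^ 2 := by
  set m : X → ℝ := fun x => w x - κ / 2 * ‖x - x₀‖ ^ 2 with hm
  have hexp : ∀ x h : X, ‖x + h - x₀‖ ^ 2 = ‖x - x₀‖ ^ 2 + 2 * ⟪x - x₀, h⟫ + ‖h‖ ^ 2 := by
    intro x h
    rw [show x + h - x₀ = (x - x₀) + h by abel, norm_add_sq_real]
  obtain ⟨x, p, A, hx, hp, hup, hT⟩ := exists_contact_taylor_aux (m := m) (C := C + κ) (κ := κ)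
    (x₀ := x₀) (r := min κ (min 1 κ / 2) / 2) (by positivity) hκ (by fun_prop) (by
      intro x
      obtain ⟨q, hq⟩ := hsc x
      refine ⟨q - κ • (x - x₀), fun h => ?_⟩
      have := hq h
      simp only [hm, hexp, inner_sub_left (q), inner_smul_left, conj_trivial]
      nlinarith) (by
      intro x
      have := hmax x
      simp only [hm, sub_self, norm_zero]
      nlinarith) (by positivity)
  have h1 : min κ (min 1 κ / 2) ≤ κ := min_le_left _ _
  have h2 : min κ (min 1 κ / 2) ≤ min 1 κ / 2 := min_le_right _ _
  have h3 : min 1 κ ≤ 1 := min_le_left _ _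
  have h4 : min 1 κ ≤ κ := min_le_right _ _
  refine ⟨x, p + κ • (x - x₀), A + κ • ContinuousLinearMap.id ℝ X, by linarith, ?_, ?_, ?_⟩
  · refine (norm_add_le _ _).trans ?_
    rw [norm_smul, Real.norm_of_nonneg hκ.le]
    have : κ * ‖x - x₀‖ ≤ κ * (1 / 2) := by gcongr; linarith
    linarith
  · intro h
    have := hup h
    simp only [hm, hexp, inner_add_left, inner_smul_left, conj_trivial] at this ⊢
    linarith
  · intro ε hε
    filter_upwards [hT ε hε] with h hh
    convert hh using 2
    simp only [hm, hexp, inner_add_left, inner_smul_left, conj_trivial,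
      _root_.add_apply, _root_.smul_apply, ContinuousLinearMap.id_apply,
      real_inner_self_eq_norm_sq]
    ring

end SemiconvexMax

section Sums

variable {X : Type*} [NormedAddCommGroup X] [InnerProductSpace ℝ X]
variable {Y : Type*} [NormedAddCommGroup Y] [NormedSpace ℝ Y]

/-- Sup-convolution over a compact set. -/
theorem exists_supConvolution {K : Set Y} (hK : IsCompact K) (hne : K.Nonempty) {u : Y → ℝ}
    (hu : UpperSemicontinuousOn u K) (M : Y →L[ℝ] X) :
    ∃ a : X → ℝ, Continuous a ∧
      (∀ ξ, ∃ P ∈ K, a ξ = u P - 3 / 2 * ‖ξ - M P‖ ^ 2) ∧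
      (∀ ξ, ∀ P ∈ K, u P - 3 / 2 * ‖ξ - M P‖ ^ 2 ≤ a ξ) := by
  have hex : ∀ ξ, ∃ P ∈ K, IsMaxOn (fun P => u P + -(3 / 2 * ‖ξ - M P‖ ^ 2)) K P := by
    intro ξ
    refine UpperSemicontinuousOn.exists_isMaxOn hne hK (hu.add ?_)
    exact ContinuousOn.upperSemicontinuousOn (by fun_prop)
  choose P hPK hP using hex
  set a : X → ℝ := fun ξ => u (P ξ) - 3 / 2 * ‖ξ - M (P ξ)‖ ^ 2 with ha
  have hle : ∀ ξ, ∀ Q ∈ K, u Q - 3 / 2 * ‖ξ - M Q‖ ^ 2 ≤ a ξ := by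
    intro ξ Q hQ
    have := hP ξ hQ
    simp only [Set.mem_ofPred_eq] at this
    simp only [ha]; linarith
  refine ⟨a, ?_, fun ξ => ⟨P ξ, hPK ξ, rfl⟩, hle⟩
  obtain ⟨R, hR⟩ := (hK.image M.continuous).isBounded.exists_norm_le
  have hR0 : 0 ≤ R := (norm_nonneg _).trans (hR _ (mem_image_of_mem _ hne.some_mem))
  have hlip : LipschitzWith (3 * R).toNNReal (fun ξ => a ξ + 3 / 2 * ‖ξ‖ ^ 2) := by
    apply LipschitzWith.of_le_add_mul
    intro ξ ζ
    rw [Real.coe_toNNReal _ (by positivity), dist_eq_norm]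
    have h1 := hle ζ (P ξ) (hPK ξ)
    have h2 : ⟪ξ - ζ, M (P ξ)⟫ ≤ ‖ξ - ζ‖ * R :=
      (real_inner_le_norm _ _).trans (by gcongr; exact hR _ (mem_image_of_mem _ (hPK ξ)))
    rw [inner_sub_left] at h2
    simp only [ha] at h1 ⊢
    rw [norm_sub_sq_real] at h1 ⊢
    linarith
  have : a = fun ξ => (a ξ + 3 / 2 * ‖ξ‖ ^ 2) - 3 / 2 * ‖ξ‖ ^ 2 := by ext; ring
  rw [this]
  exact hlip.continuous.sub (by fun_prop)

theorem semiconvex_supConvolution {K : Set Y} {u : Y → ℝ} {M : Y →L[ℝ] X} {a : X → ℝ}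
    (h1 : ∀ ξ, ∃ P ∈ K, a ξ = u P - 3 / 2 * ‖ξ - M P‖ ^ 2)
    (h2 : ∀ ξ, ∀ P ∈ K, u P - 3 / 2 * ‖ξ - M P‖ ^ 2 ≤ a ξ) (ξ : X) :
    ∃ q : X, ∀ h, a ξ + ⟪q, h⟫ - 3 / 2 * ‖h‖ ^ 2 ≤ a (ξ + h) := by
  obtain ⟨P, hP, e⟩ := h1 ξ
  refine ⟨-(3 : ℝ) • (ξ - M P), fun h => ?_⟩
  have := h2 (ξ + h) P hP
  rw [show ξ + h - M P = (ξ - M P) + h by abel, norm_add_sq_real] at this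
  rw [e, inner_smul_left]
  simp only [conj_trivial]
  linarith

/-- A paraboloid-type expansion of a sup-convolution is inherited by the function itself. -/
theorem superjet_of_supConvolution {K : Set Y} {u : Y → ℝ} {M : Y →L[ℝ] X} {a : X → ℝ}
    (h2 : ∀ ξ, ∀ P ∈ K, u P - 3 / 2 * ‖ξ - M P‖ ^ 2 ≤ a ξ) {ξ : X} {P : Y}
    (hP : a ξ = u P - 3 / 2 * ‖ξ - M P‖ ^ 2) {p : X} {A : X →L[ℝ] X}
    (hT : ∀ ε > 0, ∀ᶠ h in 𝓝 (0 : X),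
      a (ξ + h) ≤ a ξ + ⟪p, h⟫ + (1 / 2) * ⟪A h, h⟫ + ε * ‖h‖ ^ 2) :
    ∀ ε > 0, ∀ᶠ P' in 𝓝 P, P' ∈ K → u P' ≤ u P + ⟪p, M (P' - P)⟫ +
      (1 / 2) * ⟪A (M (P' - P)), M (P' - P)⟫ + ε * ‖M (P' - P)‖ ^ 2 := by
  intro ε hε
  have ht : Tendsto (fun P' => M (P' - P)) (𝓝 P) (𝓝 0) := by
    have : Continuous fun P' => M (P' - P) := by fun_prop
    simpa using this.tendsto P
  filter_upwards [ht.eventually (hT ε hε)] with P' h hPK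
  have := h2 (ξ + M (P' - P)) P' hPK
  rw [show ξ + M (P' - P) - M P' = ξ - M P by rw [map_sub]; abel] at this
  linarith

theorem le_zero_of_sq_expansion {c : ℝ} (h : ∀ ε > 0, ∀ᶠ t in 𝓝 (0 : ℝ), c * t ^ 2 ≤ ε * t ^ 2) :
    c ≤ 0 := by
  refine le_of_forall_pos_le_add fun ε hε => ?_
  have h1 : ∀ᶠ t in 𝓝[>] (0 : ℝ), c * t ^ 2 ≤ ε * t ^ 2 := nhdsWithin_le_nhds (h ε hε)
  obtain ⟨t, ht, ht0⟩ := (h1.and self_mem_nhdsWithin).exists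
  have ht0 : 0 < t := ht0
  have := le_of_mul_le_mul_right ht (by positivity)
  linarith

theorem quadratic_le_of_expansions {a c : X → ℝ} {ξ ζ q₁ q₂ : X} {A₁ A₂ : X →L[ℝ] X} {κ : ℝ}
    (ha : ∀ ε > 0, ∀ᶠ h in 𝓝 (0 : X),
      a ξ + ⟪q₁, h⟫ + (1 / 2) * ⟪A₁ h, h⟫ - ε * ‖h‖ ^ 2 ≤ a (ξ + h))
    (hc : ∀ ε > 0, ∀ᶠ k in 𝓝 (0 : X),
      c ζ + ⟪q₂, k⟫ + (1 / 2) * ⟪A₂ k, k⟫ - ε * ‖k‖ ^ 2 ≤ c (ζ + k))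
    (hup : ∀ h k, a (ξ + h) + c (ζ + k) ≤ a ξ + c ζ + ⟪q₁, h⟫ + ⟪q₂, k⟫ +
      3 / 2 * ‖h - k‖ ^ 2 + κ / 2 * (‖h‖ ^ 2 + ‖k‖ ^ 2)) (h k : X) :
    ⟪A₁ h, h⟫ + ⟪A₂ k, k⟫ ≤ 3 * ‖h - k‖ ^ 2 + κ * (‖h‖ ^ 2 + ‖k‖ ^ 2) := by
  set S := ‖h‖ ^ 2 + ‖k‖ ^ 2 with hS
  have hS0 : 0 ≤ S := by positivity
  have key : 1 / 2 * (⟪A₁ h, h⟫ + ⟪A₂ k, k⟫) - 3 / 2 * ‖h - k‖ ^ 2 - κ / 2 * S ≤ 0 := by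
    refine le_zero_of_sq_expansion fun ε hε => ?_
    have ht : ∀ v : X, Tendsto (fun t : ℝ => t • v) (𝓝 0) (𝓝 0) := fun v => by
      have : Continuous fun t : ℝ => t • v := by fun_prop
      simpa using this.tendsto 0
    have hε' : 0 < ε / (S + 1) := by positivity
    filter_upwards [(ht h).eventually (ha _ hε'), (ht k).eventually (hc _ hε')] with t h1 h2
    have h3 := hup (t • h) (t • k)
    rw [← smul_sub] at h3
    rw [map_smul] at h1 h2
    simp only [inner_smul_left, inner_smul_right, conj_trivial, norm_smul, mul_pow,
      Real.norm_eq_abs, sq_abs] at h1 h2 h3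
    have h4 : ε / (S + 1) * (t ^ 2 * S) ≤ ε * t ^ 2 := by
      rw [div_mul_eq_mul_div, div_le_iff₀ (by positivity)]
      nlinarith [mul_nonneg hε.le (sq_nonneg t)]
    rw [hS] at h4 ⊢
    nlinarith
  linarith

/-- **Theorem on sums** for the quadratic penalization `‖M P - M Q‖² / 2`. -/
theorem theorem_on_sums [FiniteDimensional ℝ X] {K : Set Y} (hK : IsCompact K) (hne : K.Nonempty)
    {u₁ u₂ : Y → ℝ} (hu₁ : UpperSemicontinuousOn u₁ K) (hu₂ : UpperSemicontinuousOn u₂ K)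
    (M : Y →L[ℝ] X) {κ : ℝ} (hκ : 0 < κ) :
    ∃ P ∈ K, ∃ Q ∈ K, ∃ (η p₁ p₂ : X) (A₁ A₂ : X →L[ℝ] X),
      (∀ P' ∈ K, ∀ Q' ∈ K, u₁ P' + u₂ Q' - 1 / 2 * ‖M P' - M Q'‖ ^ 2 - κ
        ≤ u₁ P + u₂ Q - 1 / 2 * ‖M P - M Q‖ ^ 2) ∧
      (∀ P' ∈ K, ∀ Q' ∈ K, u₁ P' + u₂ Q' - 1 / 2 * ‖M P' - M Q'‖ ^ 2 - κ
        ≤ u₁ P + u₂ Q - 3 / 2 * ‖η‖ ^ 2) ∧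
      ‖p₁ - (3 : ℝ) • η‖ ≤ κ ∧ ‖p₂ + (3 : ℝ) • η‖ ≤ κ ∧
      (∀ ε > 0, ∀ᶠ P' in 𝓝 P, P' ∈ K → u₁ P' ≤ u₁ P + ⟪p₁, M (P' - P)⟫ +
        (1 / 2) * ⟪A₁ (M (P' - P)), M (P' - P)⟫ + ε * ‖M (P' - P)‖ ^ 2) ∧
      (∀ ε > 0, ∀ᶠ Q' in 𝓝 Q, Q' ∈ K → u₂ Q' ≤ u₂ Q + ⟪p₂, M (Q' - Q)⟫ +
        (1 / 2) * ⟪A₂ (M (Q' - Q)), M (Q' - Q)⟫ + ε * ‖M (Q' - Q)‖ ^ 2) ∧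
      ∀ h k, ⟪A₁ h, h⟫ + ⟪A₂ k, k⟫ ≤ 3 * ‖h - k‖ ^ 2 + κ * (‖h‖ ^ 2 + ‖k‖ ^ 2) := by
  obtain ⟨a, hac, ha1, ha2⟩ := exists_supConvolution hK hne hu₁ M
  obtain ⟨c, hcc, hc1, hc2⟩ := exists_supConvolution hK hne hu₂ M
  -- three-point inequality
  have h3 : ∀ x y z : X, 1 / 2 * ‖x + y + z‖ ^ 2 ≤ 3 / 2 * (‖x‖ ^ 2 + ‖y‖ ^ 2 + ‖z‖ ^ 2) := by
    intro x y z
    have h1 : ‖x + y + z‖ ≤ ‖x‖ + ‖y‖ + ‖z‖ := norm_add₃_le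
    have h2 : ‖x + y + z‖ ^ 2 ≤ (‖x‖ + ‖y‖ + ‖z‖) ^ 2 := by gcongr
    nlinarith [sq_nonneg (‖x‖ - ‖y‖), sq_nonneg (‖y‖ - ‖z‖), sq_nonneg (‖x‖ - ‖z‖)]
  have hsplit : ∀ ξ ζ : X, ∀ P Q : Y, 1 / 2 * ‖M P - M Q‖ ^ 2 ≤
      3 / 2 * (‖ξ - M P‖ ^ 2 + ‖ξ - ζ‖ ^ 2 + ‖ζ - M Q‖ ^ 2) := by
    intro ξ ζ P Q
    have := h3 (-(ξ - M P)) (ξ - ζ) (ζ - M Q)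
    rw [norm_neg] at this
    convert this using 4
    abel
  -- maximum of the penalized function
  obtain ⟨⟨P₀, Q₀⟩, hPQ₀, hmax₀⟩ : ∃ z ∈ K ×ˢ K,
      IsMaxOn (fun z : Y × Y => (u₁ z.1 + u₂ z.2) + -(1 / 2 * ‖M z.1 - M z.2‖ ^ 2)) (K ×ˢ K) z := by
    refine UpperSemicontinuousOn.exists_isMaxOn (hne.prod hne) (hK.prod hK)
      (UpperSemicontinuousOn.add (UpperSemicontinuousOn.add ?_ ?_)
        (ContinuousOn.upperSemicontinuousOn (by fun_prop)))
    · exact hu₁.comp continuousOn_fst (fun z hz => hz.1)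
    · exact hu₂.comp continuousOn_snd (fun z hz => hz.2)
  have hP₀ : P₀ ∈ K := hPQ₀.1
  have hQ₀ : Q₀ ∈ K := hPQ₀.2
  have hmax : ∀ P' ∈ K, ∀ Q' ∈ K, u₁ P' + u₂ Q' - 1 / 2 * ‖M P' - M Q'‖ ^ 2 ≤
      u₁ P₀ + u₂ Q₀ - 1 / 2 * ‖M P₀ - M Q₀‖ ^ 2 := by
    intro P' hP' Q' hQ'
    have : (u₁ P' + u₂ Q') + -(1 / 2 * ‖M P' - M Q'‖ ^ 2) ≤
      (u₁ P₀ + u₂ Q₀) + -(1 / 2 * ‖M P₀ - M Q₀‖ ^ 2) := hmax₀ (mk_mem_prod hP' hQ')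
    linarith
  set m₀ := u₁ P₀ + u₂ Q₀ - 1 / 2 * ‖M P₀ - M Q₀‖ ^ 2 with hm₀
  let W : WithLp 2 (X × X) → ℝ := fun z => a z.fst + c z.snd - 3 / 2 * ‖z.fst - z.snd‖ ^ 2
  have hWc : Continuous W := by
    have h1 : Continuous fun z : WithLp 2 (X × X) => z.fst :=
      continuous_fst.comp (WithLp.prod_continuous_ofLp 2 X X)
    have h2 : Continuous fun z : WithLp 2 (X × X) => z.snd :=
      continuous_snd.comp (WithLp.prod_continuous_ofLp 2 X X)
    fun_prop
  have hWle : ∀ z, W z ≤ m₀ := by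
    intro z
    obtain ⟨P, hP, eP⟩ := ha1 z.fst
    obtain ⟨Q, hQ, eQ⟩ := hc1 z.snd
    have h1 := hmax P hP Q hQ
    have h2 := hsplit z.fst z.snd P Q
    simp only [W, eP, eQ]
    linarith
  let ξ₀ : X := M P₀ + (1 / 3 : ℝ) • (M Q₀ - M P₀)
  let ζ₀ : X := M P₀ + (2 / 3 : ℝ) • (M Q₀ - M P₀)
  let z₀ : WithLp 2 (X × X) := WithLp.toLp 2 (ξ₀, ζ₀)
  have hWz₀ : m₀ ≤ W z₀ := by
    have h1 := ha2 ξ₀ P₀ hP₀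
    have h2 := hc2 ζ₀ Q₀ hQ₀
    have e1 : ξ₀ - M P₀ = (1 / 3 : ℝ) • (M Q₀ - M P₀) := by simp only [ξ₀]; module
    have e2 : ζ₀ - M Q₀ = (-1 / 3 : ℝ) • (M Q₀ - M P₀) := by simp only [ζ₀]; module
    have e3 : ξ₀ - ζ₀ = (-1 / 3 : ℝ) • (M Q₀ - M P₀) := by simp only [ζ₀, ξ₀]; module
    have e4 : ‖M P₀ - M Q₀‖ = ‖M Q₀ - M P₀‖ := norm_sub_rev _ _
    rw [e1, norm_smul] at h1
    rw [e2, norm_smul] at h2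
    change m₀ ≤ a ξ₀ + c ζ₀ - 3 / 2 * ‖ξ₀ - ζ₀‖ ^ 2
    rw [e3, norm_smul, hm₀, e4]
    norm_num at h1 h2 ⊢
    nlinarith
  have hinner : ∀ x y : WithLp 2 (X × X), ⟪x, y⟫ = ⟪x.fst, y.fst⟫ + ⟪x.snd, y.snd⟫ :=
    fun x y => WithLp.prod_inner_apply x y
  have hWsc : ∀ z, ∃ q, ∀ h, W z + ⟪q, h⟫ - 18 / 2 * ‖h‖ ^ 2 ≤ W (z + h) := by
    intro z
    obtain ⟨q₁, hq₁⟩ := semiconvex_supConvolution ha1 ha2 z.fst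
    obtain ⟨q₂, hq₂⟩ := semiconvex_supConvolution hc1 hc2 z.snd
    let q : WithLp 2 (X × X) :=
      WithLp.toLp 2 (q₁ - (3 : ℝ) • (z.fst - z.snd), q₂ + (3 : ℝ) • (z.fst - z.snd))
    have g1 : q.fst = q₁ - (3 : ℝ) • (z.fst - z.snd) := rfl
    have g2 : q.snd = q₂ + (3 : ℝ) • (z.fst - z.snd) := rfl
    refine ⟨q, fun h => ?_⟩
    have h1 := hq₁ h.fst
    have h2 := hq₂ h.snd
    simp only [W, hinner, g1, g2, WithLp.prod_norm_sq_eq_of_L2, WithLp.add_fst,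
      WithLp.add_snd, inner_add_left, inner_sub_left, inner_smul_left, conj_trivial]
    have e : z.fst + h.fst - (z.snd + h.snd) = (z.fst - z.snd) + (h.fst - h.snd) := by abel
    rw [e, norm_add_sq_real]
    have h4 : ‖h.fst - h.snd‖ ^ 2 ≤ 2 * (‖h.fst‖ ^ 2 + ‖h.snd‖ ^ 2) := by
      have := norm_sub_le h.fst h.snd
      have h5 : ‖h.fst - h.snd‖ ^ 2 ≤ (‖h.fst‖ + ‖h.snd‖) ^ 2 := by gcongr
      nlinarith [sq_nonneg (‖h.fst‖ - ‖h.snd‖)]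
    simp only [inner_sub_left, inner_sub_right]
    linarith [sq_nonneg ‖h.fst‖, sq_nonneg ‖h.snd‖]
  obtain ⟨δ, hδ, hWδ⟩ := Metric.continuous_iff.1 hWc z₀ κ hκ
  obtain ⟨z, p, A, hz, hp, hup, hT⟩ := exists_taylor_near_max (by norm_num) hWc hWsc
    (x₀ := z₀) (fun z => (hWle z).trans hWz₀) (κ := min (κ / 2) (δ / 2)) (by positivity)
  have hWz : m₀ - κ ≤ W z := by
    have h1 : dist z z₀ < δ := by
      rw [dist_eq_norm]
      exact (hz.trans (min_le_right _ _)).trans_lt (by linarith)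
    have h2 := hWδ z h1
    rw [Real.dist_eq] at h2
    linarith [(abs_lt.1 h2).1]
  have hκ' : min (κ / 2) (δ / 2) ≤ κ := (min_le_left _ _).trans (by linarith)
  obtain ⟨P, hP, eP⟩ := ha1 z.fst
  obtain ⟨Q, hQ, eQ⟩ := hc1 z.snd
  have hp2 : ‖p.fst‖ ^ 2 + ‖p.snd‖ ^ 2 ≤ κ ^ 2 := by
    rw [← WithLp.prod_norm_sq_eq_of_L2]
    have := hp.trans hκ'
    gcongr
  set η := z.fst - z.snd with hη
  have hWzeq : W z = a z.fst + c z.snd - 3 / 2 * ‖η‖ ^ 2 := rfl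
  let in1 : X →L[ℝ] WithLp 2 (X × X) :=
    (WithLp.prodContinuousLinearEquiv 2 ℝ X X).symm.toContinuousLinearMap ∘L
      ContinuousLinearMap.inl ℝ X X
  let in2 : X →L[ℝ] WithLp 2 (X × X) :=
    (WithLp.prodContinuousLinearEquiv 2 ℝ X X).symm.toContinuousLinearMap ∘L
      ContinuousLinearMap.inr ℝ X X
  let pr1 : WithLp 2 (X × X) →L[ℝ] X := ContinuousLinearMap.fst ℝ X X ∘L
    (WithLp.prodContinuousLinearEquiv 2 ℝ X X).toContinuousLinearMap
  let pr2 : WithLp 2 (X × X) →L[ℝ] X := ContinuousLinearMap.snd ℝ X X ∘L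
    (WithLp.prodContinuousLinearEquiv 2 ℝ X X).toContinuousLinearMap
  have f11 : ∀ h, (in1 h).fst = h := fun h => rfl
  have f12 : ∀ h, (in1 h).snd = 0 := fun h => rfl
  have f21 : ∀ h, (in2 h).fst = 0 := fun h => rfl
  have f22 : ∀ h, (in2 h).snd = h := fun h => rfl
  let A₁ : X →L[ℝ] X := pr1 ∘L A ∘L in1 + (3 : ℝ) • ContinuousLinearMap.id ℝ X
  let A₂ : X →L[ℝ] X := pr2 ∘L A ∘L in2 + (3 : ℝ) • ContinuousLinearMap.id ℝ X
  have hA₁ : ∀ h, ⟪A₁ h, h⟫ = ⟪(A (in1 h)).fst, h⟫ + 3 * ‖h‖ ^ 2 := by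
    intro h
    change ⟪(A (in1 h)).fst + (3 : ℝ) • h, h⟫ = _
    rw [inner_add_left, real_inner_smul_left, real_inner_self_eq_norm_sq]
  have hA₂ : ∀ h, ⟪A₂ h, h⟫ = ⟪(A (in2 h)).snd, h⟫ + 3 * ‖h‖ ^ 2 := by
    intro h
    change ⟪(A (in2 h)).snd + (3 : ℝ) • h, h⟫ = _
    rw [inner_add_left, real_inner_smul_left, real_inner_self_eq_norm_sq]
  have hTa : ∀ ε > 0, ∀ᶠ h in 𝓝 (0 : X), |a (z.fst + h) - a z.fst -
      ⟪p.fst + (3 : ℝ) • η, h⟫ - (1 / 2) * ⟪A₁ h, h⟫| ≤ ε * ‖h‖ ^ 2 := by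
    intro ε hε
    have ht : Tendsto in1 (𝓝 0) (𝓝 0) := by simpa using in1.continuous.tendsto 0
    filter_upwards [ht.eventually (hT ε hε)] with h hh
    rw [WithLp.prod_norm_sq_eq_of_L2, hinner, hinner, f11, f12, norm_zero, inner_zero_right,
      inner_zero_right] at hh
    simp only [W, WithLp.add_fst, WithLp.add_snd, f11, f12, add_zero] at hh
    rw [show z.fst + h - z.snd = η + h by rw [hη]; abel, norm_add_sq_real] at hh
    rw [hA₁, inner_add_left, real_inner_smul_left]
    rw [← hη] at hh
    convert hh using 2
    · ring
    · ring
  have hTc : ∀ ε > 0, ∀ᶠ h in 𝓝 (0 : X), |c (z.snd + h) - c z.snd -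
      ⟪p.snd - (3 : ℝ) • η, h⟫ - (1 / 2) * ⟪A₂ h, h⟫| ≤ ε * ‖h‖ ^ 2 := by
    intro ε hε
    have ht : Tendsto in2 (𝓝 0) (𝓝 0) := by simpa using in2.continuous.tendsto 0
    filter_upwards [ht.eventually (hT ε hε)] with h hh
    rw [WithLp.prod_norm_sq_eq_of_L2, hinner, hinner, f21, f22, norm_zero, inner_zero_right,
      inner_zero_right] at hh
    simp only [W, WithLp.add_fst, WithLp.add_snd, f21, f22, add_zero] at hh
    rw [show z.fst - (z.snd + h) = η - h by rw [hη]; abel, norm_sub_sq_real] at hh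
    rw [hA₂, inner_sub_left, real_inner_smul_left]
    rw [← hη] at hh
    convert hh using 2
    · ring
    · ring
  refine ⟨P, hP, Q, hQ, η, p.fst + (3 : ℝ) • η, p.snd - (3 : ℝ) • η, A₁, A₂, ?_, ?_, ?_, ?_,
    ?_, ?_, ?_⟩
  · intro P' hP' Q' hQ'
    have h1 := hmax P' hP' Q' hQ'
    have h2 := hsplit z.fst z.snd P Q
    rw [← hη] at h2
    linarith
  · intro P' hP' Q' hQ'
    have h1 := hmax P' hP' Q' hQ'
    linarith [sq_nonneg ‖z.fst - M P‖, sq_nonneg ‖z.snd - M Q‖]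
  · rw [add_sub_cancel_right]
    exact abs_le_of_sq_le_sq' (by linarith [sq_nonneg ‖p.snd‖]) hκ.le |>.2
  · rw [sub_add_cancel]
    exact abs_le_of_sq_le_sq' (by linarith [sq_nonneg ‖p.fst‖]) hκ.le |>.2
  · refine superjet_of_supConvolution ha2 eP fun ε hε => ?_
    filter_upwards [hTa ε hε] with h hh
    linarith [(abs_le.1 hh).2]
  · refine superjet_of_supConvolution hc2 eQ fun ε hε => ?_
    filter_upwards [hTc ε hε] with h hh
    linarith [(abs_le.1 hh).2]
  · intro h k
    refine quadratic_le_of_expansions (fun ε hε => ?_) (fun ε hε => ?_) (fun h k => ?_) h k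
      (a := a) (c := c) (ξ := z.fst) (ζ := z.snd) (q₁ := p.fst + (3 : ℝ) • η)
      (q₂ := p.snd - (3 : ℝ) • η)
    · filter_upwards [hTa ε hε] with h hh
      linarith [(abs_le.1 hh).1]
    · filter_upwards [hTc ε hε] with h hh
      linarith [(abs_le.1 hh).1]
    · have h3 := hup (in1 h + in2 k)
      rw [WithLp.prod_norm_sq_eq_of_L2, hinner] at h3
      simp only [W, WithLp.add_fst, WithLp.add_snd, f11, f12, f21, f22, add_zero,
        zero_add] at h3
      rw [show z.fst + h - (z.snd + k) = η + (h - k) by rw [hη]; abel, norm_add_sq_real,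
        ← hη, inner_sub_right] at h3
      rw [inner_add_left, inner_sub_left, real_inner_smul_left, real_inner_smul_left]
      have h5 : min (κ / 2) (δ / 2) / 2 * (‖h‖ ^ 2 + ‖k‖ ^ 2) ≤
          κ / 2 * (‖h‖ ^ 2 + ‖k‖ ^ 2) := by gcongr
      linarith
end Sums

section TestFunctions

variable {k : ℕ}

theorem IsC12.continuous_deriv {φ : ℝ → Euc k → ℝ} (h : IsC12 φ) :
    Continuous fun p : ℝ × Euc k => timeDeriv φ p.1 p.2 := h.2.1

theorem IsC12.differentiable_snd {φ : ℝ → Euc k → ℝ} (h : IsC12 φ) (t : ℝ) :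
    Differentiable ℝ (φ t) := (h.2.2.1 t).differentiable (by norm_num)

theorem IsC12.differentiable_fderiv {φ : ℝ → Euc k → ℝ} (h : IsC12 φ) (t : ℝ) :
    Differentiable ℝ (fderiv ℝ (φ t)) :=
  ((h.2.2.1 t).fderiv_right (m := 1) (by norm_num)).differentiable (by norm_num)

theorem timeDeriv_add {φ ψ : ℝ → Euc k → ℝ} (h : IsC12 φ) (h' : IsC12 ψ) (t : ℝ) (x : Euc k) :
    timeDeriv (fun t x => φ t x + ψ t x) t x = timeDeriv φ t x + timeDeriv ψ t x :=
  deriv_fun_add (h.1 x t) (h'.1 x t)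

theorem fderiv_space_add {φ ψ : ℝ → Euc k → ℝ} (h : IsC12 φ) (h' : IsC12 ψ) (t : ℝ) (x : Euc k) :
    fderiv ℝ (fun y => φ t y + ψ t y) x = fderiv ℝ (φ t) x + fderiv ℝ (ψ t) x :=
  fderiv_fun_add (h.differentiable_snd t x) (h'.differentiable_snd t x)

theorem fderiv_fderiv_space_add {φ ψ : ℝ → Euc k → ℝ} (h : IsC12 φ) (h' : IsC12 ψ) (t : ℝ)
    (x : Euc k) :
    fderiv ℝ (fderiv ℝ (fun y => φ t y + ψ t y)) x =
      fderiv ℝ (fderiv ℝ (φ t)) x + fderiv ℝ (fderiv ℝ (ψ t)) x := by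
  have : fderiv ℝ (fun y => φ t y + ψ t y) = fun y => fderiv ℝ (φ t) y + fderiv ℝ (ψ t) y :=
    funext fun y => fderiv_space_add h h' t y
  rw [this]
  exact fderiv_fun_add (h.differentiable_fderiv t x) (h'.differentiable_fderiv t x)

theorem IsC12.add {φ ψ : ℝ → Euc k → ℝ} (h : IsC12 φ) (h' : IsC12 ψ) :
    IsC12 (fun t x => φ t x + ψ t x) := by
  refine ⟨fun x => (h.1 x).add (h'.1 x), ?_, fun t => (h.2.2.1 t).add (h'.2.2.1 t), ?_, ?_⟩
  · refine (h.2.1.add h'.2.1).congr fun p => ?_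
    exact (timeDeriv_add h h' p.1 p.2).symm
  · refine (h.2.2.2.1.add h'.2.2.2.1).congr fun p => ?_
    exact (fderiv_space_add h h' p.1 p.2).symm
  · refine (h.2.2.2.2.add h'.2.2.2.2).congr fun p => ?_
    exact (fderiv_fderiv_space_add h h' p.1 p.2).symm

theorem timeDeriv_const_mul {φ : ℝ → Euc k → ℝ} (h : IsC12 φ) (c : ℝ) (t : ℝ) (x : Euc k) :
    timeDeriv (fun t x => c * φ t x) t x = c * timeDeriv φ t x :=
  deriv_const_mul c (h.1 x t)

theorem fderiv_space_const_mul {φ : ℝ → Euc k → ℝ} (h : IsC12 φ) (c : ℝ) (t : ℝ) (x : Euc k) :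
    fderiv ℝ (fun y => c * φ t y) x = c • fderiv ℝ (φ t) x :=
  fderiv_const_mul (h.differentiable_snd t x) c

theorem fderiv_fderiv_space_const_mul {φ : ℝ → Euc k → ℝ} (h : IsC12 φ) (c : ℝ) (t : ℝ)
    (x : Euc k) :
    fderiv ℝ (fderiv ℝ (fun y => c * φ t y)) x = c • fderiv ℝ (fderiv ℝ (φ t)) x := by
  have : fderiv ℝ (fun y => c * φ t y) = fun y => c • fderiv ℝ (φ t) y :=
    funext fun y => fderiv_space_const_mul h c t y
  rw [this]
  exact fderiv_fun_const_smul (h.differentiable_fderiv t x) c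

theorem IsC12.const_mul {φ : ℝ → Euc k → ℝ} (h : IsC12 φ) (c : ℝ) :
    IsC12 (fun t x => c * φ t x) := by
  refine ⟨fun x => (h.1 x).const_mul c, ?_, fun t => contDiff_const.mul (h.2.2.1 t), ?_, ?_⟩
  · refine ((continuous_const (y := c)).mul h.2.1).congr fun p => ?_
    exact (timeDeriv_const_mul h c p.1 p.2).symm
  · refine (h.2.2.2.1.const_smul c).congr fun p => ?_
    exact (fderiv_space_const_mul h c p.1 p.2).symm
  · refine (h.2.2.2.2.const_smul c).congr fun p => ?_
    exact (fderiv_fderiv_space_const_mul h c p.1 p.2).symm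

theorem IsC12.continuous {φ : ℝ → Euc k → ℝ} (h : IsC12 φ) :
    Continuous fun p : ℝ × Euc k => φ p.1 p.2 := by
  rw [continuous_iff_continuousAt]
  rintro ⟨t₀, x₀⟩
  have hloc : ∀ᶠ p : ℝ × Euc k in 𝓝 (t₀, x₀), ‖timeDeriv φ p.1 p.2‖ ≤
      ‖timeDeriv φ t₀ x₀‖ + 1 :=
    (h.continuous_deriv.norm.tendsto (t₀, x₀)).eventually (eventually_le_nhds (by simp))
  obtain ⟨δ, hδ, hb⟩ := Metric.eventually_nhds_iff_ball.1 hloc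
  have hx : ContinuousAt (fun p : ℝ × Euc k => φ t₀ p.2) (t₀, x₀) :=
    ((h.differentiable_snd t₀).continuous.comp continuous_snd).continuousAt
  have hdiff : Tendsto (fun p : ℝ × Euc k => φ p.1 p.2 - φ t₀ p.2) (𝓝 (t₀, x₀)) (𝓝 0) := by
    have hub : Tendsto (fun p : ℝ × Euc k => (‖timeDeriv φ t₀ x₀‖ + 1) * ‖p.1 - t₀‖)
        (𝓝 (t₀, x₀)) (𝓝 0) := by
      have : Continuous fun p : ℝ × Euc k => (‖timeDeriv φ t₀ x₀‖ + 1) * ‖p.1 - t₀‖ := by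
        fun_prop
      simpa using this.tendsto (t₀, x₀)
    refine squeeze_zero_norm' ?_ hub
    filter_upwards [Metric.ball_mem_nhds (t₀, x₀) hδ] with p hp
    rw [← ball_prod_same] at hp
    refine (convex_ball t₀ δ).norm_image_sub_le_of_norm_deriv_le (f := fun s => φ s p.2)
      (fun s _ => h.1 p.2 s) (fun s hs => ?_) (Metric.mem_ball_self hδ) hp.1
    exact hb (s, p.2) (by rw [← ball_prod_same]; exact ⟨hs, hp.2⟩)
  have := hdiff.add hx.tendsto
  simp only [sub_add_cancel, zero_add] at this
  exact this

section Smooth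

variable {Q : ℝ × Euc k → ℝ}

theorem hasFDerivAt_slice (hQ : ContDiff ℝ 2 Q) (t : ℝ) (x : Euc k) :
    HasFDerivAt (fun y => Q (t, y)) ((fderiv ℝ Q (t, x)).comp (ContinuousLinearMap.inr ℝ ℝ _)) x :=
  ((hQ.differentiable (by norm_num)) (t, x)).hasFDerivAt.comp x (hasFDerivAt_prodMk_right t x)

theorem hasFDerivAt_fderiv_slice (hQ : ContDiff ℝ 2 Q) (t : ℝ) (x : Euc k) :
    HasFDerivAt (fderiv ℝ (fun y => Q (t, y)))
      (((ContinuousLinearMap.compL ℝ (Euc k) (ℝ × Euc k) ℝ).flip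
        (ContinuousLinearMap.inr ℝ ℝ _)).comp
          ((fderiv ℝ (fderiv ℝ Q) (t, x)).comp (ContinuousLinearMap.inr ℝ ℝ _))) x := by
  have e : fderiv ℝ (fun y => Q (t, y)) = fun y => (ContinuousLinearMap.compL ℝ (Euc k)
      (ℝ × Euc k) ℝ).flip (ContinuousLinearMap.inr ℝ ℝ _) (fderiv ℝ Q (t, y)) :=
    funext fun y => (hasFDerivAt_slice hQ t y).fderiv
  rw [e]
  have h2 : DifferentiableAt ℝ (fderiv ℝ Q) (t, x) :=
    (hQ.fderiv_right (m := 1) (by norm_num)).differentiable (by norm_num) _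
  exact (ContinuousLinearMap.hasFDerivAt _).comp x
    (h2.hasFDerivAt.comp x (hasFDerivAt_prodMk_right t x))

theorem hasDerivAt_slice (hQ : ContDiff ℝ 2 Q) (t : ℝ) (x : Euc k) :
    HasDerivAt (fun s => Q (s, x)) (fderiv ℝ Q (t, x) (1, 0)) t := by
  have := ((hQ.differentiable (by norm_num)) (t, x)).hasFDerivAt.comp_hasDerivAt t
    ((hasDerivAt_id t).prodMk (hasDerivAt_const t x))
  exact this

theorem isC12_of_contDiff (hQ : ContDiff ℝ 2 Q) : IsC12 (fun t x => Q (t, x)) := by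
  have c1 : Continuous (fderiv ℝ Q) := hQ.continuous_fderiv (by norm_num)
  have c2 : Continuous (fderiv ℝ (fderiv ℝ Q)) :=
    (hQ.fderiv_right (m := 1) (by norm_num)).continuous_fderiv (by norm_num)
  refine ⟨fun x t => (hasDerivAt_slice hQ t x).differentiableAt, ?_,
    fun t => hQ.comp (contDiff_prodMk_right t), ?_, ?_⟩
  · have : (fun p : ℝ × Euc k => deriv (fun s => Q (s, p.2)) p.1) =
        fun p => fderiv ℝ Q p (1, 0) := funext fun p => (hasDerivAt_slice hQ p.1 p.2).deriv
    rw [this]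
    fun_prop
  · have : (fun p : ℝ × Euc k => fderiv ℝ (fun y => Q (p.1, y)) p.2) =
        fun p => (fderiv ℝ Q p).comp (ContinuousLinearMap.inr ℝ ℝ _) :=
      funext fun p => (hasFDerivAt_slice hQ p.1 p.2).fderiv
    rw [this]
    exact c1.clm_comp continuous_const
  · have : (fun p : ℝ × Euc k => fderiv ℝ (fderiv ℝ (fun y => Q (p.1, y))) p.2) = fun p =>
        ((ContinuousLinearMap.compL ℝ (Euc k) (ℝ × Euc k) ℝ).flip
        (ContinuousLinearMap.inr ℝ ℝ _)).comp
          ((fderiv ℝ (fderiv ℝ Q) p).comp (ContinuousLinearMap.inr ℝ ℝ _)) :=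
      funext fun p => (hasFDerivAt_fderiv_slice hQ p.1 p.2).fderiv
    rw [this]
    exact continuous_const.clm_comp (c2.clm_comp continuous_const)

end Smooth

theorem isC12_const (c : ℝ) : IsC12 (fun (_ : ℝ) (_ : Euc k) => c) :=
  isC12_of_contDiff (Q := fun _ => c) contDiff_const

/-- The affine-plus-quadratic function with gradient `ℓ` and Hessian (symmetrization of) `B`
at the point `P`. -/
noncomputable def quadTest (P : ℝ × Euc k) (ℓ : ℝ × Euc k →L[ℝ] ℝ)
    (B : ℝ × Euc k →L[ℝ] ℝ × Euc k →L[ℝ] ℝ) (t : ℝ) (x : Euc k) : ℝ :=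
  ℓ ((t, x) - P) + 1 / 2 * B ((t, x) - P) ((t, x) - P)

variable (P : ℝ × Euc k) (ℓ : ℝ × Euc k →L[ℝ] ℝ) (B : ℝ × Euc k →L[ℝ] ℝ × Euc k →L[ℝ] ℝ)

theorem hasFDerivAt_quad (z : ℝ × Euc k) :
    HasFDerivAt (fun z => ℓ (z - P) + 1 / 2 * B (z - P) (z - P))
      (ℓ + (1 / 2 : ℝ) • (B (z - P) + B.flip (z - P))) z := by
  have h1 : HasFDerivAt (fun z : ℝ × Euc k => z - P) (ContinuousLinearMap.id ℝ _) z :=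
    (hasFDerivAt_id z).sub_const P
  have h2 := (ℓ.hasFDerivAt (x := z - P)).comp z h1
  have h3 := (B.hasFDerivAt (x := z - P)).comp z h1
  have h4 := h2.add ((h3.clm_apply h1).const_mul (1 / 2))
  refine h4.congr_fderiv ?_
  ext h <;> simp

theorem contDiff_quad :
    ContDiff ℝ 2 (fun z : ℝ × Euc k => ℓ (z - P) + 1 / 2 * B (z - P) (z - P)) := by
  have h1 : ContDiff ℝ 2 (fun z : ℝ × Euc k => z - P) := contDiff_id.sub contDiff_const
  exact (ℓ.contDiff.comp h1).add (contDiff_const.mul ((B.contDiff.comp h1).clm_apply h1))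

theorem isC12_quadTest : IsC12 (quadTest P ℓ B) := isC12_of_contDiff (contDiff_quad P ℓ B)

theorem fderiv_fderiv_quad (z : ℝ × Euc k) :
    fderiv ℝ (fderiv ℝ (fun z => ℓ (z - P) + 1 / 2 * B (z - P) (z - P))) z =
      (1 / 2 : ℝ) • (B + B.flip) := by
  have e : fderiv ℝ (fun z => ℓ (z - P) + 1 / 2 * B (z - P) (z - P)) = fun z =>
      ℓ + (1 / 2 : ℝ) • ((B + B.flip) (z - P)) :=
    funext fun z => (hasFDerivAt_quad P ℓ B z).fderiv
  rw [e]
  have h1 : HasFDerivAt (fun z : ℝ × Euc k => z - P) (ContinuousLinearMap.id ℝ _) z :=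
    (hasFDerivAt_id z).sub_const P
  have h3 := (((B + B.flip).hasFDerivAt (x := z - P)).comp z h1).const_smul (1 / 2 : ℝ)
  exact (h3.const_add ℓ).fderiv

theorem timeDeriv_quadTest (t : ℝ) (x : Euc k) :
    timeDeriv (quadTest (t, x) ℓ B) t x = ℓ (1, 0) := by
  refine (hasDerivAt_slice (contDiff_quad (t, x) ℓ B) t x).deriv.trans ?_
  rw [(hasFDerivAt_quad _ ℓ B _).fderiv]
  simp

theorem fderiv_quadTest (t : ℝ) (x h : Euc k) :
    fderiv ℝ (quadTest (t, x) ℓ B t) x h = ℓ (0, h) := by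
  have := (hasFDerivAt_slice (contDiff_quad (t, x) ℓ B) t x).fderiv
  unfold quadTest
  rw [this, (hasFDerivAt_quad _ ℓ B _).fderiv]
  simp

theorem fderiv_fderiv_quadTest (t : ℝ) (x h : Euc k) :
    fderiv ℝ (fderiv ℝ (quadTest (t, x) ℓ B t)) x h h = B (0, h) (0, h) := by
  have := (hasFDerivAt_fderiv_slice (contDiff_quad (t, x) ℓ B) t x).fderiv
  unfold quadTest
  rw [this, fderiv_fderiv_quad]
  change (1 / 2 : ℝ) * (B (0, h) (0, h) + B (0, h) (0, h)) = B (0, h) (0, h)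
  ring

end TestFunctions

section Obstacle

/-- Coefficients of a two-obstacle problem, with drift and diffusion given as vector fields. -/
structure ObstacleData (k d : ℕ) where
  /-- horizon -/
  T : ℝ
  /-- drift -/
  bv : ℝ → Euc k → Euc k
  /-- columns of the diffusion matrix -/
  S : Fin d → ℝ → Euc k → Euc k
  /-- driver -/
  f : ℝ → Euc k → ℝ → (Fin d → ℝ) → ℝ
  /-- upper obstacle -/
  H : ℝ → Euc k → ℝ
  /-- lower obstacle -/
  L : ℝ → Euc k → ℝ
  /-- terminal value -/
  g : Euc k → ℝ

variable {k d : ℕ}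

namespace ObstacleData

/-- The data solved by `-u` when `u` solves the problem with data `D`. -/
def dual (D : ObstacleData k d) : ObstacleData k d where
  T := D.T
  bv := D.bv
  S := D.S
  f := fun t x y z => -D.f t x (-y) (-z)
  H := fun t x => -D.L t x
  L := fun t x => -D.H t x
  g := fun x => -D.g x

@[simp] theorem dual_dual (D : ObstacleData k d) : D.dual.dual = D := by
  simp [dual]

/-- Standing assumptions, uniformly over all real times. -/
structure Regular (D : ObstacleData k d) : Prop where
  bv_cont : Continuous fun p : ℝ × Euc k => D.bv p.1 p.2
  S_cont : ∀ l, Continuous fun p : ℝ × Euc k => D.S l p.1 p.2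
  lip : ∃ C, 0 ≤ C ∧ ∀ t x y, ‖D.bv t x - D.bv t y‖ ≤ C * ‖x - y‖ ∧
    ∀ l, ‖D.S l t x - D.S l t y‖ ≤ C * ‖x - y‖
  lin : ∃ C, 0 ≤ C ∧ ∀ t x, ‖D.bv t x‖ ^ 2 ≤ C * (1 + ‖x‖ ^ 2) ∧
    ∀ l, ‖D.S l t x‖ ^ 2 ≤ C * (1 + ‖x‖ ^ 2)
  f_cont : Continuous fun q : ℝ × (Euc k × ℝ × (Fin d → ℝ)) => D.f q.1 q.2.1 q.2.2.1 q.2.2.2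
  f_lip : ∃ C, 0 ≤ C ∧ ∀ t x y y' z z', |D.f t x y z - D.f t x y' z'| ≤
    C * (|y - y'| + ‖z - z'‖)
  f_mod : ∀ R > (0 : ℝ), ∀ ε > (0 : ℝ), ∃ δ > (0 : ℝ), ∀ t, ∀ x y : Euc k, ‖x‖ ≤ R → ‖y‖ ≤ R →
    ∀ r, |r| ≤ R → ∀ z, (1 + ‖z‖) * ‖x - y‖ < δ → |D.f t x r z - D.f t y r z| ≤ ε
  H_cont : Continuous fun p : ℝ × Euc k => D.H p.1 p.2
  L_cont : Continuous fun p : ℝ × Euc k => D.L p.1 p.2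
  g_cont : Continuous D.g
  L_le_H : ∀ t x, D.L t x ≤ D.H t x
  L_le_g : ∀ x, D.L D.T x ≤ D.g x
  g_le_H : ∀ x, D.g x ≤ D.H D.T x
  growth : ∃ (C : ℝ) (n : ℕ), 0 ≤ C ∧ ∀ t x, |D.g x| ≤ C * (1 + ‖x‖ ^ 2) ^ n ∧
    |D.f t x 0 0| ≤ C * (1 + ‖x‖ ^ 2) ^ n ∧ |D.H t x| ≤ C * (1 + ‖x‖ ^ 2) ^ n ∧
    |D.L t x| ≤ C * (1 + ‖x‖ ^ 2) ^ n

theorem Regular.dual {D : ObstacleData k d} (h : D.Regular) : D.dual.Regular where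
  bv_cont := h.bv_cont
  S_cont := h.S_cont
  lip := h.lip
  lin := h.lin
  f_cont := by
    have : Continuous fun q : ℝ × (Euc k × ℝ × (Fin d → ℝ)) =>
      (q.1, (q.2.1, (-q.2.2.1, -q.2.2.2))) := by fun_prop
    exact (h.f_cont.comp this).neg
  f_lip := by
    obtain ⟨C, hC, hf⟩ := h.f_lip
    refine ⟨C, hC, fun t x y y' z z' => ?_⟩
    have := hf t x (-y') (-y) (-z') (-z)
    simp only [ObstacleData.dual]
    rw [show -y' - -y = y - y' by ring, show -z' - -z = z - z' by abel] at this
    rw [show -D.f t x (-y) (-z) - -D.f t x (-y') (-z') =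
      D.f t x (-y') (-z') - D.f t x (-y) (-z) by ring]
    exact this
  f_mod := by
    intro R hR ε hε
    obtain ⟨δ, hδ, hf⟩ := h.f_mod R hR ε hε
    refine ⟨δ, hδ, fun t x y hx hy r hr z hz => ?_⟩
    have := hf t x y hx hy (-r) (by rwa [abs_neg]) (-z) (by rwa [norm_neg])
    simp only [ObstacleData.dual]
    rwa [neg_sub_neg, abs_sub_comm]
  H_cont := h.L_cont.neg
  L_cont := h.H_cont.neg
  g_cont := h.g_cont.neg
  L_le_H := fun t x => neg_le_neg (h.L_le_H t x)
  L_le_g := fun x => neg_le_neg (h.g_le_H x)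
  g_le_H := fun x => neg_le_neg (h.L_le_g x)
  growth := by
    obtain ⟨C, n, hC, hg⟩ := h.growth
    refine ⟨C, n, hC, fun t x => ?_⟩
    obtain ⟨h1, h2, h3, h4⟩ := hg t x
    simp only [ObstacleData.dual, abs_neg, neg_zero]
    exact ⟨h1, h2, h4, h3⟩

variable (D : ObstacleData k d)

/-- The parabolic operator, as a function of time derivative `q`, gradient `p` and the
second-order term `s = ∑ l, D²φ(S l, S l)`. -/
noncomputable def G (t : ℝ) (x : Euc k) (y q : ℝ) (p : Euc k →L[ℝ] ℝ) (s : ℝ) : ℝ :=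
  -q - 1 / 2 * s - p (D.bv t x) - D.f t x y fun l => p (D.S l t x)

/-- The second-order term of the operator. -/
noncomputable def hess (φ : ℝ → Euc k → ℝ) (t : ℝ) (x : Euc k) : ℝ :=
  ∑ l, fderiv ℝ (fderiv ℝ (φ t)) x (D.S l t x) (D.S l t x)

/-- The parabolic operator applied to a test function, with zeroth order argument `y`. -/
noncomputable def GΦ (φ : ℝ → Euc k → ℝ) (t : ℝ) (x : Euc k) (y : ℝ) : ℝ :=
  D.G t x y (timeDeriv φ t x) (fderiv ℝ (φ t) x) (D.hess φ t x)

/-- Interior subsolution property on the time interval `(a, T)`. -/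
def IsSub (a : ℝ) (w : ℝ × Euc k → ℝ) : Prop :=
  ∀ t x, t ∈ Ioo a D.T → ∀ φ, IsC12 φ →
    IsLocalMax (fun p : ℝ × Euc k => w p - φ p.1 p.2) (t, x) →
    w (t, x) ≤ D.H t x ∧ (w (t, x) ≤ D.L t x ∨ D.GΦ φ t x (w (t, x)) ≤ 0)

variable {D}

theorem hess_add {φ ψ : ℝ → Euc k → ℝ} (h : IsC12 φ) (h' : IsC12 ψ) (t : ℝ) (x : Euc k) :
    D.hess (fun t x => φ t x + ψ t x) t x = D.hess φ t x + D.hess ψ t x := by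
  simp only [hess, fderiv_fderiv_space_add h h', _root_.add_apply, Finset.sum_add_distrib]

theorem hess_const_mul {φ : ℝ → Euc k → ℝ} (h : IsC12 φ) (c t : ℝ) (x : Euc k) :
    D.hess (fun t x => c * φ t x) t x = c * D.hess φ t x := by
  simp only [hess, fderiv_fderiv_space_const_mul h, _root_.smul_apply, smul_eq_mul,
    Finset.mul_sum]

theorem hess_quadTest (t : ℝ) (x : Euc k) (ℓ : ℝ × Euc k →L[ℝ] ℝ)
    (B : ℝ × Euc k →L[ℝ] ℝ × Euc k →L[ℝ] ℝ) :
    D.hess (quadTest (t, x) ℓ B) t x = ∑ l, B (0, D.S l t x) (0, D.S l t x) := by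
  simp only [hess, fderiv_fderiv_quadTest]

theorem Regular.continuous_hess (hD : D.Regular) {φ : ℝ → Euc k → ℝ} (h : IsC12 φ) :
    Continuous fun p : ℝ × Euc k => D.hess φ p.1 p.2 := by
  unfold hess
  exact continuous_finsetSum _ fun l _ =>
    (h.2.2.2.2.clm_apply (hD.S_cont l)).clm_apply (hD.S_cont l)

theorem Regular.continuous_GΦ (hD : D.Regular) {φ : ℝ → Euc k → ℝ} (h : IsC12 φ) :
    Continuous fun p : (ℝ × Euc k) × ℝ => D.GΦ φ p.1.1 p.1.2 p.2 := by
  unfold GΦ G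
  have h1 := (hD.continuous_hess h).comp (continuous_fst (X := ℝ × Euc k) (Y := ℝ))
  have h2 := (h.2.2.2.1.clm_apply hD.bv_cont).comp (continuous_fst (X := ℝ × Euc k) (Y := ℝ))
  have h3 := h.continuous_deriv.comp (continuous_fst (X := ℝ × Euc k) (Y := ℝ))
  have h4 : Continuous fun p : (ℝ × Euc k) × ℝ => fun l =>
      fderiv ℝ (φ p.1.1) p.1.2 (D.S l p.1.1 p.1.2) :=
    continuous_pi fun l => (h.2.2.2.1.clm_apply (hD.S_cont l)).comp continuous_fst
  have h5 : Continuous fun p : (ℝ × Euc k) × ℝ => D.f p.1.1 p.1.2 p.2 fun l =>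
      fderiv ℝ (φ p.1.1) p.1.2 (D.S l p.1.1 p.1.2) :=
    hD.f_cont.comp ((continuous_fst.comp continuous_fst).prodMk
      ((continuous_snd.comp continuous_fst).prodMk (continuous_snd.prodMk h4)))
  exact ((h3.neg.sub (continuous_const.mul h1)).sub h2).sub h5

/-- The operator applied to the sum of a test function and a quadratic. -/
theorem GΦ_add_quadTest {φ : ℝ → Euc k → ℝ} (h : IsC12 φ) (t : ℝ) (x : Euc k)
    (ℓ : ℝ × Euc k →L[ℝ] ℝ) (B : ℝ × Euc k →L[ℝ] ℝ × Euc k →L[ℝ] ℝ) (y : ℝ) :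
    D.GΦ (fun s y => φ s y + quadTest (t, x) ℓ B s y) t x y =
      D.G t x y (timeDeriv φ t x + ℓ (1, 0))
        (fderiv ℝ (φ t) x + ℓ.comp (ContinuousLinearMap.inr ℝ ℝ _))
        (D.hess φ t x + ∑ l, B (0, D.S l t x) (0, D.S l t x)) := by
  have hq := isC12_quadTest (t, x) ℓ B
  rw [GΦ, timeDeriv_add h hq, hess_add h hq, fderiv_space_add h hq, hess_quadTest,
    timeDeriv_quadTest]
  congr 2
  ext v
  rw [fderiv_quadTest]
  rfl

end ObstacleData

end Obstacle

section Doubling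

theorem exists_penalization {Y : Type*} [MetricSpace Y] {K O : Set Y} (hK : IsCompact K)
    {u₁ u₂ : Y → ℝ} (hu₁ : UpperSemicontinuousOn u₁ K) (hu₂ : UpperSemicontinuousOn u₂ K)
    (hO : IsOpen O) (hdiag : ∀ P ∈ K, u₁ P + u₂ P ≤ 0)
    (h_nonneg : ∀ P ∈ K, 0 ≤ u₁ P + u₂ P → P ∈ O) {ε : ℝ} (hε : 0 < ε) :
    ∃ N₀ > 0, ∀ N ≥ N₀, ∀ P ∈ K, ∀ Q ∈ K, ∀ r, N * dist P Q ^ 2 ≤ r →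
      -(1 / N) ≤ u₁ P + u₂ Q - r → u₁ P + u₂ Q ≤ ε ∧ r ≤ ε ∧ P ∈ O ∧ Q ∈ O := by
  by_contra! hcon
  have hcon' : ∀ n : ℕ, ∃ P ∈ K, ∃ Q ∈ K, ∃ r, ((n : ℝ) + 1) * dist P Q ^ 2 ≤ r ∧
      -(1 / ((n : ℝ) + 1)) ≤ u₁ P + u₂ Q - r ∧
      (u₁ P + u₂ Q ≤ ε → r ≤ ε → P ∈ O → Q ∉ O) := by
    intro n
    obtain ⟨N, hN, P, hP, Q, hQ, r, h1, h2, h3⟩ := hcon (n + 1) (by positivity)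
    have hn : (0 : ℝ) < n + 1 := by positivity
    refine ⟨P, hP, Q, hQ, r, le_trans (by gcongr) h1, le_trans ?_ h2, h3⟩
    apply neg_le_neg
    exact one_div_le_one_div_of_le hn hN
  choose P hP Q hQ r h1 h2 h3 using hcon'
  obtain ⟨C₁, hC₁⟩ := hu₁.bddAbove_of_isCompact hK
  obtain ⟨C₂, hC₂⟩ := hu₂.bddAbove_of_isCompact hK
  have hone : Tendsto (fun n : ℕ => 1 / ((n : ℝ) + 1)) atTop (𝓝 0) :=
    tendsto_one_div_add_atTop_nhds_zero_nat
  obtain ⟨P₀, hP₀, φ, hφ, hlim⟩ := hK.tendsto_subseq hP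
  have hφt := hφ.tendsto_atTop
  have hdist : Tendsto (fun n => dist (P n) (Q n)) atTop (𝓝 0) := by
    have hsq : Tendsto (fun n => dist (P n) (Q n) ^ 2) atTop (𝓝 0) := by
      have hb : Tendsto (fun n : ℕ => (C₁ + C₂ + 1) * (1 / ((n : ℝ) + 1))) atTop (𝓝 0) := by
        simpa using hone.const_mul (C₁ + C₂ + 1)
      refine squeeze_zero (fun n => sq_nonneg _) (fun n => ?_) hb
      have hn : (0 : ℝ) < n + 1 := by positivity
      have hn1 : 1 / ((n : ℝ) + 1) ≤ 1 := by
        rw [div_le_one hn]; linarith [(Nat.cast_nonneg n : (0 : ℝ) ≤ n)]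
      have a1 := hC₁ (mem_image_of_mem u₁ (hP n))
      have a2 := hC₂ (mem_image_of_mem u₂ (hQ n))
      rw [mul_one_div, le_div_iff₀ hn]
      linarith [h1 n, h2 n]
    have := hsq.sqrt
    simpa [Real.sqrt_sq dist_nonneg] using this
  have hlimQ : Tendsto (Q ∘ φ) atTop (𝓝 P₀) := by
    refine (tendsto_iff_of_dist ?_).1 hlim
    exact hdist.comp hφt
  have hPw : Tendsto (P ∘ φ) atTop (𝓝[K] P₀) :=
    tendsto_nhdsWithin_iff.2 ⟨hlim, Eventually.of_forall fun n => hP _⟩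
  have hQw : Tendsto (Q ∘ φ) atTop (𝓝[K] P₀) :=
    tendsto_nhdsWithin_iff.2 ⟨hlimQ, Eventually.of_forall fun n => hQ _⟩
  have hD : ∀ e > 0, ∀ᶠ n in atTop, u₁ (P (φ n)) + u₂ (Q (φ n)) < u₁ P₀ + u₂ P₀ + e := by
    intro e he
    filter_upwards [hPw.eventually (hu₁ P₀ hP₀ (u₁ P₀ + e / 2) (by linarith)),
      hQw.eventually (hu₂ P₀ hP₀ (u₂ P₀ + e / 2) (by linarith))] with n e1 e2
    simp only [Function.comp] at e1 e2
    linarith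
  have hr0 : ∀ n, 0 ≤ r n := fun n => le_trans (by positivity) (h1 n)
  have hP₀O : P₀ ∈ O := by
    refine h_nonneg P₀ hP₀ (le_of_forall_pos_le_add fun e he => ?_)
    have := (hone.comp hφt).eventually (eventually_lt_nhds (show (0 : ℝ) < e / 2 by linarith))
    obtain ⟨n, n1, n2⟩ := ((hD (e / 2) (by linarith)).and this).exists
    simp only [Function.comp] at n2
    linarith [h2 (φ n), hr0 (φ n)]
  have e1 := hlim.eventually (hO.mem_nhds hP₀O)
  have e2 := hlimQ.eventually (hO.mem_nhds hP₀O)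
  have e3 := (hone.comp hφt).eventually (eventually_lt_nhds (show (0 : ℝ) < ε / 2 by linarith))
  obtain ⟨n, ⟨n1, n2⟩, n3, n4⟩ := ((e1.and e2).and (e3.and (hD (ε / 2) (by linarith)))).exists
  simp only [Function.comp] at n3
  have hd := hdiag P₀ hP₀
  exact h3 (φ n) (by linarith) (by linarith [h2 (φ n)]) n1 n2

theorem exists_time_modulus {W E : Type*} [PseudoMetricSpace W] [PseudoMetricSpace E]
    {F : ℝ × W → E} (hF : Continuous F) {I : Set ℝ} {K : Set W} (hI : IsCompact I)
    (hK : IsCompact K) {ε : ℝ} (hε : 0 < ε) :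
    ∃ ω > 0, ∀ t ∈ I, ∀ s ∈ I, ∀ w ∈ K, |t - s| < ω → dist (F (t, w)) (F (s, w)) < ε := by
  have := (hI.prod hK).uniformContinuousOn_of_continuous hF.continuousOn
  obtain ⟨ω, hω, h⟩ := Metric.uniformContinuousOn_iff.1 this ε hε
  refine ⟨ω, hω, fun t ht s hs w hw hts => h _ ⟨ht, hw⟩ _ ⟨hs, hw⟩ ?_⟩
  rwa [dist_prod_same_right, Real.dist_eq]

variable {k d : ℕ}

/-- The anisotropic scaling `(t, x) ↦ (α t, β x)` with values in a Hilbert space. -/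
noncomputable def scaleMap (k : ℕ) (α β : ℝ) : ℝ × Euc k →L[ℝ] WithLp 2 (ℝ × Euc k) :=
  (WithLp.prodContinuousLinearEquiv 2 ℝ ℝ (Euc k)).symm.toContinuousLinearMap ∘L
    ((α • ContinuousLinearMap.fst ℝ ℝ (Euc k)).prod (β • ContinuousLinearMap.snd ℝ ℝ (Euc k)))

theorem norm_scaleMap_sq (α β : ℝ) (z : ℝ × Euc k) :
    ‖scaleMap k α β z‖ ^ 2 = α ^ 2 * z.1 ^ 2 + β ^ 2 * ‖z.2‖ ^ 2 := by
  rw [WithLp.prod_norm_sq_eq_of_L2]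
  change ‖α * z.1‖ ^ 2 + ‖β • z.2‖ ^ 2 = _
  rw [norm_smul, mul_pow, Real.norm_eq_abs, Real.norm_eq_abs, sq_abs, sq_abs, mul_pow]

theorem norm_scaleMap_time {α : ℝ} (hα : 0 ≤ α) (β : ℝ) : ‖scaleMap k α β (1, 0)‖ = α := by
  have := norm_scaleMap_sq (k := k) α β (1, 0)
  simp only [norm_zero] at this
  rw [← Real.sqrt_sq (norm_nonneg _), this]
  simp [Real.sqrt_sq hα]

theorem norm_scaleMap_space (α : ℝ) {β : ℝ} (hβ : 0 ≤ β) (v : Euc k) :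
    ‖scaleMap k α β (0, v)‖ = β * ‖v‖ := by
  have := norm_scaleMap_sq (k := k) α β (0, v)
  rw [← Real.sqrt_sq (norm_nonneg _), this, ← Real.sqrt_sq (by positivity : 0 ≤ β * ‖v‖)]
  congr 1; ring

end Doubling

section DoublingMain

theorem abs_inner_add_inner_le {X : Type*} [NormedAddCommGroup X] [InnerProductSpace ℝ X]
    {η p₁ p₂ : X} {κ : ℝ} (h₁ : ‖p₁ - (3 : ℝ) • η‖ ≤ κ) (h₂ : ‖p₂ + (3 : ℝ) • η‖ ≤ κ) (V W : X) :
    |⟪p₁, V⟫ + ⟪p₂, W⟫| ≤ κ * (‖V‖ + ‖W‖) + 3 * ‖η‖ * ‖V - W‖ := by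
  have e : ⟪p₁, V⟫ + ⟪p₂, W⟫ =
      ⟪p₁ - (3 : ℝ) • η, V⟫ + ⟪p₂ + (3 : ℝ) • η, W⟫ + 3 * ⟪η, V - W⟫ := by
    rw [inner_sub_left, inner_add_left, inner_sub_right, real_inner_smul_left,
      real_inner_smul_left]
    ring
  rw [e]
  have a1 := abs_real_inner_le_norm (p₁ - (3 : ℝ) • η) V
  have a2 := abs_real_inner_le_norm (p₂ + (3 : ℝ) • η) W
  have a3 := abs_real_inner_le_norm η (V - W)
  have b1 : ‖p₁ - (3 : ℝ) • η‖ * ‖V‖ ≤ κ * ‖V‖ := by gcongr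
  have b2 : ‖p₂ + (3 : ℝ) • η‖ * ‖W‖ ≤ κ * ‖W‖ := by gcongr
  rw [abs_le] at *
  constructor <;> linarith [a1.1, a1.2, a2.1, a2.2, a3.1, a3.2]

variable {k d : ℕ}

set_option maxHeartbeats 4000000 in
/-- Doubling of variables: approximate second-order jets at nearby interior points. -/
theorem ObstacleData.Regular.exists_doubling {D : ObstacleData k d} (hD : D.Regular) {a' T' ρ R : ℝ}
    (hρ : 0 ≤ ρ)
    {u₁ u₂ : ℝ × Euc k → ℝ}
    (hu₁ : UpperSemicontinuousOn u₁ (Icc a' T' ×ˢ Metric.closedBall 0 ρ))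
    (hu₂ : UpperSemicontinuousOn u₂ (Icc a' T' ×ˢ Metric.closedBall 0 ρ))
    (hdiag : ∀ P ∈ Icc a' T' ×ˢ Metric.closedBall (0 : Euc k) ρ, u₁ P + u₂ P ≤ 0)
    (hsup : ∀ κ > 0, ∃ P ∈ Icc a' T' ×ˢ Metric.closedBall (0 : Euc k) ρ, -κ ≤ u₁ P + u₂ P)
    (h_nonneg : ∀ P ∈ Icc a' T' ×ˢ Metric.closedBall (0 : Euc k) ρ, 0 ≤ u₁ P + u₂ P →
      P ∈ Ioo a' T' ×ˢ Metric.ball (0 : Euc k) ρ) {ε : ℝ} (hε : 0 < ε) :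
    ∃ P ∈ Ioo a' T' ×ˢ Metric.ball (0 : Euc k) ρ, ∃ Q ∈ Ioo a' T' ×ˢ Metric.ball (0 : Euc k) ρ,
    ∃ (ℓ₁ ℓ₂ : ℝ × Euc k →L[ℝ] ℝ) (B₁ B₂ : ℝ × Euc k →L[ℝ] ℝ × Euc k →L[ℝ] ℝ),
      (∀ᶠ P' in 𝓝 P, u₁ P' ≤ u₁ P + quadTest P ℓ₁ B₁ P'.1 P'.2) ∧
      (∀ᶠ Q' in 𝓝 Q, u₂ Q' ≤ u₂ Q + quadTest Q ℓ₂ B₂ Q'.1 Q'.2) ∧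
      |ℓ₁ (1, 0) + ℓ₂ (1, 0)| ≤ ε ∧
      ∑ l, B₁ (0, D.S l P.1 P.2) (0, D.S l P.1 P.2) +
        ∑ l, B₂ (0, D.S l Q.1 Q.2) (0, D.S l Q.1 Q.2) ≤ ε ∧
      |ℓ₁ (0, D.bv P.1 P.2) + ℓ₂ (0, D.bv Q.1 Q.2)| ≤ ε ∧
      (∀ l, |ℓ₁ (0, D.S l P.1 P.2) + ℓ₂ (0, D.S l Q.1 Q.2)| ≤ ε) ∧
      (∀ r, |r| ≤ R → |D.f P.1 P.2 r (fun l => -ℓ₂ (0, D.S l Q.1 Q.2)) -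
        D.f Q.1 Q.2 r (fun l => -ℓ₂ (0, D.S l Q.1 Q.2))| ≤ ε) ∧
      |u₁ P + u₂ Q| ≤ ε ∧ dist P Q ≤ ε := by
  set K := Icc a' T' ×ˢ Metric.closedBall (0 : Euc k) ρ with hKdef
  set O := Ioo a' T' ×ˢ Metric.ball (0 : Euc k) ρ with hOdef
  have hKc : IsCompact K := isCompact_Icc.prod (isCompact_closedBall 0 ρ)
  have hOo : IsOpen O := isOpen_Ioo.prod Metric.isOpen_ball
  have hOK : O ⊆ K := prod_mono Ioo_subset_Icc_self Metric.ball_subset_closedBall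
  have hKne : K.Nonempty := by obtain ⟨P, hP, -⟩ := hsup 1 one_pos; exact ⟨P, hP⟩
  -- bounds for the coefficients
  obtain ⟨C, hC0, hC⟩ := hD.lip
  obtain ⟨B, hB0, hBb, hBS⟩ : ∃ B, 0 ≤ B ∧ (∀ P ∈ K, ‖D.bv P.1 P.2‖ ≤ B) ∧
      ∀ P ∈ K, ∀ l, ‖D.S l P.1 P.2‖ ≤ B := by
    obtain ⟨Cl, hCl, h⟩ := hD.lin
    have hle : ∀ P ∈ K, ∀ v : Euc k, ‖v‖ ^ 2 ≤ Cl * (1 + ‖P.2‖ ^ 2) →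
        ‖v‖ ≤ √(Cl * (1 + ρ ^ 2)) := by
      intro P hP v hv
      have h2 : ‖P.2‖ ≤ ρ := by simpa using hP.2
      refine Real.le_sqrt_of_sq_le (hv.trans ?_)
      gcongr
    exact ⟨√(Cl * (1 + ρ ^ 2)), Real.sqrt_nonneg _, fun P hP => hle P hP _ (h P.1 P.2).1,
      fun P hP l => hle P hP _ ((h P.1 P.2).2 l)⟩
  obtain ⟨δΦ, hδΦ, hΦ⟩ := hD.f_mod (max ρ R + 1) (by positivity) (ε / 2) (by positivity)
  -- choice of the main small parameter
  obtain ⟨δ, hδ0, hδ1, hδε, hδ2, hδ3⟩ : ∃ δ > 0, δ ≤ 1 ∧ δ ≤ ε ∧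
      δ * (6 * (d + 1) * (C + 1) ^ 2) ≤ ε ∧ δ * (1 + 4 * B) < δΦ := by
    refine ⟨min (min 1 ε) (min (ε / (6 * (d + 1) * (C + 1) ^ 2)) (δΦ / (2 * (1 + 4 * B)))),
      by positivity, (min_le_left _ _).trans (min_le_left _ _),
      (min_le_left _ _).trans (min_le_right _ _), ?_, ?_⟩
    · rw [← le_div_iff₀ (by positivity)]
      exact (min_le_right _ _).trans (min_le_left _ _)
    · have : min (min 1 ε) (min (ε / (6 * (d + 1) * (C + 1) ^ 2)) (δΦ / (2 * (1 + 4 * B)))) ≤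
        δΦ / (2 * (1 + 4 * B)) := (min_le_right _ _).trans (min_le_right _ _)
      rw [le_div_iff₀ (by positivity)] at this
      linarith
  have hδsq : δ ^ 2 ≤ δ := by nlinarith
  obtain ⟨N₀, hN₀, hpen⟩ := exists_penalization hKc hu₁ hu₂ hOo hdiag h_nonneg
    (show 0 < δ ^ 2 / 2 by positivity)
  obtain ⟨N, hN0, hNN, hNδ⟩ : ∃ N > 0, N₀ ≤ N ∧ 1 / N ≤ δ ^ 2 / 2 := by
    refine ⟨max N₀ (1 / (δ ^ 2 / 2)), by positivity, le_max_left _ _, ?_⟩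
    rw [one_div_le (by positivity) (by positivity)]
    exact le_max_right _ _
  set β := N + 2 with hβ
  have hβ0 : 0 < β := by positivity
  have hβ1 : 1 ≤ β := by linarith
  obtain ⟨ωb, hωb, hωb'⟩ := exists_time_modulus (F := fun p : ℝ × Euc k => D.bv p.1 p.2) hD.bv_cont
    (isCompact_Icc (a := a') (b := T')) (isCompact_closedBall (0 : Euc k) ρ)
    (show 0 < δ / β by positivity)
  obtain ⟨ωS, hωS, hωS'⟩ := exists_time_modulus
    (F := fun p : ℝ × Euc k => fun l => D.S l p.1 p.2) (continuous_pi fun l => hD.S_cont l)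
    (isCompact_Icc (a := a') (b := T')) (isCompact_closedBall (0 : Euc k) ρ)
    (show 0 < δ / β by positivity)
  obtain ⟨ωf, hωf, hωf'⟩ := exists_time_modulus
    (F := fun q : ℝ × (Euc k × ℝ × (Fin d → ℝ)) => D.f q.1 q.2.1 q.2.2.1 q.2.2.2) hD.f_cont
    (isCompact_Icc (a := a') (b := T'))
    ((isCompact_closedBall (0 : Euc k) ρ).prod ((isCompact_Icc (a := -R) (b := R)).prod
      (isCompact_closedBall (0 : Fin d → ℝ) (4 * β * B))))
    (show 0 < ε / 2 by positivity)
  set ω := min ωb (min ωS ωf) with hω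
  have hω0 : 0 < ω := by positivity
  set α := β + 2 / ω with hα
  have hα0 : 0 < α := by positivity
  have hαβ : β ≤ α := by have : 0 < 2 / ω := by positivity
                         linarith
  obtain ⟨κ, hκ0, hκN, hκδ, hκ⟩ : ∃ κ > 0, 2 * κ ≤ 1 / N ∧ κ ≤ δ ∧
      κ * (2 * α + 4 * β * B + 12 * β ^ 2 * d * B ^ 2 + 1) ≤ ε := by
    refine ⟨min (1 / N / 2) (min δ (ε / (2 * α + 4 * β * B + 12 * β ^ 2 * d * B ^ 2 + 1))),
      by positivity, ?_, (min_le_right _ _).trans (min_le_left _ _), ?_⟩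
    · have := min_le_left (1 / N / 2)
        (min δ (ε / (2 * α + 4 * β * B + 12 * β ^ 2 * d * B ^ 2 + 1)))
      linarith
    · rw [← le_div_iff₀ (by positivity)]
      exact (min_le_right _ _).trans (min_le_right _ _)
  have hκα : 2 * κ * α ≤ ε := by
    have : 0 ≤ κ * (4 * β * B + 12 * β ^ 2 * d * B ^ 2 + 1) := by positivity
    linarith
  have hκB : κ * (4 * β * B) ≤ ε := by
    have : 0 ≤ κ * (2 * α + 12 * β ^ 2 * d * B ^ 2 + 1) := by positivity
    linarith
  have hκ2 : κ * (12 * β ^ 2 * d * B ^ 2) ≤ ε := by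
    have : 0 ≤ κ * (2 * α + 4 * β * B + 1) := by positivity
    linarith
  set M := scaleMap k α β with hM
  obtain ⟨P, hP, Q, hQ, η, p₁, p₂, A₁, A₂, hm1, hm2, hp₁, hp₂, hj1, hj2, hA⟩ :=
    theorem_on_sums hKc hKne hu₁ hu₂ M hκ0
  obtain ⟨P₀, hP₀, hP₀'⟩ := hsup κ hκ0
  have hr1 := hm1 P₀ hP₀ P₀ hP₀
  have hr2 := hm2 P₀ hP₀ P₀ hP₀
  rw [sub_self, norm_zero] at hr1 hr2
  have hsq : ‖M P - M Q‖ ^ 2 = α ^ 2 * (P.1 - Q.1) ^ 2 + β ^ 2 * ‖P.2 - Q.2‖ ^ 2 := by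
    rw [← map_sub, hM, norm_scaleMap_sq]; rfl
  have hdist : N * dist P Q ^ 2 ≤ 1 / 2 * ‖M P - M Q‖ ^ 2 := by
    have h1 : dist P Q ^ 2 ≤ (P.1 - Q.1) ^ 2 + ‖P.2 - Q.2‖ ^ 2 := by
      rw [Prod.dist_eq, Real.dist_eq, dist_eq_norm]
      rcases max_choice |P.1 - Q.1| ‖P.2 - Q.2‖ with h | h <;> rw [h]
      · rw [sq_abs]; linarith [sq_nonneg ‖P.2 - Q.2‖]
      · linarith [sq_nonneg (P.1 - Q.1)]
    have h2 : 2 * N ≤ β ^ 2 := by rw [hβ]; nlinarith only [hN0, sq_nonneg N]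
    have h3 : β ^ 2 ≤ α ^ 2 := by gcongr
    rw [hsq]
    have h4 : 2 * N * (P.1 - Q.1) ^ 2 ≤ α ^ 2 * (P.1 - Q.1) ^ 2 := by
      have := h2.trans h3; gcongr
    have h5 : 2 * N * ‖P.2 - Q.2‖ ^ 2 ≤ β ^ 2 * ‖P.2 - Q.2‖ ^ 2 := by gcongr
    have h6 : N * dist P Q ^ 2 ≤ N * ((P.1 - Q.1) ^ 2 + ‖P.2 - Q.2‖ ^ 2) := by gcongr
    linarith
  obtain ⟨hDle, hrle, hPO, hQO⟩ := hpen N hNN P hP Q hQ _ hdist (by linarith)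
  have hη : ‖η‖ ≤ δ := by
    have : ‖η‖ ^ 2 ≤ δ ^ 2 := by linarith [sq_nonneg δ]
    exact abs_le_of_sq_le_sq' this hδ0.le |>.2
  have hMd : ‖M P - M Q‖ ^ 2 ≤ δ ^ 2 := by linarith
  have hx : β * ‖P.2 - Q.2‖ ≤ δ := by
    have : (β * ‖P.2 - Q.2‖) ^ 2 ≤ δ ^ 2 := by
      rw [mul_pow]
      rw [hsq] at hMd
      linarith [mul_nonneg (sq_nonneg α) (sq_nonneg (P.1 - Q.1))]
    exact abs_le_of_sq_le_sq' this hδ0.le |>.2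
  have hx' : ‖P.2 - Q.2‖ ≤ δ / β := by rw [le_div_iff₀ hβ0]; linarith
  have ht : α * |P.1 - Q.1| ≤ δ := by
    have : (α * |P.1 - Q.1|) ^ 2 ≤ δ ^ 2 := by
      rw [mul_pow, sq_abs]
      rw [hsq] at hMd
      linarith [mul_nonneg (sq_nonneg β) (sq_nonneg ‖P.2 - Q.2‖)]
    exact abs_le_of_sq_le_sq' this hδ0.le |>.2
  have htω : |P.1 - Q.1| < ω := by
    have h1 : 2 / ω * |P.1 - Q.1| ≤ 1 := by
      have : 0 ≤ β * |P.1 - Q.1| := by positivity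
      rw [hα, add_mul] at ht
      linarith
    rw [div_mul_eq_mul_div, div_le_iff₀ hω0] at h1
    linarith
  have hPQd : dist P Q ≤ δ := by
    rw [Prod.dist_eq, Real.dist_eq, dist_eq_norm]
    refine max_le ?_ ?_
    · nlinarith only [abs_nonneg (P.1 - Q.1), ht, hαβ, hβ1]
    · nlinarith only [norm_nonneg (P.2 - Q.2), hx, hβ1]
  have hn0 : ∀ v, ‖M (0, v)‖ = β * ‖v‖ := norm_scaleMap_space α hβ0.le
  have hsub : ∀ v w : Euc k, ‖M (0, v) - M (0, w)‖ = β * ‖v - w‖ := fun v w => by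
    rw [← map_sub, Prod.mk_sub_mk, sub_zero, hn0]
  have hcl : ∀ {u v : Euc k}, ‖u‖ ≤ C * ‖P.2 - Q.2‖ → ‖v‖ ≤ δ / β →
      β * ‖u + v‖ ≤ (C + 1) * δ := by
    intro u v hu hv
    have h1 := norm_add_le u v
    have h2 : β * ‖v‖ ≤ δ := by rw [le_div_iff₀ hβ0] at hv; linarith
    have h3 : β * ‖u‖ ≤ C * δ := by
      calc β * ‖u‖ ≤ β * (C * ‖P.2 - Q.2‖) := by gcongr
        _ = C * (β * ‖P.2 - Q.2‖) := by ring
        _ ≤ C * δ := by gcongr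
    nlinarith only [h1, h2, h3, hβ0]
  have hbd : β * ‖D.bv P.1 P.2 - D.bv Q.1 Q.2‖ ≤ (C + 1) * δ := by
    rw [← sub_add_sub_cancel _ (D.bv P.1 Q.2)]
    refine hcl (hC P.1 P.2 Q.2).1 ?_
    have := hωb' P.1 hP.1 Q.1 hQ.1 Q.2 hQ.2 (htω.trans_le (min_le_left _ _))
    rw [dist_eq_norm] at this
    exact this.le
  have hSd : ∀ l, β * ‖D.S l P.1 P.2 - D.S l Q.1 Q.2‖ ≤ (C + 1) * δ := by
    intro l
    rw [← sub_add_sub_cancel _ (D.S l P.1 Q.2)]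
    refine hcl ((hC P.1 P.2 Q.2).2 l) ?_
    have := hωS' P.1 hP.1 Q.1 hQ.1 Q.2 hQ.2
      (htω.trans_le ((min_le_right _ _).trans (min_le_left _ _)))
    rw [← dist_eq_norm]
    exact (dist_le_pi_dist (fun l => D.S l P.1 Q.2) (fun l => D.S l Q.1 Q.2) l).trans this.le
  have hCδ : 3 * δ * ((C + 1) * δ) ≤ ε / 2 := by
    have h1 : 3 * δ * ((C + 1) * δ) ≤ 3 * ((C + 1) ^ 2 * δ) := by
      have : δ * ((C + 1) * δ) ≤ 1 * ((C + 1) * δ * (C + 1)) := by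
        have : (C + 1) * δ ≤ (C + 1) * δ * (C + 1) :=
          le_mul_of_one_le_right (by positivity) (by linarith only [hC0])
        gcongr
      linarith only [this]
    have h2 : 0 ≤ δ * (6 * d * (C + 1) ^ 2) := by positivity
    linarith only [h1, h2, hδ2]
  have hfirst : ∀ v w : Euc k, ‖v‖ ≤ B → ‖w‖ ≤ B → β * ‖v - w‖ ≤ (C + 1) * δ →
      |⟪p₁, M (0, v)⟫ + ⟪p₂, M (0, w)⟫| ≤ ε := by
    intro v w hv hw hvw
    refine (abs_inner_add_inner_le hp₁ hp₂ _ _).trans ?_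
    rw [hsub, hn0, hn0]
    have h1 : 3 * ‖η‖ * (β * ‖v - w‖) ≤ 3 * δ * ((C + 1) * δ) := by gcongr
    have h2 : κ * (β * ‖v‖ + β * ‖w‖) ≤ κ * (β * B + β * B) := by gcongr
    linarith
  let A₁' := A₁ + (2 * κ) • ContinuousLinearMap.id ℝ (WithLp 2 (ℝ × Euc k))
  let A₂' := A₂ + (2 * κ) • ContinuousLinearMap.id ℝ (WithLp 2 (ℝ × Euc k))
  let B₁ := (innerSL ℝ).bilinearComp (A₁' ∘L M) M
  let B₂ := (innerSL ℝ).bilinearComp (A₂' ∘L M) M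
  have hB₁ : ∀ z, B₁ z z = ⟪A₁ (M z), M z⟫ + 2 * κ * ‖M z‖ ^ 2 := by
    intro z
    change ⟪A₁ (M z) + (2 * κ) • M z, M z⟫ = _
    rw [inner_add_left, real_inner_smul_left, real_inner_self_eq_norm_sq]
  have hB₂ : ∀ z, B₂ z z = ⟪A₂ (M z), M z⟫ + 2 * κ * ‖M z‖ ^ 2 := by
    intro z
    change ⟪A₂ (M z) + (2 * κ) • M z, M z⟫ = _
    rw [inner_add_left, real_inner_smul_left, real_inner_self_eq_norm_sq]
  refine ⟨P, hPO, Q, hQO, (innerSL ℝ p₁) ∘L M, (innerSL ℝ p₂) ∘L M, B₁, B₂, ?_, ?_, ?_, ?_,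
    hfirst _ _ (hBb P hP) (hBb Q hQ) hbd,
    fun l => hfirst _ _ (hBS P hP l) (hBS Q hQ l) (hSd l), ?_, ?_, hPQd.trans hδε⟩
  · filter_upwards [hj1 κ hκ0, hOo.mem_nhds hPO] with P' h1 h2
    refine (h1 (hOK h2)).trans (le_of_eq ?_)
    simp only [quadTest, Prod.mk.eta, hB₁]
    change _ = u₁ P + (⟪p₁, M (P' - P)⟫ + _)
    ring
  · filter_upwards [hj2 κ hκ0, hOo.mem_nhds hQO] with P' h1 h2
    refine (h1 (hOK h2)).trans (le_of_eq ?_)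
    simp only [quadTest, Prod.mk.eta, hB₂]
    change _ = u₂ Q + (⟪p₂, M (P' - Q)⟫ + _)
    ring
  · have := abs_inner_add_inner_le hp₁ hp₂ (M (1, 0)) (M (1, 0))
    rw [sub_self, norm_zero, norm_scaleMap_time hα0.le] at this
    refine this.trans ?_
    linarith
  · rw [← Finset.sum_add_distrib]
    have hterm : ∀ l, B₁ (0, D.S l P.1 P.2) (0, D.S l P.1 P.2) +
        B₂ (0, D.S l Q.1 Q.2) (0, D.S l Q.1 Q.2) ≤
        3 * ((C + 1) ^ 2 * δ) + 6 * κ * β ^ 2 * B ^ 2 := by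
      intro l
      have h1 := hA (M (0, D.S l P.1 P.2)) (M (0, D.S l Q.1 Q.2))
      rw [hsub, hn0, hn0] at h1
      rw [hB₁, hB₂, hn0, hn0]
      have h2 : (β * ‖D.S l P.1 P.2 - D.S l Q.1 Q.2‖) ^ 2 ≤ ((C + 1) * δ) ^ 2 := by
        have := hSd l; gcongr
      have h3 : (β * ‖D.S l P.1 P.2‖) ^ 2 ≤ (β * B) ^ 2 := by
        have := hBS P hP l; gcongr
      have h4 : (β * ‖D.S l Q.1 Q.2‖) ^ 2 ≤ (β * B) ^ 2 := by
        have := hBS Q hQ l; gcongr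
      have h5 : ((C + 1) * δ) ^ 2 ≤ (C + 1) ^ 2 * δ := by rw [mul_pow]; gcongr
      have h6 : κ * ((β * ‖D.S l P.1 P.2‖) ^ 2 + (β * ‖D.S l Q.1 Q.2‖) ^ 2) ≤
        κ * ((β * B) ^ 2 + (β * B) ^ 2) := by gcongr
      linarith only [h1, h2, h5, h6]
    refine (Finset.sum_le_sum fun l _ => hterm l).trans ?_
    rw [Finset.sum_const, Finset.card_univ, Fintype.card_fin, nsmul_eq_mul]
    have h7 : 0 ≤ δ * (C + 1) ^ 2 := by positivity
    linarith
  · intro r hr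
    set z : Fin d → ℝ := fun l => -((innerSL ℝ p₂) ∘L M) (0, D.S l Q.1 Q.2) with hz
    have hp₂n : ‖p₂‖ ≤ 4 * δ := by
      have h1 := norm_sub_le (p₂ + (3 : ℝ) • η) ((3 : ℝ) • η)
      rw [add_sub_cancel_right, norm_smul] at h1
      norm_num at h1
      linarith
    have hzn : ‖z‖ ≤ 4 * δ * (β * B) := by
      rw [pi_norm_le_iff_of_nonneg (by positivity)]
      intro l
      rw [hz, norm_neg]
      refine (norm_inner_le_norm (𝕜 := ℝ) p₂ (M (0, D.S l Q.1 Q.2))).trans ?_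
      rw [hn0]
      have := hBS Q hQ l
      gcongr
    have hPn : ‖P.2‖ ≤ ρ := by simpa using hP.2
    have hQn : ‖Q.2‖ ≤ ρ := by simpa using hQ.2
    have h1 := hΦ P.1 P.2 Q.2 (by linarith [le_max_left ρ R]) (by linarith [le_max_left ρ R]) r
      (by linarith [le_max_right ρ R]) z (by
        have e1 : ‖z‖ * ‖P.2 - Q.2‖ ≤ 4 * δ * (β * B) * ‖P.2 - Q.2‖ := by gcongr
        have e2 : 4 * δ * (β * B) * ‖P.2 - Q.2‖ = 4 * δ * B * (β * ‖P.2 - Q.2‖) := by ring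
        have e3 : 4 * δ * B * (β * ‖P.2 - Q.2‖) ≤ 4 * 1 * B * δ := by gcongr
        have e4 : ‖P.2 - Q.2‖ ≤ δ := by nlinarith only [norm_nonneg (P.2 - Q.2), hx, hβ1]
        linarith)
    have h2 := hωf' P.1 hP.1 Q.1 hQ.1 (Q.2, r, z) ⟨hQ.2, abs_le.1 hr, by
        rw [mem_closedBall_zero_iff]
        refine hzn.trans ?_
        have : 0 ≤ β * B := by positivity
        nlinarith only [this, hδ1]⟩
      (htω.trans_le ((min_le_right _ _).trans (min_le_right _ _)))
    rw [Real.dist_eq] at h2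
    simp only at h2
    have h3 := abs_sub_le (D.f P.1 P.2 r z) (D.f P.1 Q.2 r z) (D.f Q.1 Q.2 r z)
    linarith
  · rw [abs_le]
    constructor
    · linarith [sq_nonneg ‖M P - M Q‖]
    · linarith
end DoublingMain

section Barrier

variable {k d : ℕ}

/-- The weight `e^{Λ (T - t)} (1 + |x - x₀|²)^(n + 2)`. -/
noncomputable def weight (T Λ : ℝ) (n : ℕ) (x₀ : Euc k) (t : ℝ) (x : Euc k) : ℝ :=
  Real.exp (Λ * (T - t)) * (1 + ‖x - x₀‖ ^ 2) ^ (n + 2)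

variable (T Λ : ℝ) (n : ℕ) (x₀ : Euc k)

theorem isC12_weight : IsC12 (weight T Λ n x₀) := by
  refine isC12_of_contDiff (Q := fun p : ℝ × Euc k =>
    Real.exp (Λ * (T - p.1)) * (1 + ‖p.2 - x₀‖ ^ 2) ^ (n + 2)) ?_
  have h1 : ContDiff ℝ 2 fun p : ℝ × Euc k => ‖p.2 - x₀‖ ^ 2 :=
    (contDiff_snd.sub contDiff_const).norm_sq ℝ
  have h2 : ContDiff ℝ 2 fun p : ℝ × Euc k => Real.exp (Λ * (T - p.1)) :=
    Real.contDiff_exp.comp (contDiff_const.mul (contDiff_const.sub contDiff_fst))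
  exact h2.mul ((contDiff_const.add h1).pow _)

theorem weight_pos (t : ℝ) (x : Euc k) : 0 < weight T Λ n x₀ t x := by
  unfold weight; positivity

variable {T Λ} in
theorem pow_le_weight (hΛ : 0 ≤ Λ) {t : ℝ} (ht : t ≤ T) (x : Euc k) :
    (1 + ‖x - x₀‖ ^ 2) ^ (n + 2) ≤ weight T Λ n x₀ t x := by
  have : 1 ≤ Real.exp (Λ * (T - t)) := Real.one_le_exp (mul_nonneg hΛ (sub_nonneg.2 ht))
  unfold weight
  exact le_mul_of_one_le_left (by positivity) this

variable {T Λ} in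
theorem one_le_weight (hΛ : 0 ≤ Λ) {t : ℝ} (ht : t ≤ T) (x : Euc k) :
    1 ≤ weight T Λ n x₀ t x :=
  (one_le_pow₀ (by linarith [sq_nonneg ‖x - x₀‖])).trans (pow_le_weight n x₀ hΛ ht x)

theorem timeDeriv_weight (t : ℝ) (x : Euc k) :
    timeDeriv (weight T Λ n x₀) t x = -Λ * weight T Λ n x₀ t x := by
  have h : HasDerivAt (fun s => Real.exp (Λ * (T - s)) * (1 + ‖x - x₀‖ ^ 2) ^ (n + 2))
      (Real.exp (Λ * (T - t)) * (Λ * -1) * (1 + ‖x - x₀‖ ^ 2) ^ (n + 2)) t :=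
    ((((hasDerivAt_id t).const_sub T).const_mul Λ).exp).mul_const _
  refine h.deriv.trans ?_
  unfold weight; ring

theorem hasFDerivAt_one_add_norm_sq (x : Euc k) :
    HasFDerivAt (fun y => 1 + ‖y - x₀‖ ^ 2) ((2 : ℝ) • innerSL ℝ (x - x₀)) x := by
  have := ((hasFDerivAt_id x).sub_const x₀).norm_sq.const_add 1
  refine this.congr_fderiv ?_
  ext v; simp

theorem fderiv_weight (t : ℝ) : fderiv ℝ (weight T Λ n x₀ t) = fun x =>
    (Real.exp (Λ * (T - t)) * (2 * (n + 2)) * (1 + ‖x - x₀‖ ^ 2) ^ (n + 1)) •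
      innerSL ℝ (x - x₀) := by
  ext1 x
  have h := ((hasFDerivAt_one_add_norm_sq x₀ x).pow (n + 2)).const_mul (Real.exp (Λ * (T - t)))
  refine h.fderiv.trans ?_
  rw [smul_smul, smul_smul]
  congr 1
  push_cast
  ring_nf

theorem fderiv_fderiv_weight (t : ℝ) (x h : Euc k) :
    fderiv ℝ (fderiv ℝ (weight T Λ n x₀ t)) x h h =
      Real.exp (Λ * (T - t)) * (2 * (n + 2)) * ((1 + ‖x - x₀‖ ^ 2) ^ (n + 1) * ‖h‖ ^ 2 +
        2 * (n + 1) * (1 + ‖x - x₀‖ ^ 2) ^ n * ⟪x - x₀, h⟫ ^ 2) := by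
  rw [fderiv_weight]
  have h1 := ((hasFDerivAt_one_add_norm_sq x₀ x).pow (n + 1)).const_mul
    (Real.exp (Λ * (T - t)) * (2 * (n + 2)))
  let J : Euc k →L[ℝ] Euc k →L[ℝ] ℝ := innerSL ℝ
  have h2 : HasFDerivAt (fun y : Euc k => J (y - x₀)) J x := by
    have := J.hasFDerivAt (x := x - x₀)
    exact (this.comp x ((hasFDerivAt_id x).sub_const x₀)).congr_fderiv (by ext; rfl)
  have h3 := h1.fun_smul h2
  refine (congrArg (fun A : Euc k →L[ℝ] Euc k →L[ℝ] ℝ => A h h) h3.fderiv).trans ?_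
  have hJ : ∀ y z, J y z = ⟪y, z⟫ := fun y z => innerSL_apply_apply ℝ y z
  simp only [_root_.add_apply, _root_.smul_apply, ContinuousLinearMap.smulRight_apply, smul_eq_mul,
    hJ, innerSL_apply_apply, real_inner_self_eq_norm_sq, nsmul_eq_mul]
  push_cast
  ring

theorem one_add_norm_sq_le (x : Euc k) :
    1 + ‖x‖ ^ 2 ≤ 2 * (1 + ‖x₀‖ ^ 2) * (1 + ‖x - x₀‖ ^ 2) := by
  have h1 : ‖x‖ ≤ ‖x - x₀‖ + ‖x₀‖ := by simpa using norm_add_le (x - x₀) x₀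
  have h2 : ‖x‖ ^ 2 ≤ (‖x - x₀‖ + ‖x₀‖) ^ 2 := by gcongr
  nlinarith [sq_nonneg (‖x - x₀‖ - ‖x₀‖), mul_nonneg (sq_nonneg ‖x - x₀‖) (sq_nonneg ‖x₀‖)]

theorem abs_fderiv_weight_le {c : ℝ} (t : ℝ) {x v : Euc k}
    (hv : ‖v‖ ^ 2 ≤ c * (1 + ‖x - x₀‖ ^ 2)) :
    |fderiv ℝ (weight T Λ n x₀ t) x v| ≤ (2 * (n + 2)) * (1 + c) * weight T Λ n x₀ t x := by
  rw [fderiv_weight]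
  set E := Real.exp (Λ * (T - t))
  have hE : 0 < E := Real.exp_pos _
  set N := 1 + ‖x - x₀‖ ^ 2 with hN
  have hN0 : 0 < N := by positivity
  simp only [_root_.smul_apply, innerSL_apply_apply, smul_eq_mul, weight]
  rw [abs_mul, abs_of_pos (by positivity)]
  have h1 := abs_real_inner_le_norm (x - x₀) v
  have h2 : ‖x - x₀‖ * ‖v‖ ≤ (1 + c) * N := by
    nlinarith [sq_nonneg (‖x - x₀‖ - ‖v‖), (sq_nonneg ‖v‖).trans hv]
  calc E * (2 * (n + 2)) * N ^ (n + 1) * |⟪x - x₀, v⟫|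
      ≤ E * (2 * (n + 2)) * N ^ (n + 1) * ((1 + c) * N) := by
        have := h1.trans h2; gcongr
    _ = _ := by ring

theorem abs_fderiv_fderiv_weight_le {c : ℝ} (_hc : 0 ≤ c) (t : ℝ) {x v : Euc k}
    (hv : ‖v‖ ^ 2 ≤ c * (1 + ‖x - x₀‖ ^ 2)) :
    |fderiv ℝ (fderiv ℝ (weight T Λ n x₀ t)) x v v| ≤
      (2 * (n + 2)) * (c + 2 * (n + 1) * c) * weight T Λ n x₀ t x := by
  rw [fderiv_fderiv_weight]
  set E := Real.exp (Λ * (T - t))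
  have hE : 0 < E := Real.exp_pos _
  set N := 1 + ‖x - x₀‖ ^ 2 with hN
  have hN0 : 0 < N := by positivity
  simp only [weight]
  rw [abs_of_nonneg (by positivity)]
  have h1 : ⟪x - x₀, v⟫ ^ 2 ≤ N * (c * N) := by
    have h2 : ⟪x - x₀, v⟫ ^ 2 ≤ (‖x - x₀‖ * ‖v‖) ^ 2 :=
      sq_le_sq' (neg_le_of_abs_le (abs_real_inner_le_norm _ _)) (real_inner_le_norm _ _)
    rw [mul_pow] at h2
    refine h2.trans ?_
    gcongr
    rw [hN]; linarith
  calc E * (2 * (n + 2)) * (N ^ (n + 1) * ‖v‖ ^ 2 + 2 * (n + 1) * N ^ n * ⟪x - x₀, v⟫ ^ 2)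
      ≤ E * (2 * (n + 2)) * (N ^ (n + 1) * (c * N) + 2 * (n + 1) * N ^ n * (N * (c * N))) := by
        gcongr
    _ = _ := by ring

/-- The weights absorb all first and second order terms, uniformly in the exponential rate. -/
theorem ObstacleData.Regular.exists_weight_bound {D : ObstacleData k d} (hD : D.Regular) (n : ℕ)
    (x₀ : Euc k) : ∃ C, 0 ≤ C ∧ ∀ T Λ t x,
      |fderiv ℝ (weight T Λ n x₀ t) x (D.bv t x)| ≤ C * weight T Λ n x₀ t x ∧
      (∀ l, |fderiv ℝ (weight T Λ n x₀ t) x (D.S l t x)| ≤ C * weight T Λ n x₀ t x) ∧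
      |D.hess (weight T Λ n x₀) t x| ≤ C * weight T Λ n x₀ t x := by
  obtain ⟨C₀, hC₀, hlin⟩ := hD.lin
  set c := C₀ * (2 * (1 + ‖x₀‖ ^ 2)) with hc
  have hc0 : 0 ≤ c := by positivity
  have hle : ∀ x v : Euc k, ‖v‖ ^ 2 ≤ C₀ * (1 + ‖x‖ ^ 2) → ‖v‖ ^ 2 ≤ c * (1 + ‖x - x₀‖ ^ 2) := by
    intro x v hv
    refine hv.trans ?_
    rw [hc, mul_assoc]
    exact mul_le_mul_of_nonneg_left (one_add_norm_sq_le x₀ x) hC₀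
  set C₁ := (2 * ((n : ℝ) + 2)) * (1 + c)
  set C₂ := (d : ℝ) * ((2 * ((n : ℝ) + 2)) * (c + 2 * (n + 1) * c))
  refine ⟨max C₁ C₂, le_max_of_le_left (by positivity), fun T Λ t x => ?_⟩
  have hw := (weight_pos T Λ n x₀ t x).le
  refine ⟨(abs_fderiv_weight_le T Λ n x₀ t (hle x _ (hlin t x).1)).trans ?_,
    fun l => (abs_fderiv_weight_le T Λ n x₀ t (hle x _ ((hlin t x).2 l))).trans ?_, ?_⟩
  · exact mul_le_mul_of_nonneg_right (le_max_left _ _) hw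
  · exact mul_le_mul_of_nonneg_right (le_max_left _ _) hw
  · refine le_trans ?_ (mul_le_mul_of_nonneg_right (le_max_right C₁ C₂) hw)
    refine (Finset.abs_sum_le_sum_abs _ _).trans ((Finset.sum_le_sum fun l _ =>
      abs_fderiv_fderiv_weight_le T Λ n x₀ hc0 t (hle x _ ((hlin t x).2 l))).trans ?_)
    rw [Finset.sum_const, Finset.card_univ, Fintype.card_fin, nsmul_eq_mul, ← mul_assoc]

end Barrier

section Comparison

theorem exists_best_constant {Y : Type*} [TopologicalSpace Y] {K : Set Y} (hK : IsCompact K)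
    {χ w : Y → ℝ} (hχ : ContinuousOn χ K) (hχ1 : ∀ P ∈ K, 1 ≤ χ P) {c : ℝ} (hw : ∀ P ∈ K, w P ≤ c)
    {P₁ : Y} (hP₁ : P₁ ∈ K) {θ₁ : ℝ} (hθ₁ : θ₁ * χ P₁ ≤ w P₁) :
    ∃ θ, θ₁ ≤ θ ∧ (∀ P ∈ K, w P ≤ θ * χ P) ∧ ∀ κ > 0, ∃ P ∈ K, -κ ≤ w P - θ * χ P := by
  have hpos : ∀ P ∈ K, 0 < χ P := fun P hP => one_pos.trans_le (hχ1 P hP)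
  have hAb : BddAbove ((fun P => w P / χ P) '' K) := by
    refine ⟨max c 0, ?_⟩
    rintro _ ⟨P, hP, rfl⟩
    refine (div_le_iff₀ (hpos P hP)).2 (((hw P hP).trans (le_max_left c 0)).trans ?_)
    exact le_mul_of_one_le_right (le_max_right c 0) (hχ1 P hP)
  obtain ⟨M, hM⟩ := hK.bddAbove_image hχ
  have hM : ∀ P ∈ K, χ P ≤ M := fun P hP => hM ⟨P, hP, rfl⟩
  have hM0 : 0 < M := (hpos _ hP₁).trans_le (hM _ hP₁)
  refine ⟨sSup ((fun P => w P / χ P) '' K), ?_, fun P hP => ?_, fun κ hκ => ?_⟩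
  · exact ((le_div_iff₀ (hpos _ hP₁)).2 hθ₁).trans (le_csSup hAb ⟨P₁, hP₁, rfl⟩)
  · exact (div_le_iff₀ (hpos P hP)).1 (le_csSup hAb ⟨P, hP, rfl⟩)
  · obtain ⟨_, ⟨P, hP, rfl⟩, h⟩ := exists_lt_of_lt_csSup (s := (fun P => w P / χ P) '' K)
      ⟨_, ⟨P₁, hP₁, rfl⟩⟩ (sub_lt_self _ (div_pos hκ hM0))
    refine ⟨P, hP, ?_⟩
    have h2 := (lt_div_iff₀ (hpos P hP)).1 h
    have h3 : κ / M * χ P ≤ κ := by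
      rw [div_mul_eq_mul_div, div_le_iff₀ hM0]
      exact mul_le_mul_of_nonneg_left (hM P hP) hκ.le
    linarith

variable {k d : ℕ}

namespace ObstacleData

variable {D : ObstacleData k d}

/-- The two operator inequalities at a doubled pair are incompatible once the weight is strictly
dominating. -/
theorem not_G_le_zero_and {t s : ℝ} {x y : Euc k} {C Cf Λ X ε r₁ r₂ q₁ q₂ q s₁ s₂ sw : ℝ}
    {p₁ p₂ pw : Euc k →L[ℝ] ℝ} (hCf : 0 ≤ Cf)
    (hf : ∀ t x y y' z z', |D.f t x y z - D.f t x y' z'| ≤ Cf * (|y - y'| + ‖z - z'‖))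
    (hΛ : 1.5 * C + Cf + Cf * C + 1 ≤ Λ) (hX : 0 ≤ X) (hC : 0 ≤ C) (hε0 : 0 ≤ ε)
    (hε : ε * (4 + 2 * Cf) < X)
    (hq : q = -Λ * X) (hpw : |pw (D.bv t x)| ≤ C * X) (hpS : ∀ l, |pw (D.S l t x)| ≤ C * X)
    (hsw : |sw| ≤ C * X) (hqq : |q₁ + q₂| ≤ ε) (hss : s₁ + s₂ ≤ ε)
    (hpb : |p₁ (D.bv t x) + p₂ (D.bv s y)| ≤ ε)
    (hpp : ∀ l, |p₁ (D.S l t x) + p₂ (D.S l s y)| ≤ ε)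
    (hff : |D.f t x (-r₂) (fun l => -p₂ (D.S l s y)) -
      D.f s y (-r₂) (fun l => -p₂ (D.S l s y))| ≤ ε)
    (hr : |r₁ + r₂ - X| ≤ ε) (h₁ : D.G t x r₁ (q + q₁) (pw + p₁) (sw + s₁) ≤ 0)
    (h₂ : D.dual.G s y r₂ q₂ p₂ s₂ ≤ 0) : False := by
  simp only [G, dual, _root_.add_apply] at h₁ h₂
  have e1 : (-fun l => p₂ (D.S l s y)) = fun l => -p₂ (D.S l s y) := rfl
  rw [e1] at h₂
  set z := fun l => -p₂ (D.S l s y)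
  set z₁ := fun l => pw (D.S l t x) + p₁ (D.S l t x)
  have hz : ‖z₁ - z‖ ≤ C * X + ε := by
    refine (pi_norm_le_iff_of_nonneg (by positivity)).2 fun l => ?_
    have a := hpS l
    have b := hpp l
    rw [abs_le] at a b
    rw [Real.norm_eq_abs, abs_le]
    simp only [z₁, z, Pi.sub_apply]
    constructor <;> linarith
  have hy : |r₁ - -r₂| ≤ X + ε := by
    rw [abs_le] at hr ⊢
    constructor <;> linarith
  have hfz := (le_abs_self _).trans (hf t x r₁ (-r₂) z₁ z)
  have hfz2 : Cf * (|r₁ - -r₂| + ‖z₁ - z‖) ≤ Cf * (X + ε + (C * X + ε)) := by gcongr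
  have hΛX : (1.5 * C + Cf + Cf * C + 1) * X ≤ Λ * X := by gcongr
  rw [abs_le] at hpw hsw hqq hpb hff
  subst hq
  linarith only [hfz, hfz2, hΛX, hpw.1, hpw.2, hsw.1, hsw.2, hqq.1, hqq.2, hpb.1, hpb.2, hff.1,
    hff.2, h₁, h₂, hss, hε, hε0]

set_option maxHeartbeats 2000000 in
theorem Regular.comparison (hD : D.Regular) {a : ℝ} {u v : ℝ × Euc k → ℝ}
    (hu : UpperSemicontinuousOn u (Ioc a D.T ×ˢ univ))
    (hv : UpperSemicontinuousOn v (Ioc a D.T ×ˢ univ)) (su : D.IsSub a u) (sv : D.dual.IsSub a v)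
    (hT : ∀ x, u (D.T, x) + v (D.T, x) ≤ 0)
    (hgr : ∃ (C : ℝ) (n : ℕ), ∀ t ∈ Ioc a D.T, ∀ x, |u (t, x)| ≤ C * (1 + ‖x‖ ^ 2) ^ n ∧
      |v (t, x)| ≤ C * (1 + ‖x‖ ^ 2) ^ n) :
    ∀ t ∈ Ioc a D.T, ∀ x, u (t, x) + v (t, x) ≤ 0 := by
  intro t₁ ht₁ x₁
  by_contra! hm
  set m := u (t₁, x₁) + v (t₁, x₁)
  have ht₁T : t₁ < D.T := by
    refine lt_of_le_of_ne ht₁.2 fun h => ?_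
    have := hT x₁
    rw [← h] at this
    exact absurd hm (not_lt.2 this)
  obtain ⟨Cg, n, hg⟩ := hgr
  have hCg : 0 ≤ Cg := by
    have := (abs_nonneg _).trans (hg t₁ ht₁ x₁).1
    exact nonneg_of_mul_nonneg_left this (by positivity)
  obtain ⟨Cf, hCf, hf⟩ := hD.f_lip
  obtain ⟨C, hC, hw⟩ := hD.exists_weight_bound n 0
  set a' := (a + t₁) / 2
  have haa' : a < a' := by have := ht₁.1; simp only [a']; linarith
  have ha't : a' < t₁ := by have := ht₁.1; simp only [a']; linarith
  set N₁ := (1 + ‖x₁‖ ^ 2) ^ (n + 2)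
  have hN₁ : 0 < N₁ := by positivity
  obtain ⟨Λ, hΛ1, hΛ2⟩ : ∃ Λ, 1.5 * C + Cf + Cf * C + 1 ≤ Λ ∧
      2 * Cg * N₁ / (m * (t₁ - a')) ≤ Λ := ⟨max _ _, le_max_left _ _, le_max_right _ _⟩
  have hΛ0 : 0 ≤ Λ := le_trans (by positivity) hΛ1
  set χ := weight D.T Λ n (0 : Euc k)
  have hχpos : ∀ t x, 0 < χ t x := weight_pos D.T Λ n 0
  set θ₁ := m / χ t₁ x₁
  have hθ₁ : 0 < θ₁ := div_pos hm (hχpos _ _)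
  obtain ⟨ρ, hρ1, hρx⟩ : ∃ ρ, 1 + 2 * Cg / θ₁ ≤ ρ ∧ ‖x₁‖ ≤ ρ :=
    ⟨max _ _, le_max_left _ _, le_max_right _ _⟩
  have hρ0 : 0 ≤ ρ := (norm_nonneg _).trans hρx
  set K := Icc a' D.T ×ˢ Metric.closedBall (0 : Euc k) ρ with hK
  have hKc : IsCompact K := isCompact_Icc.prod (isCompact_closedBall 0 ρ)
  have hKsub : K ⊆ Ioc a D.T ×ˢ univ := by
    rintro ⟨t, x⟩ ⟨h1, -⟩
    exact ⟨⟨haa'.trans_le h1.1, h1.2⟩, mem_univ _⟩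
  have hKI : ∀ P ∈ K, P.1 ∈ Ioc a D.T := fun P hP => (hKsub hP).1
  have hKn : ∀ P ∈ K, ‖P.2‖ ≤ ρ := fun P hP => by simpa using hP.2
  have h1K : (t₁, x₁) ∈ K := ⟨⟨ha't.le, ht₁.2⟩, by simpa using hρx⟩
  have hχ1 : ∀ P ∈ K, 1 ≤ χ P.1 P.2 := fun P hP => one_le_weight n 0 hΛ0 (hKI P hP).2 P.2
  have hsum : ∀ P ∈ K, u P + v P ≤ 2 * Cg * (1 + ‖P.2‖ ^ 2) ^ n := by
    intro P hP
    have h := hg P.1 (hKI P hP) P.2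
    linarith [(le_abs_self _).trans h.1, (le_abs_self _).trans h.2]
  have hχc : Continuous fun P : ℝ × Euc k => χ P.1 P.2 := (isC12_weight D.T Λ n 0).continuous
  have hbound : ∀ P ∈ K, u P + v P ≤ 2 * Cg * (1 + ρ ^ 2) ^ n := by
    intro P hP
    have h1 := hKn P hP
    refine (hsum P hP).trans ?_
    gcongr
  have h1eq : θ₁ * χ t₁ x₁ = u (t₁, x₁) + v (t₁, x₁) := div_mul_cancel₀ _ (hχpos _ _).ne'
  obtain ⟨θ, hθθ, hdiag', hsup'⟩ := exists_best_constant hKc hχc.continuousOn hχ1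
    (w := fun P => u P + v P) hbound h1K h1eq.le
  have hθ0 : 0 < θ := hθ₁.trans_le hθθ
  have hdiag : ∀ P ∈ K, (u P - θ * χ P.1 P.2) + v P ≤ 0 := fun P hP => by
    have := hdiag' P hP
    linarith only [this]
  have hsup : ∀ κ > 0, ∃ P ∈ K, -κ ≤ (u P - θ * χ P.1 P.2) + v P := fun κ hκ => by
    obtain ⟨P, hP, h⟩ := hsup' κ hκ
    exact ⟨P, hP, by linarith only [h]⟩
  have h_nonneg : ∀ P ∈ K, 0 ≤ (u P - θ * χ P.1 P.2) + v P →
      P ∈ Ioo a' D.T ×ˢ Metric.ball (0 : Euc k) ρ := by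
    rintro ⟨t, x⟩ hP h
    have hs := hsum _ hP
    have hn : ‖x‖ ≤ ρ := hKn (t, x) hP
    have hlow : (1 + ‖x‖ ^ 2) ^ (n + 2) ≤ χ t x := by
      simpa using pow_le_weight n 0 hΛ0 (hKI _ hP).2 x
    have hNx : 0 < (1 + ‖x‖ ^ 2) ^ n := by positivity
    simp only at h hs
    refine ⟨⟨lt_of_le_of_ne hP.1.1 ?_, lt_of_le_of_ne hP.1.2 ?_⟩, ?_⟩
    · intro hta
      simp only at hta
      have e1 : χ t x = Real.exp (Λ * (D.T - a')) * (1 + ‖x‖ ^ 2) ^ (n + 2) := by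
        simp [χ, weight, hta]
      have e2 : θ₁ * Real.exp (Λ * (D.T - a')) = m / N₁ * Real.exp (Λ * (t₁ - a')) := by
        have : χ t₁ x₁ = Real.exp (Λ * (D.T - t₁)) * N₁ := by simp [χ, weight, N₁]
        simp only [θ₁]
        rw [this, show Λ * (D.T - a') = Λ * (D.T - t₁) + Λ * (t₁ - a') by ring, Real.exp_add]
        field_simp
      have e3 : 2 * Cg < m / N₁ * Real.exp (Λ * (t₁ - a')) := by
        have h4 : 2 * Cg * N₁ / m ≤ Λ * (t₁ - a') := by
          have : 0 < t₁ - a' := sub_pos.2 ha't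
          rw [div_le_iff₀ (by positivity)] at hΛ2
          rw [div_le_iff₀ hm]
          linarith
        have h5 := Real.add_one_le_exp (Λ * (t₁ - a'))
        have h6 : 2 * Cg * N₁ / m < Real.exp (Λ * (t₁ - a')) := by linarith
        rw [div_lt_iff₀ hm] at h6
        rw [div_mul_eq_mul_div, lt_div_iff₀ hN₁]
        linarith
      have e4 : 2 * Cg * (1 + ‖x‖ ^ 2) ^ n ≤ 2 * Cg * (1 + ‖x‖ ^ 2) ^ (n + 2) := by
        gcongr
        · linarith [sq_nonneg ‖x‖]
        · omega
      have e5 : 2 * Cg * (1 + ‖x‖ ^ 2) ^ (n + 2) < θ * χ t x := by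
        rw [e1, ← mul_assoc]
        refine mul_lt_mul_of_pos_right (e3.trans_le ?_) (by positivity)
        rw [← e2]
        gcongr
      linarith
    · intro hta
      simp only at hta
      have := hT x
      rw [← hta] at this
      have := mul_pos hθ0 (hχpos t x)
      linarith
    · rw [mem_ball_zero_iff]
      refine lt_of_le_of_ne hn fun hxρ => ?_
      simp only at hxρ
      have h7 : 2 * Cg < θ₁ * (1 + ‖x‖ ^ 2) ^ 2 := by
        have h8 : 2 * Cg / θ₁ < ρ := by linarith
        rw [div_lt_iff₀ hθ₁] at h8
        rw [hxρ]
        have : ρ ≤ (1 + ρ ^ 2) ^ 2 := by nlinarith [sq_nonneg (ρ - 1), sq_nonneg (ρ ^ 2)]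
        nlinarith
      have h9 : 2 * Cg * (1 + ‖x‖ ^ 2) ^ n < θ * χ t x := by
        calc 2 * Cg * (1 + ‖x‖ ^ 2) ^ n < θ₁ * (1 + ‖x‖ ^ 2) ^ 2 * (1 + ‖x‖ ^ 2) ^ n := by
              gcongr
          _ = θ₁ * (1 + ‖x‖ ^ 2) ^ (n + 2) := by ring
          _ ≤ θ * χ t x := by gcongr
      linarith
  -- uniform continuity of the obstacles
  obtain ⟨η, hη, hηL⟩ := Metric.uniformContinuousOn_iff.1
    (hKc.uniformContinuousOn_of_continuous hD.L_cont.continuousOn) (θ / 4) (by positivity)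
  obtain ⟨η', hη', hηH⟩ := Metric.uniformContinuousOn_iff.1
    (hKc.uniformContinuousOn_of_continuous hD.H_cont.continuousOn) (θ / 4) (by positivity)
  obtain ⟨ε, hε0, hε1, hε2, hε3⟩ : ∃ ε > 0, ε * (4 + 2 * Cf) < θ ∧ ε < η ∧ ε < η' := by
    refine ⟨min (θ / (2 * (4 + 2 * Cf))) (min (η / 2) (η' / 2)), by positivity, ?_, ?_, ?_⟩
    · refine lt_of_le_of_lt (mul_le_mul_of_nonneg_right (min_le_left _ _) (by positivity)) ?_
      rw [div_mul_eq_mul_div, div_lt_iff₀ (by positivity)]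
      nlinarith [mul_pos hθ0 (by positivity : 0 < 4 + 2 * Cf)]
    · exact ((min_le_right _ _).trans (min_le_left _ _)).trans_lt (by linarith)
    · exact ((min_le_right _ _).trans (min_le_right _ _)).trans_lt (by linarith)
  have hεθ : 4 * ε < θ := by nlinarith
  have hu' : UpperSemicontinuousOn (fun P : ℝ × Euc k => u P - θ * χ P.1 P.2) K := by
    have : Continuous fun P : ℝ × Euc k => -(θ * χ P.1 P.2) := (continuous_const.mul hχc).neg
    simpa only [sub_eq_add_neg] using
      (hu.mono hKsub).add (this.upperSemicontinuous.upperSemicontinuousOn K)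
  obtain ⟨⟨t, x⟩, hPO, ⟨s, y⟩, hQO, ℓ₁, ℓ₂, B₁, B₂, hP, hQ, i1, i2, i3, i4, i5, i6, i7⟩ :=
    hD.exists_doubling (R := Cg * (1 + ρ ^ 2) ^ n) hρ0 hu' (hv.mono hKsub) hdiag hsup h_nonneg hε0
  have hOK : Ioo a' D.T ×ˢ Metric.ball (0 : Euc k) ρ ⊆ K :=
    prod_mono Ioo_subset_Icc_self Metric.ball_subset_closedBall
  have hPK := hOK hPO
  have hQK := hOK hQO
  have hχw := isC12_weight D.T Λ n (0 : Euc k)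
  have htestP : IsLocalMax (fun p : ℝ × Euc k => u p -
      (fun t' x' => θ * χ t' x' + quadTest (t, x) ℓ₁ B₁ t' x') p.1 p.2) (t, x) := by
    filter_upwards [hP] with p hp
    have : quadTest (t, x) ℓ₁ B₁ t x = 0 := by simp [quadTest]
    simp only [this]
    linarith
  have htestQ : IsLocalMax (fun p : ℝ × Euc k => v p -
      (fun t' x' => (fun _ _ => (0 : ℝ)) t' x' + quadTest (s, y) ℓ₂ B₂ t' x') p.1 p.2) (s, y) := by
    filter_upwards [hQ] with p hp
    have : quadTest (s, y) ℓ₂ B₂ s y = 0 := by simp [quadTest]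
    simp only [this]
    linarith
  have hc0 : IsC12 fun (_ : ℝ) (_ : Euc k) => (0 : ℝ) := isC12_const 0
  obtain ⟨j1, j2⟩ := su t x ⟨haa'.trans hPO.1.1, hPO.1.2⟩ _
    ((hχw.const_mul θ).add (isC12_quadTest _ _ _)) htestP
  obtain ⟨j3, j4⟩ := sv s y ⟨haa'.trans hQO.1.1, hQO.1.2⟩ _
    (hc0.add (isC12_quadTest _ _ _)) htestQ
  have hχP : 1 ≤ χ t x := hχ1 _ hPK
  have hXθ : θ ≤ θ * χ t x := le_mul_of_one_le_right hθ0.le hχP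
  simp only at i6 i7
  have huv : |u (t, x) + v (s, y) - θ * χ t x| ≤ ε := by
    rwa [show u (t, x) + v (s, y) - θ * χ t x = u (t, x) - θ * χ t x + v (s, y) by ring]
  have huv' : θ - ε ≤ u (t, x) + v (s, y) := by
    have := (abs_le.1 huv).1
    linarith
  have hL := (abs_lt.1 (hηL _ hPK _ hQK (i7.trans_lt hε2))).2
  have hH := (abs_lt.1 (hηH _ hPK _ hQK (i7.trans_lt hε3))).2
  simp only at hL hH
  have j3' : v (s, y) ≤ -D.L s y := j3
  rcases j2 with j2 | j2
  · linarith
  rcases j4 with j4 | j4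
  · have j4' : v (s, y) ≤ -D.H s y := j4
    linarith
  rw [GΦ_add_quadTest (hχw.const_mul θ)] at j2
  rw [GΦ_add_quadTest hc0] at j4
  obtain ⟨w1, w2, w3⟩ := hw D.T Λ t x
  have hz1 : timeDeriv (fun (_ : ℝ) (_ : Euc k) => (0 : ℝ)) s y = 0 := by simp [timeDeriv]
  have hz2 : D.dual.hess (fun (_ : ℝ) (_ : Euc k) => (0 : ℝ)) s y = 0 := by simp [hess]
  rw [hz1, hz2, zero_add, zero_add, show fderiv ℝ (fun _ : Euc k => (0 : ℝ)) y = 0 by simp,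
    zero_add] at j4
  have hvR : |-v (s, y)| ≤ Cg * (1 + ρ ^ 2) ^ n := by
    rw [abs_neg]
    refine ((hg s (hKI _ hQK) y).2).trans ?_
    have := hKn _ hQK
    simp only at this
    gcongr
  refine not_G_le_zero_and hCf hf hΛ1 (by positivity) hC hε0.le (hε1.trans_le hXθ) ?_ ?_ ?_ ?_
    i1 i2 i3 i4 (i5 _ hvR) huv j2 j4
  · rw [timeDeriv_const_mul hχw, timeDeriv_weight]; ring
  · rw [fderiv_space_const_mul hχw, _root_.smul_apply, smul_eq_mul, abs_mul, abs_of_pos hθ0]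
    calc _ ≤ θ * (C * χ t x) := by gcongr
      _ = _ := by ring
  · intro l
    rw [fderiv_space_const_mul hχw, _root_.smul_apply, smul_eq_mul, abs_mul, abs_of_pos hθ0]
    calc _ ≤ θ * (C * χ t x) := mul_le_mul_of_nonneg_left (w2 l) hθ0.le
      _ = _ := by ring
  · rw [hess_const_mul hχw, abs_mul, abs_of_pos hθ0]
    calc _ ≤ θ * (C * χ t x) := by gcongr
      _ = _ := by ring

end ObstacleData

end Comparison

section Classical

variable {k d : ℕ}

theorem deriv_deriv_nonpos_of_isLocalMax {h : ℝ → ℝ} {s : ℝ} (hc : ContinuousAt h s)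
    (hm : IsLocalMax h s) : deriv (deriv h) s ≤ 0 := by
  by_contra! hpos
  have hmin := isLocalMin_of_deriv_deriv_pos hpos hm.deriv_eq_zero hc
  have heq : h =ᶠ[𝓝 s] fun _ => h s := by
    filter_upwards [hm, hmin] with r h1 h2 using le_antisymm h1 h2
  rw [heq.deriv.deriv_eq] at hpos
  simp at hpos

theorem fderiv_fderiv_nonpos_of_isLocalMax {θ : Euc k → ℝ} (hd : Differentiable ℝ θ)
    (hd' : Differentiable ℝ (fderiv ℝ θ)) {x : Euc k} (hm : IsLocalMax θ x) (v : Euc k) :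
    fderiv ℝ (fderiv ℝ θ) x v v ≤ 0 := by
  have hl : ∀ r : ℝ, HasDerivAt (fun s : ℝ => x + s • v) v r := fun r => by
    simpa using ((hasDerivAt_id r).smul_const v).const_add x
  have h1 : ∀ r : ℝ, HasDerivAt (fun s : ℝ => θ (x + s • v)) (fderiv ℝ θ (x + r • v) v) r :=
    fun r => (hd _).hasFDerivAt.comp_hasDerivAt r (hl r)
  have h2 : HasDerivAt (fun s : ℝ => fderiv ℝ θ (x + s • v) v)
      (fderiv ℝ (fderiv ℝ θ) x v v) 0 := by
    have := (hd' (x + (0 : ℝ) • v)).hasFDerivAt.comp_hasDerivAt (0 : ℝ) (hl 0)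
    have h3 := this.clm_apply (hasDerivAt_const (0 : ℝ) v)
    simpa using h3
  have e : deriv (fun s : ℝ => θ (x + s • v)) = fun s => fderiv ℝ θ (x + s • v) v :=
    funext fun r => (h1 r).deriv
  have := deriv_deriv_nonpos_of_isLocalMax (h1 0).continuousAt (s := 0) (by
    have hc : Tendsto (fun s : ℝ => x + s • v) (𝓝 0) (𝓝 x) := by
      simpa using (hl 0).continuousAt.tendsto
    have := hc.eventually hm
    simpa [IsLocalMax, IsMaxFilter] using this)
  rwa [e, h2.deriv] at this

namespace ObstacleData

variable {D : ObstacleData k d}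

theorem GΦ_add_const (φ : ℝ → Euc k → ℝ) (c t : ℝ) (x : Euc k) (y : ℝ) :
    D.GΦ (fun t x => φ t x + c) t x y = D.GΦ φ t x y := by
  have : ∀ t, fderiv ℝ (fun x => φ t x + c) = fderiv ℝ (φ t) := fun t =>
    funext fun x => fderiv_add_const c
  simp only [GΦ, hess, this, timeDeriv, deriv_add_const]

theorem dual_GΦ_neg (φ : ℝ → Euc k → ℝ) (t : ℝ) (x : Euc k) (y : ℝ) :
    D.dual.GΦ (fun t x => -φ t x) t x (-y) = -D.GΦ φ t x y := by
  have h1 : ∀ t, fderiv ℝ (fun x => -φ t x) = fun x => -fderiv ℝ (φ t) x := fun t =>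
    funext fun x => fderiv_fun_neg
  have h2 : fderiv ℝ (fun x => -fderiv ℝ (φ t) x) x = -fderiv ℝ (fderiv ℝ (φ t)) x :=
    fderiv_fun_neg
  have h3 : (-fun l => -(fderiv ℝ (φ t) x) (D.S l t x)) =
      fun l => (fderiv ℝ (φ t) x) (D.S l t x) := by ext; simp
  simp only [GΦ, hess, h1, h2, timeDeriv, deriv.fun_neg, G, dual, _root_.neg_apply,
    Finset.sum_neg_distrib, neg_neg, h3]
  ring

theorem GΦ_le_of_isLocalMax {ψ φ : ℝ → Euc k → ℝ} (hψ : IsC12 ψ) (hφ : IsC12 φ) {t : ℝ} {x : Euc k}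
    (hm : IsLocalMax (fun p : ℝ × Euc k => ψ p.1 p.2 - φ p.1 p.2) (t, x)) (y : ℝ) :
    D.GΦ φ t x y ≤ D.GΦ ψ t x y := by
  set θ : ℝ → Euc k → ℝ := fun t x => ψ t x + -1 * φ t x
  have hφ' := hφ.const_mul (-1)
  have hθ : IsC12 θ := hψ.add hφ'
  have hmθ : IsLocalMax (fun p : ℝ × Euc k => θ p.1 p.2) (t, x) := by
    refine hm.congr (Eventually.of_forall fun p => ?_)
    simp only [θ]; ring
  have ht : IsLocalMax (fun s => θ s x) t := by
    have hc : Tendsto (fun s : ℝ => (s, x)) (𝓝 t) (𝓝 (t, x)) :=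
      (continuous_id.prodMk continuous_const).tendsto t
    exact hc.eventually hmθ
  have hx : IsLocalMax (θ t) x := by
    have hc : Tendsto (fun y : Euc k => (t, y)) (𝓝 x) (𝓝 (t, x)) :=
      (continuous_const.prodMk continuous_id).tendsto x
    exact hc.eventually hmθ
  have e1 : timeDeriv ψ t x = timeDeriv φ t x := by
    have h0 : timeDeriv θ t x = 0 := ht.deriv_eq_zero
    rw [timeDeriv_add hψ hφ', timeDeriv_const_mul hφ] at h0
    linarith
  have e2 : fderiv ℝ (ψ t) x = fderiv ℝ (φ t) x := by
    have h0 : fderiv ℝ (θ t) x = 0 := hx.fderiv_eq_zero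
    rw [fderiv_space_add hψ hφ', fderiv_space_const_mul hφ, neg_one_smul, ← sub_eq_add_neg,
      sub_eq_zero] at h0
    exact h0
  have e3 : D.hess ψ t x ≤ D.hess φ t x := by
    have h0 : D.hess θ t x ≤ 0 := Finset.sum_nonpos fun l _ =>
      fderiv_fderiv_nonpos_of_isLocalMax (hθ.differentiable_snd t) (hθ.differentiable_fderiv t) hx _
    rw [hess_add hψ hφ', hess_const_mul hφ] at h0
    linarith
  rw [GΦ, GΦ, e1, e2, G, G]
  linarith

theorem isSub_of_classical {a : ℝ} {ψ : ℝ → Euc k → ℝ} (hψ : IsC12 ψ)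
    (h : ∀ t ∈ Ioo a D.T, ∀ x, ψ t x ≤ D.H t x ∧ D.GΦ ψ t x (ψ t x) ≤ 0) :
    D.IsSub a fun p => ψ p.1 p.2 := fun t x ht _φ hφ hm =>
  ⟨(h t ht x).1, Or.inr ((GΦ_le_of_isLocalMax hψ hφ hm _).trans (h t ht x).2)⟩

theorem IsSub.congr {a : ℝ} {w w' : ℝ × Euc k → ℝ} (h : D.IsSub a w)
    (hw : ∀ p : ℝ × Euc k, p.1 ∈ Ioo a D.T → w' p = w p) : D.IsSub a w' := by
  intro t x ht φ hφ hm
  rw [hw _ ht]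
  refine h t x ht φ hφ (hm.congr ?_)
  have : ∀ᶠ p : ℝ × Euc k in 𝓝 (t, x), p.1 ∈ Ioo a D.T :=
    continuous_fst.continuousAt.eventually (isOpen_Ioo.mem_nhds ht)
  filter_upwards [this] with p hp
  rw [hw p hp]

end ObstacleData

end Classical

section Barriers

variable {k d : ℕ}

theorem exists_le_weight {T : ℝ} {n : ℕ} {x₀ : Euc k} {F : ℝ → Euc k → ℝ} {c C ε : ℝ}
    (hF : ContinuousAt (fun p : ℝ × Euc k => F p.1 p.2) (T, x₀)) (hc : F T x₀ ≤ c) (hC : 0 ≤ C)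
    (hg : ∀ t x, |F t x| ≤ C * (1 + ‖x‖ ^ 2) ^ n) (hε : 0 < ε) :
    ∃ K₀ Λ₀, ∀ K ≥ K₀, ∀ Λ ≥ Λ₀, ∀ t ≤ T, ∀ x,
      F t x ≤ K * weight T Λ n x₀ t x + (c + ε - K) := by
  obtain ⟨δ, hδ, hFδ⟩ := Metric.continuousAt_iff.1 hF ε hε
  set η := δ ^ 2 / (1 + δ ^ 2)
  have hη : 0 < η := by positivity
  set c₁ := (2 * (1 + ‖x₀‖ ^ 2)) ^ n
  have hc₁ : 0 < c₁ := by positivity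
  set K₀ := (C + |c|) * c₁ / η
  have hK₀ : 0 ≤ K₀ := by positivity
  refine ⟨K₀, δ, fun K hK Λ hΛ t ht x => ?_⟩
  have hΛ0 : 0 ≤ Λ := hδ.le.trans hΛ
  have hK0 : 0 ≤ K := hK₀.trans hK
  have hw1 := one_le_weight n x₀ hΛ0 ht x
  set W := weight T Λ n x₀ t x with hW
  by_cases hnear : dist (t, x) (T, x₀) < δ
  · have h1 := hFδ hnear
    rw [Real.dist_eq] at h1
    have h2 := (abs_lt.1 h1).2
    simp only at h2
    nlinarith only [h2, hc, hw1, hK0]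
  · have hN1 : 1 ≤ 1 + ‖x - x₀‖ ^ 2 := by linarith [sq_nonneg ‖x - x₀‖]
    have hbig : 1 + δ ^ 2 ≤ W := by
      have hpw := pow_le_weight n x₀ hΛ0 ht x
      rw [Prod.dist_eq, not_lt, le_max_iff] at hnear
      rcases hnear with h | h
      · rw [Real.dist_eq, abs_sub_comm, abs_of_nonneg (by linarith)] at h
        simp only at h
        have h1 : Λ * (T - t) + 1 ≤ Real.exp (Λ * (T - t)) := Real.add_one_le_exp _
        have h2 : δ * δ ≤ Λ * (T - t) := mul_le_mul hΛ h hδ.le hΛ0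
        have h3 : Real.exp (Λ * (T - t)) ≤ W := by
          rw [hW, weight]
          exact le_mul_of_one_le_right (Real.exp_pos _).le (one_le_pow₀ hN1)
        nlinarith only [h1, h2, h3]
      · rw [dist_eq_norm] at h
        simp only at h
        have h1 : δ ^ 2 ≤ ‖x - x₀‖ ^ 2 := by gcongr
        have h2 := le_self_pow₀ hN1 (show n + 2 ≠ 0 by omega)
        linarith
    have hWη : η * W ≤ W - 1 := by
      have : η = 1 - 1 / (1 + δ ^ 2) := by simp only [η]; field_simp; ring
      have h3 : 1 ≤ 1 / (1 + δ ^ 2) * W := by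
        rw [one_div_mul_eq_div, le_div_iff₀ (by positivity)]; linarith
      rw [this]; linarith
    have hWn : (1 + ‖x‖ ^ 2) ^ n ≤ c₁ * W := by
      calc (1 + ‖x‖ ^ 2) ^ n ≤ (2 * (1 + ‖x₀‖ ^ 2) * (1 + ‖x - x₀‖ ^ 2)) ^ n := by
            gcongr; exact one_add_norm_sq_le x₀ x
        _ = c₁ * (1 + ‖x - x₀‖ ^ 2) ^ n := by rw [mul_pow]
        _ ≤ c₁ * (1 + ‖x - x₀‖ ^ 2) ^ (n + 2) := by
            gcongr
            omega
        _ ≤ c₁ * W := by gcongr; exact pow_le_weight n x₀ hΛ0 ht x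
    have h4 : F t x - c ≤ (C + |c|) * (c₁ * W) := by
      have h5 := (le_abs_self _).trans (hg t x)
      have h6 := neg_abs_le c
      have h7 : 1 ≤ (1 + ‖x‖ ^ 2) ^ n := one_le_pow₀ (by linarith [sq_nonneg ‖x‖])
      have h8 := mul_le_mul_of_nonneg_left h7 (abs_nonneg c)
      have h9 : (C + |c|) * (1 + ‖x‖ ^ 2) ^ n ≤ (C + |c|) * (c₁ * W) := by gcongr
      nlinarith only [h5, h6, h8, h9]
    have h10 : (C + |c|) * (c₁ * W) ≤ K * (η * W) := by
      have : (C + |c|) * c₁ ≤ K * η := (div_le_iff₀ hη).1 hK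
      nlinarith only [this, hw1]
    have h11 : K * (η * W) ≤ K * (W - 1) := by gcongr
    nlinarith only [h4, h10, h11, hε]

namespace ObstacleData

variable {D : ObstacleData k d}

/-- A smooth supersolution touching the terminal value from above, up to `ε`, at `x₀`. -/
theorem Regular.exists_barrier (hD : D.Regular) (a : ℝ) (x₀ : Euc k) {ε : ℝ} (hε : 0 < ε) :
    ∃ Ψ : ℝ → Euc k → ℝ, IsC12 Ψ ∧ (∀ x, D.g x ≤ Ψ D.T x) ∧ Ψ D.T x₀ = D.g x₀ + ε ∧
      (D.dual.IsSub a fun p => -Ψ p.1 p.2) ∧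
      ∃ (C : ℝ) (n : ℕ), ∀ t ∈ Icc a D.T, ∀ x, |Ψ t x| ≤ C * (1 + ‖x‖ ^ 2) ^ n := by
  obtain ⟨Cg, n, hCg, hg⟩ := hD.growth
  obtain ⟨Cf, hCf, hf⟩ := hD.f_lip
  obtain ⟨C, hC, hw⟩ := hD.exists_weight_bound n x₀
  obtain ⟨K₁, Λ₁, h₁⟩ :=
    exists_le_weight (T := D.T) (x₀ := x₀) (F := fun _ x => D.g x) (c := D.g x₀)
    (hD.g_cont.comp continuous_snd).continuousAt le_rfl hCg (fun t x => (hg t x).1) hε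
  obtain ⟨K₂, Λ₂, h₂⟩ := exists_le_weight (T := D.T) (x₀ := x₀) (F := D.L) (c := D.g x₀)
    hD.L_cont.continuousAt (hD.L_le_g x₀) hCg (fun t x => (hg t x).2.2.2) hε
  obtain ⟨K, hK1, hK2, hK⟩ : ∃ K, K₁ ≤ K ∧ K₂ ≤ K ∧ 1 ≤ K :=
    ⟨max K₁ (max K₂ 1), le_max_left _ _, (le_max_left _ _).trans (le_max_right _ _),
      (le_max_right _ _).trans (le_max_right _ _)⟩
  set c := D.g x₀ + ε - K
  set c₁ := Cg * (2 * (1 + ‖x₀‖ ^ 2)) ^ n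
  have hc₁ : 0 ≤ c₁ := by positivity
  obtain ⟨Λ, hΛ1, hΛ2, hΛ⟩ : ∃ Λ, Λ₁ ≤ Λ ∧ Λ₂ ≤ Λ ∧ 1.5 * C + c₁ + Cf * (|c| + 1 + C) ≤ Λ :=
    ⟨max Λ₁ (max Λ₂ _), le_max_left _ _, (le_max_left _ _).trans (le_max_right _ _),
      (le_max_right _ _).trans (le_max_right _ _)⟩
  have hΛ0 : 0 ≤ Λ := le_trans (by positivity) hΛ
  have hχ := isC12_weight D.T Λ n x₀
  have hKχ := hχ.const_mul K
  have hΨ : IsC12 fun t x => K * weight D.T Λ n x₀ t x + c := hKχ.add (isC12_const c)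
  refine ⟨fun t x => K * weight D.T Λ n x₀ t x + c, hΨ, h₁ K hK1 Λ hΛ1 D.T le_rfl, ?_, ?_, ?_⟩
  · simp [weight, c]
  · have hneg : IsC12 fun t x => -(K * weight D.T Λ n x₀ t x + c) := by
      simpa only [neg_one_mul] using hΨ.const_mul (-1)
    refine isSub_of_classical hneg fun t ht x => ⟨?_, ?_⟩
    · exact neg_le_neg (h₂ K hK2 Λ hΛ2 t ht.2.le x)
    · rw [dual_GΦ_neg, neg_nonpos, GΦ_add_const, GΦ, timeDeriv_const_mul hχ,
        fderiv_space_const_mul hχ, hess_const_mul hχ, timeDeriv_weight, G]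
      obtain ⟨w1, w2, w3⟩ := hw D.T Λ t x
      have hW1 := one_le_weight n x₀ hΛ0 ht.2.le x
      have hWn : Cg * (1 + ‖x‖ ^ 2) ^ n ≤ c₁ * weight D.T Λ n x₀ t x := by
        have hN1 : 1 ≤ 1 + ‖x - x₀‖ ^ 2 := by linarith [sq_nonneg ‖x - x₀‖]
        calc Cg * (1 + ‖x‖ ^ 2) ^ n ≤ Cg * (2 * (1 + ‖x₀‖ ^ 2) * (1 + ‖x - x₀‖ ^ 2)) ^ n := by
              gcongr; exact one_add_norm_sq_le x₀ x
          _ = c₁ * (1 + ‖x - x₀‖ ^ 2) ^ n := by rw [mul_pow, ← mul_assoc]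
          _ ≤ c₁ * (1 + ‖x - x₀‖ ^ 2) ^ (n + 2) := by
              gcongr
              omega
          _ ≤ _ := by gcongr; exact pow_le_weight n x₀ hΛ0 ht.2.le x
      set W := weight D.T Λ n x₀ t x
      set z : Fin d → ℝ := fun l => (K • fderiv ℝ (weight D.T Λ n x₀ t) x) (D.S l t x)
      have hK0 : 0 ≤ K := zero_le_one.trans hK
      have hz : ‖z‖ ≤ K * (C * W) := by
        refine (pi_norm_le_iff_of_nonneg (by positivity)).2 fun l => ?_
        simp only [z, _root_.smul_apply, smul_eq_mul, Real.norm_eq_abs, abs_mul, abs_of_nonneg hK0]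
        exact mul_le_mul_of_nonneg_left (w2 l) hK0
      have hy : |K * W + c| ≤ K * W + |c| := by
        refine (abs_add_le _ _).trans ?_
        rw [abs_of_nonneg (by positivity)]
      have h3 := (le_abs_self _).trans (hf t x (K * W + c) 0 z 0)
      rw [sub_zero, sub_zero] at h3
      have h4 := (le_abs_self _).trans (hg t x).2.1
      have h5 : Cf * (|K * W + c| + ‖z‖) ≤ Cf * (K * W + |c| + K * (C * W)) := by gcongr
      have hKW : 1 ≤ K * W := one_le_mul_of_one_le_of_one_le hK hW1
      have h6 : Cf * |c| ≤ Cf * |c| * (K * W) := le_mul_of_one_le_right (by positivity) hKW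
      have h7 : c₁ * W ≤ c₁ * (K * W) := by
        gcongr; exact le_mul_of_one_le_left (by positivity) hK
      have h8 : (1.5 * C + c₁ + Cf * (|c| + 1 + C)) * (K * W) ≤ Λ * (K * W) := by gcongr
      have h9 : K * fderiv ℝ (weight D.T Λ n x₀ t) x (D.bv t x) ≤ K * (C * W) :=
        mul_le_mul_of_nonneg_left ((le_abs_self _).trans w1) hK0
      have h10 : K * D.hess (weight D.T Λ n x₀) t x ≤ K * (C * W) :=
        mul_le_mul_of_nonneg_left ((le_abs_self _).trans w3) hK0
      rw [_root_.smul_apply, smul_eq_mul]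
      linarith only [h3, h4, h5, h6, h7, h8, h9, h10, hWn]
  · refine ⟨(|K| * (Real.exp (Λ * (D.T - a)) * (2 * (1 + ‖x₀‖ ^ 2)) ^ (n + 2)) + |c|), n + 2,
      fun t ht x => ?_⟩
    have hW : weight D.T Λ n x₀ t x ≤ Real.exp (Λ * (D.T - a)) * (2 * (1 + ‖x₀‖ ^ 2)) ^ (n + 2) *
        (1 + ‖x‖ ^ 2) ^ (n + 2) := by
      have := one_add_norm_sq_le x₀ x
      rw [weight, mul_assoc, ← mul_pow]
      have h1 : 1 + ‖x - x₀‖ ^ 2 ≤ 2 * (1 + ‖x₀‖ ^ 2) * (1 + ‖x‖ ^ 2) := by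
        have h1 : ‖x - x₀‖ ≤ ‖x‖ + ‖x₀‖ := norm_sub_le _ _
        have h2 : ‖x - x₀‖ ^ 2 ≤ (‖x‖ + ‖x₀‖) ^ 2 := by gcongr
        nlinarith [sq_nonneg (‖x‖ - ‖x₀‖), mul_nonneg (sq_nonneg ‖x‖) (sq_nonneg ‖x₀‖)]
      have := ht.1
      gcongr
    have h7 : 1 ≤ (1 + ‖x‖ ^ 2) ^ (n + 2) := one_le_pow₀ (by linarith [sq_nonneg ‖x‖])
    refine (abs_add_le _ _).trans ?_
    rw [abs_mul, abs_of_pos (weight_pos D.T Λ n x₀ t x), add_mul, mul_assoc |K|]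
    refine add_le_add (mul_le_mul_of_nonneg_left hW (abs_nonneg K)) ?_
    exact le_mul_of_one_le_right (abs_nonneg c) h7

end ObstacleData

end Barriers

section Envelope

variable {α : Type*} [TopologicalSpace α]

/-- Upper semicontinuous envelope of a locally bounded function. -/
noncomputable def env (f : α → ℝ) (P : α) : ℝ := limsup f (𝓝 P)

/-- Boundedness of a real function in a neighbourhood of a point. -/
def LocBdd (f : α → ℝ) (P : α) : Prop := ∃ M, ∀ᶠ Q in 𝓝 P, |f Q| ≤ M

variable {f : α → ℝ} {P : α} {c : ℝ}

theorem LocBdd.neg (h : LocBdd f P) : LocBdd (fun Q => -f Q) P := by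
  simpa only [LocBdd, abs_neg] using h

theorem LocBdd.isBoundedUnder (h : LocBdd f P) : (𝓝 P).IsBoundedUnder (· ≤ ·) f := by
  obtain ⟨M, hM⟩ := h
  exact ⟨M, eventually_map.2 (hM.mono fun Q hQ => (le_abs_self _).trans hQ)⟩

theorem LocBdd.isCoboundedUnder (h : LocBdd f P) : (𝓝 P).IsCoboundedUnder (· ≤ ·) f := by
  obtain ⟨M, hM⟩ := h
  have : (𝓝 P).IsBoundedUnder (· ≥ ·) f :=
    ⟨-M, eventually_map.2 (hM.mono fun Q hQ => (abs_le.1 hQ).1)⟩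
  exact this.isCoboundedUnder_le

theorem LocBdd.eventually_lt (h : LocBdd f P) (hc : env f P < c) : ∀ᶠ Q in 𝓝 P, f Q < c :=
  eventually_lt_of_limsup_lt hc h.isBoundedUnder

theorem LocBdd.le_env (h : LocBdd f P) : f P ≤ env f P := by
  by_contra! hlt
  exact lt_irrefl _ (h.eventually_lt hlt).self_of_nhds

theorem LocBdd.env_le (h : LocBdd f P) (hc : ∀ᶠ Q in 𝓝 P, f Q ≤ c) : env f P ≤ c :=
  limsup_le_of_le h.isCoboundedUnder hc

theorem LocBdd.frequently_lt (h : LocBdd f P) (hc : c < env f P) : ∃ᶠ Q in 𝓝 P, c < f Q :=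
  frequently_lt_of_lt_limsup h.isCoboundedUnder hc

theorem LocBdd.env_le_of_continuousAt (h : LocBdd f P) {Ψ : α → ℝ} (hΨ : ContinuousAt Ψ P)
    (hf : ∀ᶠ Q in 𝓝 P, f Q ≤ Ψ Q) : env f P ≤ Ψ P := by
  refine le_of_forall_pos_le_add fun ε hε => h.env_le ?_
  filter_upwards [hf, hΨ.eventually (eventually_lt_nhds (lt_add_of_pos_right _ hε))] with Q h1 h2
    using h1.trans h2.le

theorem LocBdd.eventually (h : LocBdd f P) : ∀ᶠ Q in 𝓝 P, LocBdd f Q := by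
  obtain ⟨M, hM⟩ := h
  exact hM.eventually_nhds.mono fun Q hQ => ⟨M, hQ⟩

theorem LocBdd.abs_env_le (h : LocBdd f P) (hc : ∀ᶠ Q in 𝓝 P, |f Q| ≤ c) : |env f P| ≤ c := by
  refine abs_le.2 ⟨?_, h.env_le (hc.mono fun Q hQ => (le_abs_self _).trans hQ)⟩
  exact (abs_le.1 hc.self_of_nhds).1.trans h.le_env

theorem LocBdd.env (h : LocBdd f P) : LocBdd (env f) P := by
  obtain ⟨M, hM⟩ := h
  exact ⟨M, hM.eventually_nhds.mono fun Q hQ => LocBdd.abs_env_le ⟨M, hQ⟩ hQ⟩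

theorem LocBdd.upperSemicontinuousAt_env (h : LocBdd f P) :
    UpperSemicontinuousAt (_root_.env f) P := by
  intro c hc
  obtain ⟨c', h1, h2⟩ := exists_between hc
  filter_upwards [(h.eventually_lt h1).eventually_nhds, h.eventually] with Q hQ hbQ
  exact (hbQ.env_le (hQ.mono fun _ h => h.le)).trans_lt h2

end Envelope

section Perron

variable {k d : ℕ}

/-- The standard quadratic form on space-time. -/
noncomputable def sqForm (k : ℕ) : ℝ × Euc k →L[ℝ] ℝ × Euc k →L[ℝ] ℝ :=
  let I : Euc k →L[ℝ] Euc k →L[ℝ] ℝ := innerSL ℝ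
  I.bilinearComp (ContinuousLinearMap.snd ℝ ℝ (Euc k)) (ContinuousLinearMap.snd ℝ ℝ (Euc k)) +
    (ContinuousLinearMap.mul ℝ ℝ).bilinearComp (ContinuousLinearMap.fst ℝ ℝ (Euc k))
      (ContinuousLinearMap.fst ℝ ℝ (Euc k))

theorem sqForm_apply_self (v : ℝ × Euc k) : sqForm k v v = ‖v.2‖ ^ 2 + v.1 ^ 2 := by
  rw [← real_inner_self_eq_norm_sq, pow_two]
  rfl

theorem dist_sq_le_sqForm (p q : ℝ × Euc k) : dist p q ^ 2 ≤ sqForm k (p - q) (p - q) := by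
  rw [sqForm_apply_self, dist_eq_norm, Prod.norm_def]
  rcases max_cases ‖(p - q).1‖ ‖(p - q).2‖ with ⟨h, -⟩ | ⟨h, -⟩ <;> rw [h]
  · rw [Real.norm_eq_abs, sq_abs]; linarith [sq_nonneg ‖(p - q).2‖]
  · linarith [sq_nonneg (p - q).1]

theorem quadTest_sqForm (P : ℝ × Euc k) (ε : ℝ) (p : ℝ × Euc k) :
    quadTest P 0 (ε • sqForm k) p.1 p.2 = ε / 2 * sqForm k (p - P) (p - P) := by
  simp only [quadTest, _root_.zero_apply, _root_.smul_apply, smul_eq_mul]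
  ring

namespace ObstacleData

variable {D : ObstacleData k d}

theorem GΦ_add_quadTest_sqForm {φ : ℝ → Euc k → ℝ} (h : IsC12 φ) (p : ℝ × Euc k) (ε y : ℝ) :
    D.GΦ (fun s y => φ s y + quadTest p 0 (ε • sqForm k) s y) p.1 p.2 y =
      D.GΦ φ p.1 p.2 y - ε / 2 * ∑ l, ‖D.S l p.1 p.2‖ ^ 2 := by
  have := GΦ_add_quadTest (D := D) h p.1 p.2 0 (ε • sqForm k) y
  rw [this]
  simp only [_root_.zero_apply, _root_.smul_apply, smul_eq_mul, sqForm_apply_self,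
    ContinuousLinearMap.zero_comp, add_zero, GΦ, G, Finset.mul_sum]
  simp only [ne_eq, OfNat.ofNat_ne_zero, not_false_eq_true, zero_pow, add_zero, ← Finset.mul_sum]
  ring

end ObstacleData

end Perron

section Stability

theorem exists_pos_lt_lt {a b : ℝ} (ha : 0 < a) (hb : 0 < b) : ∃ c, 0 < c ∧ c < a ∧ c < b := by
  obtain ⟨c, h1, h2⟩ := exists_between (lt_min ha hb)
  exact ⟨c, h1, lt_min_iff.1 h2⟩

variable {k d : ℕ}

namespace ObstacleData

variable {D : ObstacleData k d}

theorem Regular.isOpen_not_sub (hD : D.Regular) {φ : ℝ → Euc k → ℝ} (h : IsC12 φ) :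
    IsOpen {q : (ℝ × Euc k) × ℝ | D.H q.1.1 q.1.2 < q.2 ∨
      (D.L q.1.1 q.1.2 < q.2 ∧ 0 < D.GΦ φ q.1.1 q.1.2 q.2)} :=
  (isOpen_lt (hD.H_cont.comp continuous_fst) continuous_snd).union
    ((isOpen_lt (hD.L_cont.comp continuous_fst) continuous_snd).inter
      (isOpen_lt continuous_const (hD.continuous_GΦ h)))

/-- The envelope of a supremum of subsolutions is a subsolution. -/
theorem Regular.isSub_env (hD : D.Regular) {a : ℝ} {𝓕 : Set (ℝ × Euc k → ℝ)} {U : ℝ × Euc k → ℝ}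
    (hsub : ∀ w ∈ 𝓕, D.IsSub a w) (husc : ∀ w ∈ 𝓕, ∀ P, a < P.1 → UpperSemicontinuousAt w P)
    (hle : ∀ w ∈ 𝓕, ∀ P, a < P.1 → w P ≤ U P)
    (hlub : ∀ P, a < P.1 → ∀ c < U P, ∃ w ∈ 𝓕, c < w P)
    (hb : ∀ P, a < P.1 → LocBdd U P) : D.IsSub a (env U) := by
  intro t x ht φ hφ hmax
  obtain ⟨p₀, hp₀⟩ : ∃ p₀ : ℝ × Euc k, p₀ = (t, x) := ⟨_, rfl⟩
  have hap : a < p₀.1 := by rw [hp₀]; exact ht.1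
  obtain ⟨y₀, hy₀⟩ : ∃ y₀, y₀ = env U p₀ := ⟨_, rfl⟩
  rw [← hp₀] at hmax ⊢
  suffices key : ∀ ε > 0, y₀ ≤ D.H t x ∧ (y₀ ≤ D.L t x ∨
      D.GΦ φ t x y₀ ≤ ε / 2 * ∑ l, ‖D.S l t x‖ ^ 2) by
    rw [← hy₀]
    refine ⟨(key 1 one_pos).1, ?_⟩
    by_contra! hcon
    set s := ∑ l, ‖D.S l t x‖ ^ 2
    have hs : 0 ≤ s := Finset.sum_nonneg fun _ _ => sq_nonneg _
    have hG := hcon.2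
    obtain h | h := (key (D.GΦ φ t x y₀ / (s + 1)) (by positivity)).2
    · exact absurd h (not_le.2 hcon.1)
    · have : D.GΦ φ t x y₀ / (s + 1) * s ≤ D.GΦ φ t x y₀ := by
        rw [div_mul_eq_mul_div, div_le_iff₀ (by positivity)]
        nlinarith only [hG]
      linarith
  intro ε hε
  have hφε := hφ.add (isC12_quadTest p₀ 0 (ε • sqForm k))
  have hGε := GΦ_add_quadTest_sqForm (D := D) hφ p₀ ε y₀
  obtain ⟨φε, hφεdef⟩ : ∃ φε : ℝ → Euc k → ℝ,
    φε = fun s y => φ s y + quadTest p₀ 0 (ε • sqForm k) s y := ⟨_, rfl⟩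
  rw [← hφεdef] at hφε hGε
  have hval : ∀ p : ℝ × Euc k, φε p.1 p.2 = φ p.1 p.2 + ε / 2 * sqForm k (p - p₀) (p - p₀) := by
    intro p; rw [hφεdef]; simp only [quadTest_sqForm]
  by_contra hcon
  have hbad : (p₀, y₀) ∈ {q : (ℝ × Euc k) × ℝ | D.H q.1.1 q.1.2 < q.2 ∨
      (D.L q.1.1 q.1.2 < q.2 ∧ 0 < D.GΦ φε q.1.1 q.1.2 q.2)} := by
    rw [not_and_or, not_or, not_le, not_le, not_le] at hcon
    refine hcon.imp (fun h => by simpa [hp₀] using h) fun h => ?_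
    simp only
    rw [hGε, hp₀]
    exact ⟨h.1, by linarith [h.2]⟩
  obtain ⟨r, hr, hball⟩ := Metric.isOpen_iff.1 (hD.isOpen_not_sub hφε) _ hbad
  have hUb := hb p₀ hap
  have hcφ : Continuous fun p : ℝ × Euc k => φ p.1 p.2 := hφ.continuous
  have hev : ∀ᶠ q in 𝓝 p₀, env U q - φ q.1 q.2 ≤ y₀ - φ p₀.1 p₀.2 ∧ q.1 ∈ Ioo a D.T ∧
      env U q < y₀ + r ∧ |φ q.1 q.2 - φ p₀.1 p₀.2| < r / 2 := by
    refine (hy₀ ▸ hmax : ∀ᶠ q in 𝓝 p₀, _).and (.and ?_ (.and ?_ ?_))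
    · exact continuous_fst.continuousAt.eventually (isOpen_Ioo.mem_nhds (by rw [hp₀]; exact ht))
    · exact hUb.upperSemicontinuousAt_env _ (by simp only [← hy₀]; linarith)
    · have := Metric.continuousAt_iff'.1 (hcφ.continuousAt (x := p₀)) (r / 2) (half_pos hr)
      simpa only [Real.dist_eq] using this
  obtain ⟨s', hs', hs'ball⟩ := Metric.eventually_nhds_iff.1 hev
  obtain ⟨s, hs, hss', hsr⟩ : ∃ s, 0 < s ∧ s < s' ∧ s < r :=
    exists_pos_lt_lt hs' hr
  obtain ⟨κ, hκ, hκ1, hκ2⟩ : ∃ κ, 0 < κ ∧ κ < ε / 2 * s ^ 2 ∧ κ < r / 2 :=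
    exists_pos_lt_lt (by positivity) (half_pos hr)
  have hφε0 : φε p₀.1 p₀.2 = φ p₀.1 p₀.2 := by simp [hval]
  have hnear : ∀ᶠ p in 𝓝 p₀, φε p.1 p.2 < φ p₀.1 p₀.2 + κ / 2 ∧ dist p p₀ < s :=
    (hφε.continuous.continuousAt.eventually (eventually_lt_nhds
      (by simp only [hφε0]; linarith))).and (Metric.ball_mem_nhds _ hs)
  obtain ⟨p, hUp, hp1, hp2⟩ := ((hUb.frequently_lt (c := y₀ - κ / 2)
    (by rw [← hy₀]; linarith)).and_eventually hnear).exists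
  have hpa : a < p.1 := (hs'ball (hp2.trans hss')).2.1.1
  obtain ⟨w, hwF, hwp⟩ := hlub p hpa _ hUp
  have hin : ∀ q ∈ Metric.closedBall p₀ s, dist q p₀ < s' := fun q hq =>
    (Metric.mem_closedBall.1 hq).trans_lt hss'
  have husc' : UpperSemicontinuousOn (fun q => w q + -φε q.1 q.2) (Metric.closedBall p₀ s) :=
    fun q hq => ((husc w hwF q (hs'ball (hin q hq)).2.1.1).add
      hφε.continuous.neg.continuousAt.upperSemicontinuousAt).upperSemicontinuousWithinAt _
  obtain ⟨q, hq, hqmax⟩ := husc'.exists_isMaxOn ⟨p₀, Metric.mem_closedBall_self hs.le⟩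
    (isCompact_closedBall p₀ s)
  obtain ⟨e1, e2, e3, e4⟩ := hs'ball (hin q hq)
  have h1 : w p + -φε p.1 p.2 ≤ w q + -φε q.1 q.2 := hqmax (Metric.mem_closedBall.2 hp2.le)
  have h2 : w q ≤ env U q := (hle w hwF q e2.1).trans (hb q e2.1).le_env
  have h3 := dist_sq_le_sqForm q p₀
  have h4 : ε / 2 * dist q p₀ ^ 2 ≤ ε / 2 * sqForm k (q - p₀) (q - p₀) := by gcongr
  have h5 := hval q
  have h6 : 0 ≤ ε / 2 * dist q p₀ ^ 2 := by positivity
  have hqs : dist q p₀ < s := by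
    by_contra! hge
    have : ε / 2 * s ^ 2 ≤ ε / 2 * dist q p₀ ^ 2 := by gcongr
    linarith
  have hwq : |w q - y₀| < r := by
    rw [abs_lt] at e4 ⊢
    constructor <;> linarith
  have hloc : IsLocalMax (fun p : ℝ × Euc k => w p - φε p.1 p.2) q := by
    filter_upwards [Metric.isOpen_ball.mem_nhds (Metric.mem_ball.2 hqs)] with z hz
    have : w z + -φε z.1 z.2 ≤ w q + -φε q.1 q.2 := hqmax (Metric.ball_subset_closedBall hz)
    linarith
  have hgood := hsub w hwF q.1 q.2 e2 φε hφε hloc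
  have hb' := hball (a := (q, w q)) (by
    rw [Metric.mem_ball, Prod.dist_eq, max_lt_iff]
    exact ⟨hqs.trans hsr, by rw [Real.dist_eq]; exact hwq⟩)
  rcases hb' with h | h
  · exact absurd hgood.1 (not_le.2 h)
  · rcases hgood.2 with h' | h'
    · exact absurd h' (not_le.2 h.1)
    · exact absurd h' (not_le.2 h.2)

theorem IsSub.max_classical {a : ℝ} {U w : ℝ × Euc k → ℝ} {ζ : ℝ → Euc k → ℝ} (hU : D.IsSub a U)
    (hζ : IsC12 ζ) {r : ℝ} {p₀ : ℝ × Euc k}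
    (hin : ∀ p, dist p p₀ < r → w p = max (U p) (ζ p.1 p.2))
    (hout : ∀ p, r / 2 < dist p p₀ → w p = U p) (hr : 0 < r)
    (hgood : ∀ p, dist p p₀ < r → p.1 ∈ Ioo a D.T → U p < ζ p.1 p.2 → ζ p.1 p.2 ≤ D.H p.1 p.2 ∧
      (ζ p.1 p.2 ≤ D.L p.1 p.2 ∨ D.GΦ ζ p.1 p.2 (ζ p.1 p.2) ≤ 0)) : D.IsSub a w := by
  intro t x ht φ hφ hm
  have hUw : ∀ p, U p ≤ w p := fun p => by
    rcases lt_or_ge (dist p p₀) r with h | h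
    · rw [hin p h]; exact le_max_left _ _
    · rw [hout p (by linarith)]
  by_cases hw : w (t, x) = U (t, x)
  · rw [hw]
    refine hU t x ht φ hφ (hm.mono fun p hp => ?_)
    have := hUw p
    simp only [hw] at hp ⊢
    linarith
  · have hlt : dist (t, x) p₀ < r := by
      by_contra! h
      exact hw (hout _ (by linarith))
    have hU' : U (t, x) < ζ t x := by
      by_contra! h
      exact hw ((hin _ hlt).trans (max_eq_left h))
    have hwζ : w (t, x) = ζ t x := (hin _ hlt).trans (max_eq_right hU'.le)
    obtain ⟨h1, h2⟩ := hgood _ hlt ht hU'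
    rw [hwζ]
    refine ⟨h1, h2.imp_right fun h => (GΦ_le_of_isLocalMax hζ hφ ?_ _).trans h⟩
    filter_upwards [hm, Metric.isOpen_ball.mem_nhds (Metric.mem_ball.2 hlt)] with p hp hpb
    have h3 : ζ p.1 p.2 ≤ w p := by rw [hin p hpb]; exact le_max_right _ _
    simp only [hwζ] at hp ⊢
    linarith

/-- If the envelope of `-U` is not a subsolution of the dual problem, then `U` is not maximal. -/
theorem Regular.exists_bump (hD : D.Regular) {a : ℝ} {U : ℝ × Euc k → ℝ} (hU : D.IsSub a U)
    (husc : ∀ P, a < P.1 → UpperSemicontinuousAt U P) (hb : ∀ P, a < P.1 → LocBdd U P)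
    (hnot : ¬ D.dual.IsSub a (env fun P => -U P)) :
    ∃ w : ℝ × Euc k → ℝ, D.IsSub a w ∧ (∀ P, a < P.1 → UpperSemicontinuousAt w P) ∧
      (∀ P, U P ≤ w P) ∧ (∃ M, ∀ P, w P ≤ max (U P) M) ∧ (∀ P, D.T ≤ P.1 → w P = U P) ∧
      ∃ P, a < P.1 ∧ U P < w P := by
  obtain ⟨t, x, ht, φ, hφ, hmax, hcon⟩ : ∃ t x, t ∈ Ioo a D.T ∧ ∃ φ, IsC12 φ ∧
      IsLocalMax (fun p : ℝ × Euc k => env (fun P => -U P) p - φ p.1 p.2) (t, x) ∧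
      ¬ (env (fun P => -U P) (t, x) ≤ -D.L t x ∧ (env (fun P => -U P) (t, x) ≤ -D.H t x ∨
        D.dual.GΦ φ t x (env (fun P => -U P) (t, x)) ≤ 0)) := by
    by_contra! h
    exact hnot fun t x ht φ hφ hm => h t x ht φ hφ hm
  obtain ⟨p₀, hp₀⟩ : ∃ p₀ : ℝ × Euc k, p₀ = (t, x) := ⟨_, rfl⟩
  have hap : a < p₀.1 := by rw [hp₀]; exact ht.1
  obtain ⟨y₀, hy₀⟩ : ∃ y₀, env (fun P => -U P) p₀ = -y₀ := ⟨_, (neg_neg _).symm⟩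
  rw [← hp₀] at hmax hcon
  obtain ⟨ψ, hψ, rfl⟩ : ∃ ψ : ℝ → Euc k → ℝ, IsC12 ψ ∧ φ = fun t x => -ψ t x :=
    ⟨fun t x => -1 * φ t x, hφ.const_mul (-1), by ext; simp⟩
  have hLH := hD.L_le_H t x
  have hy : y₀ < D.H t x ∧ (y₀ < D.L t x ∨ D.GΦ ψ t x y₀ < 0) := by
    rw [hy₀, dual_GΦ_neg] at hcon
    by_contra hc
    apply hcon
    rw [not_and_or, not_or, not_lt, not_lt, not_lt] at hc
    rcases hc with hc | hc
    · exact ⟨by linarith, Or.inl (by linarith)⟩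
    · exact ⟨by linarith [hc.1], Or.inr (by linarith [hc.2])⟩
  obtain ⟨ε, hε, hε'⟩ : ∃ ε > 0, y₀ < D.L t x ∨
      D.GΦ ψ t x y₀ - -ε / 2 * ∑ l, ‖D.S l t x‖ ^ 2 < 0 := by
    rcases hy.2 with h | h
    · exact ⟨1, one_pos, Or.inl h⟩
    · set s := ∑ l, ‖D.S l t x‖ ^ 2
      have hs : 0 ≤ s := Finset.sum_nonneg fun _ _ => sq_nonneg _
      refine ⟨-D.GΦ ψ t x y₀ / (s + 1), div_pos (by linarith) (by positivity), Or.inr ?_⟩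
      have : -D.GΦ ψ t x y₀ / (s + 1) * s ≤ -D.GΦ ψ t x y₀ := by
        rw [div_mul_eq_mul_div, div_le_iff₀ (by positivity)]
        nlinarith only [h]
      linarith
  have hψε := hψ.add (isC12_quadTest p₀ 0 (-ε • sqForm k))
  have hGε := GΦ_add_quadTest_sqForm (D := D) hψ p₀ (-ε) y₀
  obtain ⟨ψε, hψεdef⟩ : ∃ ψε : ℝ → Euc k → ℝ,
    ψε = fun s y => ψ s y + quadTest p₀ 0 (-ε • sqForm k) s y := ⟨_, rfl⟩
  rw [← hψεdef] at hψε hGε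
  have hval : ∀ p : ℝ × Euc k, ψε p.1 p.2 = ψ p.1 p.2 + -ε / 2 * sqForm k (p - p₀) (p - p₀) := by
    intro p; rw [hψεdef]; simp only [quadTest_sqForm]
  have hψε0 : ψε p₀.1 p₀.2 = ψ p₀.1 p₀.2 := by simp [hval]
  have hopen : IsOpen {q : (ℝ × Euc k) × ℝ | q.2 < D.H q.1.1 q.1.2 ∧
      (q.2 < D.L q.1.1 q.1.2 ∨ D.GΦ ψε q.1.1 q.1.2 q.2 < 0)} :=
    (isOpen_lt continuous_snd (hD.H_cont.comp continuous_fst)).inter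
      ((isOpen_lt continuous_snd (hD.L_cont.comp continuous_fst)).union
        (isOpen_lt (hD.continuous_GΦ hψε) continuous_const))
  obtain ⟨ρ, hρ, hball⟩ := Metric.isOpen_iff.1 hopen (p₀, y₀) (by
    rw [hp₀] at hGε ⊢
    exact ⟨hy.1, hε'.imp_right fun h => by simp only; rw [hGε]; exact h⟩)
  have hVb := (hb p₀ hap).neg
  have hcψ : Continuous fun p : ℝ × Euc k => ψε p.1 p.2 := hψε.continuous
  have hev : ∀ᶠ q in 𝓝 p₀, ψ q.1 q.2 + (y₀ - ψ p₀.1 p₀.2) ≤ U q ∧ q.1 ∈ Ioo a D.T ∧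
      |ψε q.1 q.2 - ψ p₀.1 p₀.2| < ρ / 2 := by
    have hI : ∀ᶠ q : ℝ × Euc k in 𝓝 p₀, q.1 ∈ Ioo a D.T :=
      continuous_fst.continuousAt.eventually (isOpen_Ioo.mem_nhds (by rw [hp₀]; exact ht))
    have hc := Metric.continuousAt_iff'.1 (hcψ.continuousAt (x := p₀)) (ρ / 2) (half_pos hρ)
    simp only [Real.dist_eq, hψε0] at hc
    filter_upwards [hmax, hI, hc] with q h1 h2 h3
    refine ⟨?_, h2, h3⟩
    have h4 := (hb q h2.1).neg.le_env
    rw [hy₀] at h1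
    linarith
  obtain ⟨r', hr', hr'ball⟩ := Metric.eventually_nhds_iff.1 hev
  obtain ⟨r, hr, hrr', hrρ⟩ : ∃ r, 0 < r ∧ r < r' ∧ r < ρ :=
    exists_pos_lt_lt hr' hρ
  have hεr : 0 < ε / 2 * (r / 2) ^ 2 := by positivity
  obtain ⟨δ, hδ, hδ1, hδ2⟩ : ∃ δ, 0 < δ ∧ δ < ε / 2 * (r / 2) ^ 2 ∧ δ < ρ / 2 :=
    exists_pos_lt_lt hεr (half_pos hρ)
  obtain ⟨c, hc⟩ : ∃ c, c = y₀ - ψ p₀.1 p₀.2 + δ := ⟨_, rfl⟩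
  have hζ : IsC12 fun t x => ψε t x + c := hψε.add (isC12_const c)
  have hann : ∀ p, r / 2 < dist p p₀ → dist p p₀ ≤ r → ψε p.1 p.2 + c ≤ U p := by
    intro p h1 h2
    have h3 := (hr'ball (h2.trans_lt hrr')).1
    have h4 := dist_sq_le_sqForm p p₀
    have h5 : ε / 2 * (r / 2) ^ 2 ≤ ε / 2 * sqForm k (p - p₀) (p - p₀) := by
      refine mul_le_mul_of_nonneg_left (le_trans ?_ h4) (by positivity)
      gcongr
    rw [hval]
    linarith
  have hζy : ∀ p, dist p p₀ ≤ r → |ψε p.1 p.2 + c - y₀| < ρ := by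
    intro p hp
    have := (hr'ball (hp.trans_lt hrr')).2.2
    rw [abs_lt] at this ⊢
    constructor <;> linarith
  classical
  obtain ⟨w, hw⟩ : ∃ w : ℝ × Euc k → ℝ,
    w = fun p => if dist p p₀ ≤ r then max (U p) (ψε p.1 p.2 + c) else U p := ⟨_, rfl⟩
  have hin : ∀ p, dist p p₀ ≤ r → w p = max (U p) (ψε p.1 p.2 + c) := fun p hp => by
    rw [hw]; exact if_pos hp
  have hout : ∀ p, r / 2 < dist p p₀ → w p = U p := fun p hp => by
    by_cases h : dist p p₀ ≤ r
    · rw [hin p h]; exact max_eq_left (hann p hp h)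
    · rw [hw]; exact if_neg h
  refine ⟨w, ?_, ?_, ?_, ⟨y₀ + ρ, ?_⟩, ?_, ?_⟩
  · refine hU.max_classical hζ (fun p hp => hin p hp.le) hout hr fun p hp _ _ => ?_
    have := hball (a := (p, ψε p.1 p.2 + c)) (by
      rw [Metric.mem_ball, Prod.dist_eq, max_lt_iff]
      exact ⟨hp.trans hrρ, by rw [Real.dist_eq]; exact hζy p hp.le⟩)
    exact ⟨this.1.le, this.2.imp le_of_lt fun h => by rw [GΦ_add_const]; exact h.le⟩
  · intro P hP
    rcases lt_or_ge (dist P p₀) r with h | h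
    · have h1 : UpperSemicontinuousAt (fun p => U p ⊔ (ψε p.1 p.2 + c)) P :=
        (husc P hP).sup hζ.continuous.continuousAt.upperSemicontinuousAt
      intro y hy
      rw [hin P h.le] at hy
      filter_upwards [h1 y hy, Metric.isOpen_ball.mem_nhds (Metric.mem_ball.2 h)] with q h2 h3
      rw [hin q (Metric.mem_ball.1 h3).le]
      exact h2
    · intro y hy
      have hP' : r / 2 < dist P p₀ := by linarith
      rw [hout P hP'] at hy
      have : ∀ᶠ q in 𝓝 P, r / 2 < dist q p₀ :=
        (continuous_id.dist continuous_const).continuousAt.eventually (eventually_gt_nhds hP')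
      filter_upwards [husc P hP y hy, this] with q h2 h3
      rw [hout q h3]
      exact h2
  · intro P
    rw [hw]
    simp only
    split_ifs
    · exact le_max_left _ _
    · exact le_rfl
  · intro P
    by_cases h : dist P p₀ ≤ r
    · rw [hin P h]
      exact max_le_max le_rfl (by linarith [(abs_lt.1 (hζy P h)).2])
    · rw [hout P (by linarith)]
      exact le_max_left _ _
  · intro P hP
    by_cases h : dist P p₀ ≤ r
    · exact absurd (hr'ball (h.trans_lt hrr')).2.1.2 (not_lt.2 hP)
    · exact hout P (by linarith)
  · have hnear : ∀ᶠ p in 𝓝 p₀, y₀ + δ / 2 < ψε p.1 p.2 + c ∧ dist p p₀ < r :=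
      (hζ.continuous.continuousAt.eventually (eventually_gt_nhds
        (by simp only [hψε0]; linarith))).and (Metric.ball_mem_nhds _ hr)
    obtain ⟨p, hUp, hp1, hp2⟩ := ((hVb.frequently_lt (c := -y₀ - δ / 2)
      (by rw [hy₀]; linarith)).and_eventually hnear).exists
    refine ⟨p, (hr'ball (hp2.trans hrr')).2.1.1, ?_⟩
    rw [hin p hp2.le]
    exact lt_max_of_lt_right (by linarith)

end ObstacleData

end Stability

section Existence

variable {k d : ℕ}

theorem growth_mono {C C' : ℝ} {n m : ℕ} (hC : |C| ≤ C') (hn : n ≤ m) (x : Euc k) :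
    C * (1 + ‖x‖ ^ 2) ^ n ≤ C' * (1 + ‖x‖ ^ 2) ^ m := by
  have h1 : 1 ≤ 1 + ‖x‖ ^ 2 := by linarith [sq_nonneg ‖x‖]
  have h2 := pow_le_pow_right₀ h1 hn
  have h3 := (le_abs_self C).trans hC
  have h4 := (abs_nonneg C).trans hC
  gcongr

namespace ObstacleData

/-- Polynomial growth of a function on `(a, T]`. -/
def Growth (D : ObstacleData k d) (a : ℝ) (w : ℝ × Euc k → ℝ) : Prop :=
  ∃ (C : ℝ) (n : ℕ), ∀ t ∈ Ioc a D.T, ∀ x, |w (t, x)| ≤ C * (1 + ‖x‖ ^ 2) ^ n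

/-- Smooth supersolutions above the terminal value. -/
def IsUpperBarrier (D : ObstacleData k d) (a : ℝ) (Ψ : ℝ → Euc k → ℝ) : Prop :=
  IsC12 Ψ ∧ (∀ x, D.g x ≤ Ψ D.T x) ∧ (D.dual.IsSub a fun p => -Ψ p.1 p.2) ∧
    D.Growth a fun p => Ψ p.1 p.2

/-- Semicontinuous subsolutions below the terminal value. -/
def subFamily (D : ObstacleData k d) (a : ℝ) : Set (ℝ × Euc k → ℝ) :=
  {w | D.IsSub a w ∧ (∀ P, a < P.1 → UpperSemicontinuousAt w P) ∧
    (∀ P, D.T ≤ P.1 → w P ≤ D.g P.2) ∧ D.Growth a w}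

variable {D : ObstacleData k d} {a : ℝ}

theorem Growth.of_le {w v v' : ℝ × Euc k → ℝ} (hv : D.Growth a v) (hv' : D.Growth a v')
    (h : ∀ P, a < P.1 → P.1 ≤ D.T → -v P ≤ w P ∧ w P ≤ v' P) : D.Growth a w := by
  obtain ⟨C, n, hC⟩ := hv
  obtain ⟨C', n', hC'⟩ := hv'
  refine ⟨|C| + |C'|, n + n', fun t ht x => ?_⟩
  obtain ⟨h1, h2⟩ := h (t, x) ht.1 ht.2
  have e1 := (hC t ht x).trans (growth_mono (C' := |C| + |C'|) (m := n + n')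
    (by linarith [abs_nonneg C']) (by omega) x)
  have e2 := (hC' t ht x).trans (growth_mono (C' := |C| + |C'|) (m := n + n')
    (by linarith [abs_nonneg C]) (by omega) x)
  rw [abs_le] at *
  constructor <;> linarith

theorem Regular.le_of_isSub (hD : D.Regular) {u v : ℝ × Euc k → ℝ}
    (hu : ∀ P, a < P.1 → UpperSemicontinuousAt u P) (hv : ∀ P, a < P.1 → UpperSemicontinuousAt v P)
    (su : D.IsSub a u) (sv : D.dual.IsSub a v) (hT : ∀ x, u (D.T, x) + v (D.T, x) ≤ 0)
    (gu : D.Growth a u) (gv : D.Growth a v) (P : ℝ × Euc k) (hP : a < P.1) (hP' : P.1 ≤ D.T) :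
    u P + v P ≤ 0 := by
  obtain ⟨C, n, hC⟩ := gu
  obtain ⟨C', n', hC'⟩ := gv
  refine hD.comparison (a := a) (fun P hP => (hu P hP.1.1).upperSemicontinuousWithinAt _)
    (fun P hP => (hv P hP.1.1).upperSemicontinuousWithinAt _) su sv hT
    ⟨|C| + |C'|, n + n', fun t ht x => ⟨?_, ?_⟩⟩ P.1 ⟨hP, hP'⟩ P.2
  · exact (hC t ht x).trans (growth_mono (by linarith [abs_nonneg C']) (by omega) x)
  · exact (hC' t ht x).trans (growth_mono (by linarith [abs_nonneg C]) (by omega) x)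

theorem Growth.neg {w : ℝ × Euc k → ℝ} (h : D.Growth a w) : D.Growth a fun P => -w P := by
  simpa only [Growth, abs_neg] using h

/-- Extension of a function by freezing time after the horizon. -/
def payoff (D : ObstacleData k d) (Ψ : ℝ → Euc k → ℝ) (P : ℝ × Euc k) : ℝ := Ψ (min P.1 D.T) P.2

theorem continuous_payoff {Ψ : ℝ → Euc k → ℝ} (h : IsC12 Ψ) : Continuous (D.payoff Ψ) :=
  h.continuous.comp ((continuous_fst.min continuous_const).prodMk continuous_snd)

theorem payoff_of_le (Ψ : ℝ → Euc k → ℝ) {P : ℝ × Euc k} (h : P.1 ≤ D.T) :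
    D.payoff Ψ P = Ψ P.1 P.2 := by rw [payoff, min_eq_left h]

theorem payoff_of_ge (Ψ : ℝ → Euc k → ℝ) {P : ℝ × Euc k} (h : D.T ≤ P.1) :
    D.payoff Ψ P = Ψ D.T P.2 := by rw [payoff, min_eq_right h]

theorem Growth.payoff {Ψ : ℝ → Euc k → ℝ} (h : D.Growth a fun p => Ψ p.1 p.2) :
    D.Growth a (D.payoff Ψ) := by
  obtain ⟨C, n, hC⟩ := h
  exact ⟨C, n, fun t ht x => by rw [payoff_of_le Ψ (P := (t, x)) ht.2]; exact hC t ht x⟩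

theorem Regular.exists_isUpperBarrier (hD : D.Regular) (a : ℝ) (x₀ : Euc k) {ε : ℝ} (hε : 0 < ε) :
    ∃ Ψ, D.IsUpperBarrier a Ψ ∧ Ψ D.T x₀ = D.g x₀ + ε := by
  obtain ⟨Ψ, h1, h2, h3, h4, C, n, hC⟩ := hD.exists_barrier a x₀ hε
  exact ⟨Ψ, ⟨h1, h2, h4, C, n, fun t ht x => hC t (Ioc_subset_Icc_self ht) x⟩, h3⟩

theorem Regular.le_payoff (hD : D.Regular) {w : ℝ × Euc k → ℝ} (hw : w ∈ D.subFamily a)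
    {Ψ : ℝ → Euc k → ℝ} (hΨ : D.IsUpperBarrier a Ψ) (P : ℝ × Euc k) (hP : a < P.1) :
    w P ≤ D.payoff Ψ P := by
  obtain ⟨h1, h2, h3, h4⟩ := hw
  obtain ⟨e1, e2, e3, e4⟩ := hΨ
  rcases le_total P.1 D.T with h | h
  · rw [payoff_of_le Ψ h]
    have : w P + -Ψ P.1 P.2 ≤ 0 := hD.le_of_isSub h2
      (fun Q _ => e1.continuous.neg.continuousAt.upperSemicontinuousAt) h1 e3
      (fun x => by simpa using (h3 (D.T, x) le_rfl).trans (e2 x)) h4 e4.neg P hP h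
    linarith
  · rw [payoff_of_ge Ψ h]
    exact (h3 P h).trans (e2 _)

theorem neg_payoff_mem {Ψ : ℝ → Euc k → ℝ} (hΨ : D.dual.IsUpperBarrier a Ψ) :
    (fun P => -D.payoff Ψ P) ∈ D.subFamily a := by
  obtain ⟨e1, e2, e3, e4⟩ := hΨ
  rw [dual_dual] at e3
  refine ⟨e3.congr fun p hp => by rw [payoff_of_le Ψ hp.2.le],
    fun P _ => (continuous_payoff e1).neg.continuousAt.upperSemicontinuousAt, fun P hP => ?_,
    (Growth.payoff (D := D) e4).neg⟩
  have : -D.g P.2 ≤ Ψ D.T P.2 := e2 P.2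
  rw [← payoff_of_ge Ψ hP] at this
  simp only
  linarith

/-- Perron's method. -/
theorem Regular.exists_solution (hD : D.Regular) (a : ℝ) (ha : a < D.T) :
    ∃ U : ℝ × Euc k → ℝ, ContinuousOn U (Ioc a D.T ×ˢ univ) ∧ D.IsSub a U ∧
      (D.dual.IsSub a fun P => -U P) ∧ (∀ x, U (D.T, x) = D.g x) ∧ D.Growth a U := by
  obtain ⟨Ψ, hΨ, -⟩ := hD.exists_isUpperBarrier a 0 one_pos
  obtain ⟨Ψ', hΨ', -⟩ := hD.dual.exists_isUpperBarrier a 0 one_pos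
  obtain ⟨U, hU⟩ : ∃ U : ℝ × Euc k → ℝ, U = fun P => sSup ((fun w => w P) '' D.subFamily a) :=
    ⟨_, rfl⟩
  have hbdd : ∀ P, a < P.1 → BddAbove ((fun w => w P) '' D.subFamily a) := fun P hP =>
    ⟨D.payoff Ψ P, forall_mem_image.2 fun w hw => hD.le_payoff hw hΨ P hP⟩
  have hle : ∀ w ∈ D.subFamily a, ∀ P, a < P.1 → w P ≤ U P := fun w hw P hP => by
    rw [hU]; exact le_csSup (hbdd P hP) (mem_image_of_mem _ hw)
  have hne : ∀ P, ((fun w : ℝ × Euc k → ℝ => w P) '' D.subFamily a).Nonempty := fun P =>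
    ⟨_, mem_image_of_mem _ (neg_payoff_mem hΨ')⟩
  have hup : ∀ Ψ, D.IsUpperBarrier a Ψ → ∀ P, a < P.1 → U P ≤ D.payoff Ψ P := fun Ψ hΨ P hP => by
    rw [hU]; exact csSup_le (hne P) (forall_mem_image.2 fun w hw => hD.le_payoff hw hΨ P hP)
  have hlub : ∀ P, a < P.1 → ∀ c < U P, ∃ w ∈ D.subFamily a, c < w P := fun P _ c hc => by
    rw [hU] at hc
    obtain ⟨_, ⟨w, hw, rfl⟩, h⟩ := exists_lt_of_lt_csSup (hne P) hc
    exact ⟨w, hw, h⟩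
  have hnear : ∀ P : ℝ × Euc k, a < P.1 → ∀ᶠ Q : ℝ × Euc k in 𝓝 P, a < Q.1 := fun P hP =>
    continuous_fst.continuousAt.eventually (eventually_gt_nhds hP)
  have hb : ∀ P, a < P.1 → LocBdd U P := fun P hP => by
    refine ⟨|D.payoff Ψ P| + |D.payoff Ψ' P| + 1, ?_⟩
    filter_upwards [hnear P hP,
      (continuous_payoff (D := D) hΨ.1).continuousAt.eventually (eventually_lt_nhds (lt_add_one _)),
      (continuous_payoff (D := D) hΨ'.1).continuousAt.eventually (eventually_lt_nhds (lt_add_one _))]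
      with Q h1 h2 h3
    have h4 := hup Ψ hΨ Q h1
    have h5 := hle _ (neg_payoff_mem hΨ') Q h1
    have h6 := le_abs_self (D.payoff Ψ P)
    have h7 := le_abs_self (D.payoff Ψ' P)
    have h8 := abs_nonneg (D.payoff Ψ P)
    have h9 := abs_nonneg (D.payoff Ψ' P)
    exact abs_le.2 ⟨by linarith, by linarith⟩
  obtain ⟨W, hW⟩ : ∃ W, W = env U := ⟨_, rfl⟩
  have hUW : ∀ P, a < P.1 → U P ≤ W P := fun P hP => by rw [hW]; exact (hb P hP).le_env
  have hWup : ∀ Ψ, D.IsUpperBarrier a Ψ → ∀ P, a < P.1 → W P ≤ D.payoff Ψ P := fun Ψ hΨ P hP => by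
    rw [hW]
    exact (hb P hP).env_le_of_continuousAt (continuous_payoff hΨ.1).continuousAt
      ((hnear P hP).mono fun Q hQ => hup Ψ hΨ Q hQ)
  have hlow : ∀ Ψ, D.dual.IsUpperBarrier a Ψ → ∀ P, a < P.1 → -W P ≤ D.payoff Ψ P :=
    fun Ψ hΨ P hP => by linarith [hle _ (neg_payoff_mem hΨ) P hP, hUW P hP]
  have hWF : W ∈ D.subFamily a := by
    refine ⟨?_, fun P hP => ?_, fun P hP => ?_, ?_⟩
    · rw [hW]
      exact hD.isSub_env (fun w hw => hw.1) (fun w hw => hw.2.1) hle hlub hb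
    · rw [hW]; exact (hb P hP).upperSemicontinuousAt_env
    · refine le_of_forall_pos_le_add fun ε hε => ?_
      obtain ⟨Ψ, hΨ, hε'⟩ := hD.exists_isUpperBarrier a P.2 hε
      have := hWup Ψ hΨ P (ha.trans_le hP)
      rwa [payoff_of_ge Ψ hP, hε'] at this
    · refine Growth.of_le (Growth.payoff (D := D) hΨ'.2.2.2) (Growth.payoff hΨ.2.2.2)
        fun P hP _ => ⟨?_, hWup Ψ hΨ P hP⟩
      linarith [hlow Ψ' hΨ' P hP]
  have hWb : ∀ P, a < P.1 → LocBdd W P := fun P hP => by rw [hW]; exact (hb P hP).env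
  have hmaxi : ∀ w ∈ D.subFamily a, ∀ P, a < P.1 → w P ≤ W P := fun w hw P hP =>
    (hle w hw P hP).trans (hUW P hP)
  obtain ⟨w1, w2, w3, w4⟩ := hWF
  obtain ⟨V, hV⟩ : ∃ V, V = env fun P => -W P := ⟨_, rfl⟩
  have hVsub : D.dual.IsSub a V := by
    by_contra hnot
    rw [hV] at hnot
    obtain ⟨w, e1, e2, e3, ⟨M, e4⟩, e5, P, hP, hlt⟩ := hD.exists_bump w1 w2 hWb hnot
    refine absurd (hmaxi w ⟨e1, e2, fun P hP => (e5 P hP).trans_le (w3 P hP), ?_⟩ P hP)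
      (not_le.2 hlt)
    obtain ⟨C, n, hC⟩ := w4
    refine Growth.of_le (v := fun P => |W P|) (v' := fun P => |W P| + |M|)
      ⟨C, n, by simpa only [abs_abs] using hC⟩ ⟨C + |M|, n, fun t ht x => ?_⟩ fun P _ _ =>
        ⟨(neg_abs_le _).trans (e3 P), (e4 P).trans (max_le ?_ ?_)⟩
    · have h1 : 1 ≤ (1 + ‖x‖ ^ 2) ^ n := one_le_pow₀ (by linarith [sq_nonneg ‖x‖])
      have h2 := hC t ht x
      have h3 := mul_le_mul_of_nonneg_left h1 (abs_nonneg M)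
      rw [abs_of_nonneg (by positivity)]
      linarith
    · linarith [le_abs_self (W P), abs_nonneg M]
    · linarith [le_abs_self M, abs_nonneg (W P)]
  have hVup : ∀ Ψ, D.dual.IsUpperBarrier a Ψ → ∀ P, a < P.1 → V P ≤ D.payoff Ψ P := fun Ψ hΨ P hP => by
    rw [hV]
    exact (hWb P hP).neg.env_le_of_continuousAt (continuous_payoff hΨ.1).continuousAt
      ((hnear P hP).mono fun Q hQ => hlow Ψ hΨ Q hQ)
  have hWV : ∀ P, a < P.1 → -W P ≤ V P := fun P hP => by rw [hV]; exact (hWb P hP).neg.le_env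
  have hVT : ∀ x, V (D.T, x) ≤ -D.g x := fun x => by
    refine le_of_forall_pos_le_add fun ε hε => ?_
    obtain ⟨Ψ, hΨ, hε'⟩ := hD.dual.exists_isUpperBarrier a x hε
    have := hVup Ψ hΨ (D.T, x) ha
    rw [payoff_of_ge Ψ le_rfl] at this
    exact this.trans_eq hε'
  have hVusc : ∀ P, a < P.1 → UpperSemicontinuousAt V P := fun P hP => by
    rw [hV]; exact (hWb P hP).neg.upperSemicontinuousAt_env
  have hVg : D.Growth a V :=
    Growth.of_le w4 (Growth.payoff (D := D) hΨ'.2.2.2) fun P hP _ => ⟨hWV P hP, hVup Ψ' hΨ' P hP⟩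
  have heq : ∀ P, a < P.1 → P.1 ≤ D.T → V P = -W P := fun P hP hP' => by
    have := hD.le_of_isSub w2 hVusc w1 hVsub
      (fun x => by linarith [hVT x, show W (D.T, x) ≤ D.g x from w3 (D.T, x) le_rfl]) w4 hVg P hP hP'
    linarith [hWV P hP]
  refine ⟨W, ?_, w1, hVsub.congr fun p hp => (heq p hp.1 hp.2.le).symm, fun x => ?_, w4⟩
  · rintro P ⟨⟨hP, hP'⟩, -⟩
    refine tendsto_order.2 ⟨fun c hc => ?_, fun c hc => mem_nhdsWithin_of_mem_nhds (w2 P hP c hc)⟩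
    have h1 := hVusc P hP (-c) (by simp only [heq P hP hP']; linarith)
    filter_upwards [mem_nhdsWithin_of_mem_nhds h1, self_mem_nhdsWithin] with Q hQ hQs
    have : V Q < -c := hQ
    linarith [heq Q hQs.1.1 hQs.1.2]
  · exact le_antisymm (w3 (D.T, x) le_rfl) (by linarith [hVT x, heq (D.T, x) ha le_rfl])

end ObstacleData

end Existence

section Data

variable {k d : ℕ}

/-- Projection of time onto `[0, T]`. -/
def clampTime (T t : ℝ) : ℝ := max 0 (min t T)

theorem continuous_clampTime (T : ℝ) : Continuous (clampTime T) := by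
  unfold clampTime; fun_prop

theorem clampTime_mem {T : ℝ} (hT : 0 < T) (t : ℝ) : clampTime T t ∈ Icc 0 T :=
  ⟨le_max_left _ _, max_le hT.le (min_le_right _ _)⟩

theorem clampTime_of_mem {T t : ℝ} (h : t ∈ Icc 0 T) : clampTime T t = t := by
  rw [clampTime, min_eq_left h.2, max_eq_right h.1]

theorem continuous_comp_clampTime {α : Type*} [TopologicalSpace α] (T : ℝ) {F : ℝ → Euc k → α}
    (hF : Continuous fun p : ℝ × Euc k => F p.1 p.2) :
    Continuous fun p : ℝ × Euc k => F (clampTime T p.1) p.2 :=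
  hF.comp (((continuous_clampTime T).comp continuous_fst).prodMk continuous_snd)

/-- The obstacle problem with all coefficients frozen outside `[0, T]`. -/
def obstacleData (T : ℝ) (b : ℝ → Euc k → Fin k → ℝ) (σm : ℝ → Euc k → Matrix (Fin k) (Fin d) ℝ)
    (g : Euc k → ℝ) (f : ℝ → Euc k → ℝ → (Fin d → ℝ) → ℝ) (Hf Lf : ℝ → Euc k → ℝ) :
    ObstacleData k d where
  T := T
  bv := fun t x => WithLp.toLp 2 (b (clampTime T t) x)
  S := fun l t x => WithLp.toLp 2 fun i => σm (clampTime T t) x i l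
  f := fun t => f (clampTime T t)
  H := fun t => Hf (clampTime T t)
  L := fun t => Lf (clampTime T t)
  g := g

theorem norm_le_of_forall_abs_le {v : Euc k} {M : ℝ} (h : ∀ i, |v i| ≤ M) (hM : 0 ≤ M) :
    ‖v‖ ≤ (k + 1) * M := by
  refine abs_le_of_sq_le_sq' ?_ (by positivity) |>.2
  rw [EuclideanSpace.norm_sq_eq]
  calc ∑ i, ‖v i‖ ^ 2 ≤ ∑ _i : Fin k, M ^ 2 := Finset.sum_le_sum fun i _ => by
        rw [Real.norm_eq_abs]; gcongr; exact h i
    _ = k * M ^ 2 := by simp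
    _ ≤ ((k + 1) * M) ^ 2 := by
        rw [mul_pow]
        gcongr
        have : (0 : ℝ) ≤ k := Nat.cast_nonneg k
        nlinarith

theorem exists_sq_norm_le {T : ℝ} {F : ℝ → Euc k → Euc k}
    (hF : Continuous fun p : ℝ × Euc k => F p.1 p.2) {C : ℝ}
    (hC : ∀ t ∈ Icc 0 T, ∀ x y, ‖F t x - F t y‖ ≤ C * ‖x - y‖) :
    ∃ B, 0 ≤ B ∧ ∀ t ∈ Icc 0 T, ∀ x, ‖F t x‖ ^ 2 ≤ B * (1 + ‖x‖ ^ 2) := by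
  have hc : Continuous fun t => ‖F t 0‖ :=
    (hF.comp (continuous_id.prodMk continuous_const)).norm
  obtain ⟨M, hM⟩ := (isCompact_Icc (a := (0 : ℝ)) (b := T)).bddAbove_image hc.continuousOn
  refine ⟨2 * (M ^ 2 + C ^ 2), by positivity, fun t ht x => ?_⟩
  have h1 : ‖F t 0‖ ≤ M := hM (mem_image_of_mem _ ht)
  have h2 := hC t ht x 0
  rw [sub_zero] at h2
  have h3 : ‖F t x‖ ≤ M + C * ‖x‖ := by linarith [norm_le_norm_add_norm_sub' (F t x) (F t 0)]
  have h4 : ‖F t x‖ ^ 2 ≤ (M + C * ‖x‖) ^ 2 := by gcongr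
  nlinarith [sq_nonneg (M - C * ‖x‖), mul_nonneg (sq_nonneg M) (sq_nonneg ‖x‖), sq_nonneg C]

theorem one_add_rpow_le {p r : ℝ} (hp : 0 ≤ p) (hr : 0 ≤ r) :
    1 + r ^ p ≤ 2 * (1 + r ^ 2) ^ ⌈p⌉₊ := by
  have h1 : 1 ≤ 1 + r ^ 2 := by linarith [sq_nonneg r]
  have h2 : r ^ p ≤ (1 + r ^ 2) ^ p := Real.rpow_le_rpow hr (by nlinarith [sq_nonneg (r - 1)]) hp
  have h3 : (1 + r ^ 2) ^ p ≤ (1 + r ^ 2) ^ ((⌈p⌉₊ : ℕ) : ℝ) :=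
    Real.rpow_le_rpow_of_exponent_le h1 (Nat.le_ceil p)
  rw [Real.rpow_natCast] at h3
  linarith [one_le_pow₀ (n := ⌈p⌉₊) h1]

theorem regular_obstacleData {T : ℝ} (hT : 0 < T)
    {b : ℝ → Euc k → Fin k → ℝ} {σm : ℝ → Euc k → Matrix (Fin k) (Fin d) ℝ}
    {g : Euc k → ℝ} {f : ℝ → Euc k → ℝ → (Fin d → ℝ) → ℝ} {Hf Lf : ℝ → Euc k → ℝ}
    (h0 : H0 T b σm)
    (hg : Continuous g)
    (hf : Continuous fun q : (ℝ × Euc k) × ℝ × (Fin d → ℝ) => f q.1.1 q.1.2 q.2.1 q.2.2)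
    (hH : Continuous fun p : ℝ × Euc k => Hf p.1 p.2)
    (hL : Continuous fun p : ℝ × Euc k => Lf p.1 p.2)
    (A1i : ∃ C p : ℝ, 0 ≤ C ∧ 0 ≤ p ∧ ∀ t ∈ Icc (0 : ℝ) T, ∀ x : Euc k,
      |g x| + |f t x 0 0| + |Hf t x| + |Lf t x| ≤ C * (1 + ‖x‖ ^ p))
    (A1ii : ∃ C : ℝ, ∀ (t : ℝ) (x : Euc k) (y y' : ℝ) (z z' : Fin d → ℝ),
      |f t x y z - f t x y' z'| ≤ C * (|y - y'| + ‖z - z'‖))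
    (A1iii : (∀ t ∈ Icc (0 : ℝ) T, ∀ x : Euc k, Lf t x ≤ Hf t x) ∧
      ∀ x : Euc k, Lf T x ≤ g x ∧ g x ≤ Hf T x)
    (A2 : ∀ R > (0 : ℝ), ∃ Φ : ℝ → ℝ, (∀ s, 0 ≤ Φ s) ∧
      (∀ ε > (0 : ℝ), ∃ δ > (0 : ℝ), ∀ s, 0 ≤ s → s < δ → Φ s < ε) ∧
      ∀ t ∈ Ioo (0 : ℝ) T, ∀ x x' : Euc k, ‖x‖ ≤ R → ‖x'‖ ≤ R → ∀ y : ℝ, |y| ≤ R →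
        ∀ z : Fin d → ℝ, |f t x y z - f t x' y z| ≤ Φ ((1 + ‖z‖) * ‖x - x'‖)) :
    (obstacleData T b σm g f Hf Lf).Regular := by
  obtain ⟨hb, hσ, C, hC⟩ := h0
  have hbc : Continuous fun p : ℝ × Euc k => (WithLp.toLp 2 (b p.1 p.2) : Euc k) :=
    (PiLp.continuous_toLp 2 _).comp hb
  have hσc : ∀ l, Continuous fun p : ℝ × Euc k =>
      (WithLp.toLp 2 fun i => σm p.1 p.2 i l : Euc k) := fun l =>
    (PiLp.continuous_toLp 2 _).comp (continuous_pi fun i =>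
      (continuous_apply_apply i l).comp hσ)
  have hbl : ∀ t ∈ Icc 0 T, ∀ x y, ‖(WithLp.toLp 2 (b t x) : Euc k) - WithLp.toLp 2 (b t y)‖ ≤
      (k + 1) * |C| * ‖x - y‖ := fun t ht x y => by
    rw [mul_assoc]
    refine norm_le_of_forall_abs_le (fun i => ((hC t ht x y).1 i).trans ?_) (by positivity)
    exact mul_le_mul_of_nonneg_right (le_abs_self C) (norm_nonneg _)
  have hσl : ∀ l, ∀ t ∈ Icc 0 T, ∀ x y, ‖(WithLp.toLp 2 fun i => σm t x i l : Euc k) -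
      WithLp.toLp 2 fun i => σm t y i l‖ ≤ (k + 1) * |C| * ‖x - y‖ := fun l t ht x y => by
    rw [mul_assoc]
    refine norm_le_of_forall_abs_le (fun i => ((hC t ht x y).2 i l).trans ?_) (by positivity)
    exact mul_le_mul_of_nonneg_right (le_abs_self C) (norm_nonneg _)
  have hτ := clampTime_mem hT
  have hτT : clampTime T T = T := clampTime_of_mem ⟨hT.le, le_rfl⟩
  refine
    { bv_cont := continuous_comp_clampTime (F := fun t x => (WithLp.toLp 2 (b t x) : Euc k)) T hbc
      S_cont := fun l => continuous_comp_clampTime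
        (F := fun t x => (WithLp.toLp 2 fun i => σm t x i l : Euc k)) T (hσc l)
      lip := ⟨(k + 1) * |C|, by positivity, fun t x y =>
        ⟨hbl _ (hτ t) x y, fun l => hσl l _ (hτ t) x y⟩⟩
      lin := ?_
      f_cont := ?_
      f_lip := ?_
      f_mod := ?_
      H_cont := continuous_comp_clampTime T hH
      L_cont := continuous_comp_clampTime T hL
      g_cont := hg
      L_le_H := fun t x => A1iii.1 _ (hτ t) x
      L_le_g := fun x => by simpa only [obstacleData, hτT] using (A1iii.2 x).1
      g_le_H := fun x => by simpa only [obstacleData, hτT] using (A1iii.2 x).2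
      growth := ?_ }
  · obtain ⟨B, hB, hB'⟩ := exists_sq_norm_le (F := fun t x => (WithLp.toLp 2 (b t x) : Euc k))
      hbc hbl
    choose B₁ hB₁ hB₁' using fun l => exists_sq_norm_le
      (F := fun t x => (WithLp.toLp 2 fun i => σm t x i l : Euc k)) (hσc l) (hσl l)
    have hs : 0 ≤ ∑ l, B₁ l := Finset.sum_nonneg fun l _ => hB₁ l
    refine ⟨B + ∑ l, B₁ l, by positivity, fun t x =>
      ⟨(hB' _ (hτ t) x).trans ?_, fun l => (hB₁' l _ (hτ t) x).trans ?_⟩⟩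
    · gcongr; linarith
    · gcongr
      have := Finset.single_le_sum (f := B₁) (fun l _ => hB₁ l) (Finset.mem_univ l)
      linarith
  · have : Continuous fun q : ℝ × (Euc k × ℝ × (Fin d → ℝ)) =>
        ((clampTime T q.1, q.2.1), (q.2.2.1, q.2.2.2)) :=
      ((((continuous_clampTime T).comp continuous_fst).prodMk (by fun_prop)).prodMk (by fun_prop))
    exact hf.comp this
  · obtain ⟨Cf, hCf⟩ := A1ii
    refine ⟨|Cf|, abs_nonneg _, fun t x y y' z z' => (hCf _ x y y' z z').trans ?_⟩
    gcongr
    exact le_abs_self Cf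
  · intro R hR ε hε
    obtain ⟨Φ, -, hΦ, hmod⟩ := A2 R hR
    obtain ⟨δ, hδ, hδ'⟩ := hΦ ε hε
    refine ⟨δ, hδ, fun t x y hx hy r hr z hz => ?_⟩
    have hclosed : IsClosed {s : ℝ | |f s x r z - f s y r z| ≤ ε} := by
      have h1 : ∀ x, Continuous fun s => f s x r z := fun x =>
        hf.comp (f := fun s : ℝ => ((s, x), (r, z))) (by fun_prop)
      exact isClosed_le ((h1 x).sub (h1 y)).abs continuous_const
    have hsub : Ioo 0 T ⊆ {s : ℝ | |f s x r z - f s y r z| ≤ ε} := fun s hs =>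
      (hmod s hs x y hx hy r hr z).trans (hδ' _ (by positivity) hz).le
    have := hclosed.closure_subset_iff.2 hsub
    rw [closure_Ioo hT.ne] at this
    exact this (hτ t)
  · obtain ⟨Cg, p, hCg, hp, hgr⟩ := A1i
    refine ⟨2 * Cg, ⌈p⌉₊, by positivity, fun t x => ?_⟩
    have h1 := hgr _ (hτ t) x
    have h2 := mul_le_mul_of_nonneg_left (one_add_rpow_le hp (norm_nonneg x)) hCg
    have h3 : |g x| + |f (clampTime T t) x 0 0| + |Hf (clampTime T t) x| + |Lf (clampTime T t) x| ≤
      2 * Cg * (1 + ‖x‖ ^ 2) ^ ⌈p⌉₊ := by linarith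
    have e1 := abs_nonneg (g x)
    have e2 := abs_nonneg (f (clampTime T t) x 0 0)
    have e3 := abs_nonneg (Hf (clampTime T t) x)
    have e4 := abs_nonneg (Lf (clampTime T t) x)
    simp only [obstacleData]
    exact ⟨by linarith, by linarith, by linarith, by linarith⟩

end Data

section Viscosity

variable {k d : ℕ} {T : ℝ} {b : ℝ → Euc k → Fin k → ℝ}
  {σm : ℝ → Euc k → Matrix (Fin k) (Fin d) ℝ} {g : Euc k → ℝ}
  {f : ℝ → Euc k → ℝ → (Fin d → ℝ) → ℝ} {Hf Lf : ℝ → Euc k → ℝ}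

theorem clm_apply_eq_sum (A : Euc k →L[ℝ] ℝ) (v : Euc k) :
    A v = ∑ i, v i * A (EuclideanSpace.single i 1) := by
  have hv : v = ∑ i, v i • EuclideanSpace.single i (1 : ℝ) := by
    ext j
    simp [Finset.sum_apply, Pi.single_apply]
  conv_lhs => rw [hv]
  simp only [map_sum, map_smul, smul_eq_mul]

theorem sigGrad_eq {φ : ℝ → Euc k → ℝ} {t : ℝ} (ht : t ∈ Icc 0 T) (x : Euc k) :
    sigGrad σm φ t x = fun l => fderiv ℝ (φ t) x ((obstacleData T b σm g f Hf Lf).S l t x) := by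
  ext l
  rw [clm_apply_eq_sum]
  simp only [sigGrad, pd, obstacleData, clampTime_of_mem ht]

theorem genL_eq {φ : ℝ → Euc k → ℝ} (hφ : IsC12 φ) {t : ℝ} (ht : t ∈ Icc 0 T) (x : Euc k) :
    genL b σm φ t x = 1 / 2 * (obstacleData T b σm g f Hf Lf).hess φ t x +
      fderiv ℝ (φ t) x ((obstacleData T b σm g f Hf Lf).bv t x) := by
  have hpd : ∀ i j, pd i (fun y => pd j (φ t) y) x =
      fderiv ℝ (fderiv ℝ (φ t)) x (EuclideanSpace.single i 1) (EuclideanSpace.single j 1) := by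
    intro i j
    unfold pd
    rw [fderiv_clm_apply (hφ.differentiable_fderiv t x) (differentiableAt_const _)]
    simp
  have h2 : ∀ v : Euc k, fderiv ℝ (fderiv ℝ (φ t)) x v v = ∑ i, ∑ j, v i * v j *
      fderiv ℝ (fderiv ℝ (φ t)) x (EuclideanSpace.single i 1) (EuclideanSpace.single j 1) := by
    intro v
    have : fderiv ℝ (fderiv ℝ (φ t)) x v v =
      ((ContinuousLinearMap.apply ℝ ℝ v).comp (fderiv ℝ (fderiv ℝ (φ t)) x)) v := rfl
    rw [this, clm_apply_eq_sum]
    refine Finset.sum_congr rfl fun i _ => ?_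
    rw [ContinuousLinearMap.comp_apply, ContinuousLinearMap.apply_apply, clm_apply_eq_sum,
      Finset.mul_sum]
    exact Finset.sum_congr rfl fun j _ => by ring
  rw [genL, ObstacleData.hess, clm_apply_eq_sum (fderiv ℝ (φ t) x)]
  congr 2
  · simp only [hpd, h2, obstacleData, clampTime_of_mem ht, Matrix.mul_apply, Matrix.transpose_apply,
      Finset.sum_mul]
    rw [Finset.sum_comm]
    simp_rw [Finset.sum_comm (s := (Finset.univ : Finset (Fin d)))]
    rw [Finset.sum_comm]
  · simp only [pd, obstacleData, clampTime_of_mem ht]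

theorem GΦ_obstacleData {φ : ℝ → Euc k → ℝ} (hφ : IsC12 φ) {t : ℝ} (ht : t ∈ Icc 0 T) (x : Euc k)
    (y : ℝ) : (obstacleData T b σm g f Hf Lf).GΦ φ t x y =
      -timeDeriv φ t x - genL b σm φ t x - f t x y (sigGrad σm φ t x) := by
  rw [genL_eq (T := T) (g := g) (f := f) (Hf := Hf) (Lf := Lf) hφ ht,
    sigGrad_eq (b := b) (g := g) (f := f) (Hf := Hf) (Lf := Lf) ht, ObstacleData.GΦ, ObstacleData.G]
  have : (obstacleData T b σm g f Hf Lf).f t = f t := by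
    simp only [obstacleData, clampTime_of_mem ht]
  rw [this]
  ring

theorem isViscSubsol_iff (hLH : ∀ t ∈ Icc (0 : ℝ) T, ∀ x : Euc k, Lf t x ≤ Hf t x)
    {u : ℝ → Euc k → ℝ} : IsViscSubsol T b σm g (Fmm f Lf Hf) u ↔
      (∀ x, u T x ≤ g x) ∧ (obstacleData T b σm g f Hf Lf).IsSub 0 fun p => u p.1 p.2 := by
  have key : ∀ t ∈ Ioo 0 T, ∀ x φ, IsC12 φ → ∀ y, (Fmm f Lf Hf t x y (timeDeriv φ t x)
      (genL b σm φ t x) (sigGrad σm φ t x) ≤ 0 ↔ y ≤ (obstacleData T b σm g f Hf Lf).H t x ∧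
        (y ≤ (obstacleData T b σm g f Hf Lf).L t x ∨
          (obstacleData T b σm g f Hf Lf).GΦ φ t x y ≤ 0)) := by
    intro t ht x φ hφ y
    have ht' := Ioo_subset_Icc_self ht
    have := hLH t ht' x
    rw [GΦ_obstacleData hφ ht', Fmm, min_le_iff, max_le_iff, sub_nonpos, sub_nonpos]
    simp only [obstacleData, clampTime_of_mem ht']
    constructor
    · rintro (h | h)
      · exact ⟨h.trans this, Or.inl h⟩
      · exact ⟨h.1, Or.inr h.2⟩
    · rintro ⟨h1, h2 | h2⟩
      · exact Or.inl h2
      · exact Or.inr ⟨h1, h2⟩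
  refine and_congr_right fun _ => ⟨fun h t x ht φ hφ hm => ?_, fun h t x ht φ hφ hm _ => ?_⟩
  · have hφc : IsC12 fun s y => φ s y + (u t x - φ t x) := hφ.add (isC12_const _)
    have h1 := h t x ht _ hφc (hm.mono fun p hp => by simp only at hp ⊢; linarith) (by simp)
    have h2 := (key t ht x _ hφc _).1 h1
    rwa [ObstacleData.GΦ_add_const] at h2
  · exact (key t ht x φ hφ _).2 (h t x ht φ hφ hm)

theorem isViscSupersol_iff {u : ℝ → Euc k → ℝ} : IsViscSupersol T b σm g (Fmm f Lf Hf) u ↔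
      (∀ x, g x ≤ u T x) ∧
        (obstacleData T b σm g f Hf Lf).dual.IsSub 0 fun p => -u p.1 p.2 := by
  have key : ∀ t ∈ Ioo 0 T, ∀ x φ, IsC12 φ → ∀ y, (0 ≤ Fmm f Lf Hf t x y (timeDeriv φ t x)
      (genL b σm φ t x) (sigGrad σm φ t x) ↔ -y ≤ (obstacleData T b σm g f Hf Lf).dual.H t x ∧
        (-y ≤ (obstacleData T b σm g f Hf Lf).dual.L t x ∨
          (obstacleData T b σm g f Hf Lf).dual.GΦ (fun t x => -φ t x) t x (-y) ≤ 0)) := by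
    intro t ht x φ hφ y
    have ht' := Ioo_subset_Icc_self ht
    rw [ObstacleData.dual_GΦ_neg, GΦ_obstacleData hφ ht', Fmm, le_min_iff, le_max_iff, sub_nonneg,
      sub_nonneg, neg_nonpos]
    simp only [ObstacleData.dual, obstacleData, clampTime_of_mem ht', neg_le_neg_iff]
  refine and_congr_right fun _ => ⟨fun h t x ht φ hφ hm => ?_, fun h t x ht φ hφ hm _ => ?_⟩
  · have hφc : IsC12 fun s y => -1 * φ s y + (u t x + φ t x) :=
      (hφ.const_mul (-1)).add (isC12_const _)
    have h1 := h t x ht _ hφc (hm.mono fun p hp => by simp only at hp ⊢; linarith) (by simp)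
    have h2 := (key t ht x _ hφc _).1 h1
    have h3 : (fun s y => -(-1 * φ s y + (u t x + φ t x))) =
        fun s y => φ s y + -(u t x + φ t x) := by ext; ring
    rwa [h3, ObstacleData.GΦ_add_const] at h2
  · have hφn : IsC12 fun s y => -φ s y := by simpa only [neg_one_mul] using hφ.const_mul (-1)
    exact (key t ht x φ hφ _).2 (h t x ht _ hφn
      (hm.mono fun p hp => by simp only at hp ⊢; linarith))

theorem PolyGrowth.growth {u : ℝ → Euc k → ℝ} (h : PolyGrowth T u) :
    (obstacleData T b σm g f Hf Lf).Growth 0 fun p => u p.1 p.2 := by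
  obtain ⟨C, γ, hC, hγ, h⟩ := h
  refine ⟨2 * C, ⌈γ⌉₊, fun t ht x => (h t (Ioc_subset_Icc_self ht) x).trans ?_⟩
  have := mul_le_mul_of_nonneg_left (one_add_rpow_le hγ (norm_nonneg x)) hC
  linarith

/-- Comparison of continuous viscosity solutions of polynomial growth. -/
theorem IsViscSol.le (hD : (obstacleData T b σm g f Hf Lf).Regular) (hT : 0 < T)
    (hLH : ∀ t ∈ Icc (0 : ℝ) T, ∀ x : Euc k, Lf t x ≤ Hf t x) {u v : ℝ → Euc k → ℝ}
    (hu : Continuous fun p : ℝ × Euc k => u p.1 p.2) (gu : PolyGrowth T u)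
    (su : IsViscSol T b σm g (Fmm f Lf Hf) u)
    (hv : Continuous fun p : ℝ × Euc k => v p.1 p.2) (gv : PolyGrowth T v)
    (sv : IsViscSol T b σm g (Fmm f Lf Hf) v) {t : ℝ} (ht : t ∈ Icc 0 T) (x : Euc k) :
    u t x ≤ v t x := by
  obtain ⟨u1, u2⟩ := (isViscSubsol_iff hLH).1 su.1
  obtain ⟨v1, v2⟩ := isViscSupersol_iff.1 sv.2
  have key : Ioc 0 T ⊆ {s : ℝ | u s x ≤ v s x} := fun s hs => by
    have : u s x + -v s x ≤ 0 := hD.le_of_isSub (u := fun p => u p.1 p.2) (v := fun p => -v p.1 p.2)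
      (fun P _ => hu.continuousAt.upperSemicontinuousAt)
      (fun P _ => hv.neg.continuousAt.upperSemicontinuousAt) u2 v2
      (fun x => by
        have := (u1 x).trans (v1 x)
        change u T x + -v T x ≤ 0
        linarith) gu.growth gv.growth.neg (s, x) hs.1 hs.2
    change u s x ≤ v s x
    linarith
  have hcl : IsClosed {s : ℝ | u s x ≤ v s x} :=
    isClosed_le (hu.comp (continuous_id.prodMk continuous_const))
      (hv.comp (continuous_id.prodMk continuous_const))
  have := hcl.closure_subset_iff.2 key
  rw [closure_Ioc hT.ne] at this
  exact this ht

theorem exists_isViscSol (hD : (obstacleData T b σm g f Hf Lf).Regular) (hT : 0 < T)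
    (hLH : ∀ t ∈ Icc (0 : ℝ) T, ∀ x : Euc k, Lf t x ≤ Hf t x) :
    ∃ u : ℝ → Euc k → ℝ, Continuous (fun p : ℝ × Euc k => u p.1 p.2) ∧ PolyGrowth T u ∧
      IsViscSol T b σm g (Fmm f Lf Hf) u := by
  obtain ⟨U, hc, h1, h2, h3, C, n, hC⟩ := hD.exists_solution (-1) (by
    change (-1 : ℝ) < T; linarith)
  have hτ := clampTime_mem hT
  have hmono : ∀ {D : ObstacleData k d} {w : ℝ × Euc k → ℝ}, D.IsSub (-1) w → D.IsSub 0 w :=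
    fun h t x ht => h t x ⟨by linarith [ht.1], ht.2⟩
  have heq : ∀ t ∈ Icc 0 T, ∀ x, U (clampTime T t, x) = U (t, x) := fun t ht x => by
    rw [clampTime_of_mem ht]
  have hTT := heq T ⟨hT.le, le_rfl⟩
  refine ⟨fun t x => U (clampTime T t, x), ?_, ⟨|C| * 2 ^ n, 2 * n, by positivity, by positivity,
    fun t ht x => ?_⟩, (isViscSubsol_iff hLH).2 ⟨fun x => ?_, ?_⟩,
    isViscSupersol_iff.2 ⟨fun x => ?_, ?_⟩⟩
  · refine hc.comp_continuous (f := fun p : ℝ × Euc k => (clampTime T p.1, p.2))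
      (((continuous_clampTime T).comp continuous_fst).prodMk continuous_snd) fun p =>
        ⟨⟨?_, (hτ p.1).2⟩, mem_univ _⟩
    change -1 < clampTime T p.1
    linarith [(hτ p.1).1]
  · change |U (clampTime T t, x)| ≤ _
    rw [heq t ht]
    have e1 := hC t ⟨by linarith [ht.1], ht.2⟩ x
    have e2 : (1 + ‖x‖ ^ 2) ^ n ≤ 2 ^ n * (1 + ‖x‖ ^ (2 * (n : ℝ))) := by
      have e3 : ‖x‖ ^ (2 * (n : ℝ)) = (‖x‖ ^ 2) ^ n := by
        rw [← pow_mul, ← Real.rpow_natCast]; push_cast; rfl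
      rw [e3]
      have e4 := add_pow_le (zero_le_one (α := ℝ)) (sq_nonneg ‖x‖) n
      rw [one_pow] at e4
      refine e4.trans ?_
      gcongr
      · norm_num
      · omega
    calc |U (t, x)| ≤ C * (1 + ‖x‖ ^ 2) ^ n := e1
      _ ≤ |C| * (1 + ‖x‖ ^ 2) ^ n := by gcongr; exact le_abs_self C
      _ ≤ |C| * (2 ^ n * (1 + ‖x‖ ^ (2 * (n : ℝ)))) := by gcongr
      _ = _ := by ring
  · exact ((hTT x).trans (h3 x)).le
  · exact (hmono h1).congr fun p hp => heq _ (Ioo_subset_Icc_self hp) _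
  · exact ((hTT x).trans (h3 x)).ge
  · exact (hmono h2).congr fun p hp => by simp only [heq _ (Ioo_subset_Icc_self hp)]

end Viscosity

end

/-- **Theorem 5.2(i)**: under (H0), (A1), (A2), the scalar PDE with two obstacles of
min-max type has a unique continuous viscosity solution of polynomial growth. -/
theorem scalar_two_obstacle_existence_uniqueness
    {k d : ℕ} (hk : 1 ≤ k) (hd : 1 ≤ d) (T : ℝ) (hT : 0 < T)
    (b : ℝ → Euc k → Fin k → ℝ) (σm : ℝ → Euc k → Matrix (Fin k) (Fin d) ℝ)
    (g : Euc k → ℝ) (f : ℝ → Euc k → ℝ → (Fin d → ℝ) → ℝ) (Hf Lf : ℝ → Euc k → ℝ)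
    (h0 : H0 T b σm)
    (hg : Continuous g)
    (hf : Continuous fun q : (ℝ × Euc k) × ℝ × (Fin d → ℝ) => f q.1.1 q.1.2 q.2.1 q.2.2)
    (hH : Continuous fun p : ℝ × Euc k => Hf p.1 p.2)
    (hL : Continuous fun p : ℝ × Euc k => Lf p.1 p.2)
    (A1i : ∃ C p : ℝ, 0 ≤ C ∧ 0 ≤ p ∧ ∀ t ∈ Icc (0 : ℝ) T, ∀ x : Euc k,
      |g x| + |f t x 0 0| + |Hf t x| + |Lf t x| ≤ C * (1 + ‖x‖ ^ p))
    (A1ii : ∃ C : ℝ, ∀ (t : ℝ) (x : Euc k) (y y' : ℝ) (z z' : Fin d → ℝ),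
      |f t x y z - f t x y' z'| ≤ C * (|y - y'| + ‖z - z'‖))
    (A1iii : (∀ t ∈ Icc (0 : ℝ) T, ∀ x : Euc k, Lf t x ≤ Hf t x) ∧
      ∀ x : Euc k, Lf T x ≤ g x ∧ g x ≤ Hf T x)
    (A2 : ∀ R > (0 : ℝ), ∃ Φ : ℝ → ℝ, (∀ s, 0 ≤ Φ s) ∧
      (∀ ε > (0 : ℝ), ∃ δ > (0 : ℝ), ∀ s, 0 ≤ s → s < δ → Φ s < ε) ∧
      ∀ t ∈ Ioo (0 : ℝ) T, ∀ x x' : Euc k, ‖x‖ ≤ R → ‖x'‖ ≤ R → ∀ y : ℝ, |y| ≤ R →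
        ∀ z : Fin d → ℝ, |f t x y z - f t x' y z| ≤ Φ ((1 + ‖z‖) * ‖x - x'‖)) :
    (∃ u : ℝ → Euc k → ℝ,
      Continuous (fun p : ℝ × Euc k => u p.1 p.2) ∧ PolyGrowth T u ∧
      IsViscSol T b σm g (Fmm f Lf Hf) u) ∧
    ∀ u u' : ℝ → Euc k → ℝ,
      (Continuous (fun p : ℝ × Euc k => u p.1 p.2) ∧ PolyGrowth T u ∧
        IsViscSol T b σm g (Fmm f Lf Hf) u) →
      (Continuous (fun p : ℝ × Euc k => u' p.1 p.2) ∧ PolyGrowth T u' ∧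
        IsViscSol T b σm g (Fmm f Lf Hf) u') →
      ∀ t ∈ Icc (0 : ℝ) T, ∀ x : Euc k, u t x = u' t x := by
  have hD := regular_obstacleData hT h0 hg hf hH hL A1i A1ii A1iii A2
  exact ⟨exists_isViscSol hD hT A1iii.1, fun u u' ⟨c, p, s⟩ ⟨c', p', s'⟩ t ht x =>
    le_antisymm (IsViscSol.le hD hT A1iii.1 c p s c' p' s' ht x)
      (IsViscSol.le hD hT A1iii.1 c' p' s' c p s ht x)⟩

end
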